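/- For every n ≥ 1, the outer automorphism group Out(F_n) of the free group F_n of rank n belongs to the class 𝒢: every torsion subgroup of Out(F_n) is finite, and every abelian subgroup of Out(F_n) is finitely generated (hence a direct sum of cyclic groups). -/

import Mathlib

universe u

/-- A (multiplicative) group is a direct sum of cyclic groups if it is isomorphic to
`Multiplicative` of a direct sum `⨁ i, ZMod (n i)` (recall `ZMod 0 = ℤ`). -/
def IsDirectSumOfCyclic (A : Type u) [Group A] : Prop :=
  ∃ (ι : Type u) (n : ι → ℕ),
    Nonempty (A ≃* Multiplicative (DirectSum ι fun i => ZMod (n i)))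

/-- The class `𝒢` of groups: every torsion subgroup is finite and every abelian subgroup is
a direct sum of cyclic groups. -/
def InClassG (G : Type u) [Group G] : Prop :=
  (∀ T : Subgroup G, (∀ x ∈ T, IsOfFinOrder x) → (T : Set G).Finite) ∧
  (∀ A : Subgroup G, (∀ x ∈ A, ∀ y ∈ A, x * y = y * x) → IsDirectSumOfCyclic A)

/-- The subgroup of inner automorphisms is normal in the automorphism group. -/
instance instNormalConjRange {G : Type*} [Group G] :
    (MulAut.conj : G →* MulAut G).range.Normal := by
  constructor
  rintro _ ⟨x, rfl⟩ f
  refine ⟨f x, ?_⟩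
  ext g
  simp [MulAut.conj, MulAut.mul_apply, mul_assoc]

/-- The outer automorphism group of a group: the quotient of the automorphism group by the
inner automorphisms. -/
abbrev OuterAutomorphismGroup (G : Type*) [Group G] : Type _ :=
  MulAut G ⧸ (MulAut.conj : G →* MulAut G).range

/-! ### Simplicial chains modulo two -/

section Chains

open Finset

variable {V : Type*} [DecidableEq V]

/-- Chains with coefficients modulo two on finite subsets of `V`. -/
abbrev Chain (V : Type*) := Finset V →₀ ZMod 2

/-- The boundary map of the augmented chain complex. -/
noncomputable def bd : Chain V →ₗ[ZMod 2] Chain V :=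
  Finsupp.linearCombination (ZMod 2) fun s => ∑ v ∈ s, Finsupp.single (s.erase v) 1

/-- The cone operator with apex `v`. -/
noncomputable def coneOp (v : V) : Chain V →ₗ[ZMod 2] Chain V :=
  Finsupp.linearCombination (ZMod 2) fun s => if v ∈ s then 0 else Finsupp.single (insert v s) 1

/-- The link operator at `v`. -/
noncomputable def linkOp (v : V) : Chain V →ₗ[ZMod 2] Chain V :=
  Finsupp.linearCombination (ZMod 2) fun s => if v ∈ s then Finsupp.single (s.erase v) 1 else 0

lemma bd_single (s : Finset V) :
    bd (Finsupp.single s 1) = ∑ v ∈ s, Finsupp.single (s.erase v) (1 : ZMod 2) := by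
  simp [bd]

lemma coneOp_single (v : V) (s : Finset V) :
    coneOp v (Finsupp.single s 1) = if v ∈ s then 0 else Finsupp.single (insert v s) 1 := by
  simp [coneOp]

lemma linkOp_single (v : V) (s : Finset V) :
    linkOp v (Finsupp.single s 1) = if v ∈ s then Finsupp.single (s.erase v) 1 else 0 := by
  simp [linkOp]

lemma chain_add_self (c : Chain V) : c + c = 0 := by
  ext s; simp [CharTwo.add_self_eq_zero]

lemma chain_sub_eq_add (a b : Chain V) : a - b = a + b := by
  rw [sub_eq_iff_eq_add, add_assoc, chain_add_self, add_zero]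

lemma chain_ext_single {f g : Chain V →ₗ[ZMod 2] Chain V}
    (h : ∀ s, f (Finsupp.single s 1) = g (Finsupp.single s 1)) : f = g := by
  apply Finsupp.lhom_ext'
  intro s
  apply LinearMap.ext_ring
  simpa using h s

lemma bd_bd (c : Chain V) : bd (bd c) = 0 := by
  have : (bd (V := V)).comp bd = 0 := by
    apply chain_ext_single
    intro s
    simp only [LinearMap.comp_apply, bd_single, map_sum, LinearMap.zero_apply]
    rw [Finset.sum_sigma']
    refine Finset.sum_involution (fun p _ => ⟨p.2, p.1⟩) ?_ ?_ ?_ ?_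
    · rintro ⟨a, b⟩ _
      simp only [Finset.erase_right_comm (a := a) (b := b)]
      exact chain_add_self _
    · rintro ⟨a, b⟩ h _ h'
      simp only [Finset.mem_sigma, Finset.mem_erase] at h
      simp only [Sigma.mk.injEq, heq_eq_eq] at h'
      exact h.2.1 h'.1
    · rintro ⟨a, b⟩ h
      simp only [Finset.mem_sigma, Finset.mem_erase] at h ⊢
      exact ⟨h.2.2, Ne.symm h.2.1, h.1⟩
    · rintro ⟨a, b⟩ h
      rfl
  exact LinearMap.congr_fun this c

lemma bd_coneOp (v : V) (c : Chain V) : bd (coneOp v c) + coneOp v (bd c) = c := by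
  have : (bd (V := V)).comp (coneOp v) + (coneOp v).comp bd = LinearMap.id := by
    apply chain_ext_single
    intro s
    simp only [LinearMap.add_apply, LinearMap.comp_apply, bd_single, map_sum, coneOp_single,
      LinearMap.id_apply]
    by_cases hv : v ∈ s
    · rw [if_pos hv, map_zero, zero_add, Finset.sum_eq_single_of_mem v hv]
      · simp [Finset.insert_erase hv]
      · intro u hu huv
        rw [if_pos (Finset.mem_erase.2 ⟨huv.symm, hv⟩)]
    · rw [if_neg hv, bd_single, Finset.sum_insert hv, Finset.erase_insert hv, add_assoc]
      have : ∑ u ∈ s, Finsupp.single ((insert v s).erase u) (1 : ZMod 2) =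
          ∑ u ∈ s, if v ∈ s.erase u then 0 else
            Finsupp.single (insert v (s.erase u)) (1 : ZMod 2) := by
        refine Finset.sum_congr rfl fun u hu => ?_
        have huv : v ≠ u := fun h => hv (h ▸ hu)
        rw [if_neg (fun h => hv (Finset.mem_of_mem_erase h)), Finset.erase_insert_of_ne huv]
      rw [this, chain_add_self, add_zero]
  exact LinearMap.congr_fun this c

lemma linkOp_bd (v : V) (c : Chain V) : linkOp v (bd c) = bd (linkOp v c) := by
  have : (linkOp v).comp bd = (bd (V := V)).comp (linkOp v) := by
    apply chain_ext_single
    intro s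
    simp only [LinearMap.comp_apply, bd_single, map_sum, linkOp_single]
    by_cases hv : v ∈ s
    · rw [if_pos hv, bd_single, ← Finset.add_sum_erase _ _ hv]
      simp only [Finset.notMem_erase, if_false, zero_add]
      refine Finset.sum_congr rfl fun u hu => ?_
      rw [if_pos (Finset.mem_erase.2 ⟨(Finset.ne_of_mem_erase hu).symm, hv⟩),
        Finset.erase_right_comm]
    · rw [if_neg hv, map_zero]
      refine Finset.sum_eq_zero fun u hu => ?_
      rw [if_neg (fun h => hv (Finset.mem_of_mem_erase h))]
  exact LinearMap.congr_fun this c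

/-- Chains all of whose simplices satisfy `P`. -/
noncomputable abbrev chainsOn (P : Finset V → Prop) : Submodule (ZMod 2) (Chain V) :=
  Finsupp.supported (ZMod 2) (ZMod 2) {s | P s}

lemma chainsOn_induction {P : Finset V → Prop} {q : Chain V → Prop} (h0 : q 0)
    (hadd : ∀ a b, q a → q b → q (a + b)) (hs : ∀ s, P s → q (Finsupp.single s 1))
    {c : Chain V} (hc : c ∈ chainsOn P) : q c := by
  rw [chainsOn, Finsupp.supported_eq_span_single] at hc
  refine Submodule.span_induction ?_ h0 (fun a b _ _ => hadd a b) ?_ hc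
  · rintro _ ⟨s, hs', rfl⟩
    exact hs s hs'
  · intro r a _ ha
    rcases (by decide : ∀ r : ZMod 2, r = 0 ∨ r = 1) r with rfl | rfl
    · simpa using h0
    · simpa using ha

lemma single_mem_chainsOn {P : Finset V → Prop} {s : Finset V} (h : P s) :
    Finsupp.single s (1 : ZMod 2) ∈ chainsOn P :=
  Finsupp.single_mem_supported _ _ h

lemma map_mem_chainsOn (f : Chain V →ₗ[ZMod 2] Chain V) {P Q : Finset V → Prop}
    (h : ∀ s, P s → f (Finsupp.single s 1) ∈ chainsOn Q) {c : Chain V} (hc : c ∈ chainsOn P) :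
    f c ∈ chainsOn Q := by
  refine chainsOn_induction (q := fun c => f c ∈ chainsOn Q) ?_ ?_ h hc
  · rw [map_zero]; exact Submodule.zero_mem _
  · intro a b ha hb
    rw [map_add]; exact Submodule.add_mem _ ha hb

lemma linkOp_coneOp {v : V} {P : Finset V → Prop} (hP : ∀ s, P s → v ∉ s) {c : Chain V}
    (hc : c ∈ chainsOn P) : linkOp v (coneOp v c) = c := by
  refine chainsOn_induction (q := fun c => linkOp v (coneOp v c) = c) (by simp) ?_ ?_ hc
  · intro a b ha hb
    rw [map_add, map_add, ha, hb]
  · intro s hs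
    have := hP s hs
    rw [coneOp_single, if_neg this, linkOp_single, if_pos (Finset.mem_insert_self _ _),
      Finset.erase_insert this]

lemma linkOp_apply (v : V) (c : Chain V) {s : Finset V} (hs : v ∈ s) :
    linkOp v c (s.erase v) = c s := by
  induction c using Finsupp.induction_linear with
  | zero => simp
  | add f g hf hg => rw [map_add, Finsupp.add_apply, hf, hg, Finsupp.add_apply]
  | single t r =>
    have : Finsupp.single t r = r • Finsupp.single t (1 : ZMod 2) := by simp
    rw [this, map_smul, linkOp_single]
    by_cases hv : v ∈ t
    · rw [if_pos hv, Finsupp.smul_apply, Finsupp.smul_apply, Finsupp.single_apply,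
        Finsupp.single_apply]
      congr 2
      apply propext
      constructor
      · intro h
        rw [← Finset.insert_erase hv, h, Finset.insert_erase hs]
      · rintro rfl; rfl
    · rw [if_neg hv]
      have : t ≠ s := fun h => hv (h ▸ hs)
      simp [this]

/-- The part of a chain made of simplices with `k` vertices. -/
noncomputable def homPart (k : ℕ) : Chain V →ₗ[ZMod 2] Chain V :=
  Finsupp.linearCombination (ZMod 2) fun s => if s.card = k then Finsupp.single s 1 else 0

lemma homPart_single (k : ℕ) (s : Finset V) : homPart k (Finsupp.single s 1) =
    if s.card = k then Finsupp.single s (1 : ZMod 2) else 0 := by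
  simp [homPart]

lemma bd_homPart (k : ℕ) (c : Chain V) : bd (homPart (k + 1) c) = homPart k (bd c) := by
  have : (bd (V := V)).comp (homPart (k + 1)) = (homPart k).comp bd := by
    apply chain_ext_single
    intro s
    simp only [LinearMap.comp_apply, bd_single, map_sum, homPart_single]
    by_cases h : s.card = k + 1
    · rw [if_pos h, bd_single]
      refine Finset.sum_congr rfl fun u hu => ?_
      rw [if_pos (by rw [Finset.card_erase_of_mem hu, h]; rfl)]
    · rw [if_neg h, map_zero]
      refine (Finset.sum_eq_zero fun u hu => ?_).symm
      rw [if_neg]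
      rw [Finset.card_erase_of_mem hu]
      have := Finset.card_pos.2 ⟨u, hu⟩
      omega
  exact LinearMap.congr_fun this c

lemma homPart_eq_self {k : ℕ} {P : Finset V → Prop} (hP : ∀ s, P s → s.card = k) {c : Chain V}
    (hc : c ∈ chainsOn P) : homPart k c = c := by
  refine chainsOn_induction (q := fun c => homPart k c = c) (by simp) ?_ ?_ hc
  · intro a b ha hb
    rw [map_add, ha, hb]
  · intro s hs
    rw [homPart_single, if_pos (hP s hs)]

end Chains

section CliqueComplex

open Finset

variable {V : Type*} [DecidableEq V] (G : SimpleGraph V)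

/-- Finite cliques of `G` inside `S`. -/
def CliqueIn (S : Set V) (s : Finset V) : Prop := (s : Set V) ⊆ S ∧ G.IsClique (s : Set V)

/-- The augmented clique complex of `S` is acyclic modulo two. -/
def Acyclic (S : Set V) : Prop :=
  ∀ c ∈ chainsOn (CliqueIn G S), bd c = 0 → ∃ b ∈ chainsOn (CliqueIn G S), bd b = c

variable {G}

lemma CliqueIn.subset {S : Set V} {s t : Finset V} (h : CliqueIn G S s) (hts : t ⊆ s) :
    CliqueIn G S t :=
  ⟨(Finset.coe_subset.2 hts).trans h.1, h.2.subset (Finset.coe_subset.2 hts)⟩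

lemma CliqueIn.insert_vertex {S : Set V} {s : Finset V} (h : CliqueIn G S s) {v : V}
    (hv : ∀ u ∈ s, u ≠ v → G.Adj v u) : CliqueIn G (insert v S) (insert v s) := by
  refine ⟨?_, ?_⟩
  · rw [Finset.coe_insert]; exact Set.insert_subset_insert h.1
  · rw [Finset.coe_insert, SimpleGraph.isClique_insert]
    exact ⟨h.2, fun u hu huv => hv u hu huv.symm⟩

lemma CliqueIn.mono {S T : Set V} (hST : S ⊆ T) {s : Finset V} (h : CliqueIn G S s) :
    CliqueIn G T s := ⟨h.1.trans hST, h.2⟩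

lemma acyclic_of_cone {S : Set V} {w : V} (hw : w ∈ S) (h : ∀ u ∈ S, u ≠ w → G.Adj w u) :
    Acyclic G S := by
  intro c hc hbd
  refine ⟨coneOp w c, ?_, ?_⟩
  · refine map_mem_chainsOn _ (fun s hs => ?_) hc
    rw [coneOp_single]
    split_ifs with hws
    · exact Submodule.zero_mem _
    · refine single_mem_chainsOn ?_
      have := hs.insert_vertex (v := w) (fun u hu huw => h u (hs.1 hu) huw)
      rwa [Set.insert_eq_of_mem hw] at this
  · have := bd_coneOp w c
    rwa [hbd, map_zero, add_zero] at this

/-- A cycle can be pushed off a vertex whose link is acyclic. -/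
lemma exists_push {S : Set V} {v : V} (hv : v ∉ S) {c : Chain V}
    (hc : c ∈ chainsOn (CliqueIn G (insert v S))) {b : Chain V}
    (hb : b ∈ chainsOn (CliqueIn G {u ∈ S | G.Adj v u})) (hbc : bd b = linkOp v c) :
    coneOp v b ∈ chainsOn (CliqueIn G (insert v S)) ∧
      c - bd (coneOp v b) ∈ chainsOn (CliqueIn G S) := by
  have hcone : coneOp v b ∈ chainsOn (CliqueIn G (insert v S)) := by
    refine map_mem_chainsOn _ (fun s hs => ?_) hb
    rw [coneOp_single]
    split_ifs with hws
    · exact Submodule.zero_mem _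
    · refine single_mem_chainsOn ?_
      have := hs.insert_vertex (v := v) (fun u hu _ => (hs.1 hu).2)
      exact this.mono (Set.insert_subset_insert fun u hu => hu.1)
  refine ⟨hcone, ?_⟩
  have hbdc : bd (coneOp v b) ∈ chainsOn (CliqueIn G (insert v S)) := by
    refine map_mem_chainsOn _ (fun s hs => ?_) hcone
    rw [bd_single]
    exact Submodule.sum_mem _ fun u hu => single_mem_chainsOn (hs.subset (Finset.erase_subset _ _))
  have hmem := Submodule.sub_mem _ hc hbdc
  have hlink : linkOp v (c - bd (coneOp v b)) = 0 := by
    rw [map_sub, linkOp_bd, linkOp_coneOp (P := CliqueIn G {u ∈ S | G.Adj v u}) _ hb, hbc, sub_self]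
    intro s hs hvs
    exact hv (hs.1 hvs).1
  rw [Finsupp.mem_supported] at hmem ⊢
  intro s hs
  have h1 := hmem hs
  refine ⟨fun u hu => ?_, h1.2⟩
  rcases h1.1 hu with rfl | h
  · exfalso
    have := linkOp_apply u (c - bd (coneOp u b)) hu
    rw [hlink] at this
    exact (Finsupp.mem_support_iff.1 hs) this.symm
  · exact h

lemma linkOp_mem {S : Set V} {v : V} {c : Chain V}
    (hc : c ∈ chainsOn (CliqueIn G (insert v S))) :
    linkOp v c ∈ chainsOn (CliqueIn G {u ∈ S | G.Adj v u}) := by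
  refine map_mem_chainsOn _ (fun s hs => ?_) hc
  rw [linkOp_single]
  split_ifs with hvs
  · refine single_mem_chainsOn ⟨fun u hu => ?_, ?_⟩
    · have hu' := Finset.mem_erase.1 (Finset.mem_coe.1 hu)
      refine ⟨(hs.1 hu'.2).resolve_left hu'.1, ?_⟩
      exact hs.2 hvs hu'.2 (Ne.symm hu'.1)
    · exact hs.2.subset (Finset.coe_subset.2 (Finset.erase_subset _ _))
  · exact Submodule.zero_mem _

lemma acyclic_insert {S : Set V} {v : V} (hv : v ∉ S) (hS : Acyclic G S)
    (hL : Acyclic G {u ∈ S | G.Adj v u}) : Acyclic G (insert v S) := by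
  intro c hc hbd
  obtain ⟨b, hb, hbc⟩ := hL _ (linkOp_mem hc) (by rw [← linkOp_bd, hbd, map_zero])
  obtain ⟨h1, h2⟩ := exists_push hv hc hb hbc
  obtain ⟨d, hd, hdc⟩ := hS _ h2 (by rw [map_sub, hbd, bd_bd, sub_zero])
  refine ⟨coneOp v b + d, Submodule.add_mem _ h1 ?_, ?_⟩
  · exact Finsupp.supported_mono (fun s hs => CliqueIn.mono (Set.subset_insert _ _) hs) hd
  · rw [map_add, hdc]; abel

/-- Adding finitely many dominated vertices preserves acyclicity. -/
lemma acyclic_of_dismantle {T : Set V} (hT : Acyclic G T) (S : Finset V) (hTS : T ⊆ S)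
    (h : ∀ S' : Finset V, S' ⊆ S → T ⊂ S' → ∃ v ∈ S', v ∉ T ∧
      ∃ w ∈ S', G.Adj v w ∧ ∀ u ∈ S', G.Adj v u → u ≠ w → G.Adj w u) :
    Acyclic G (S : Set V) := by
  have key : ∀ (k : ℕ) (S' : Finset V), S'.card = k → S' ⊆ S → T ⊆ S' →
      Acyclic G (S' : Set V) := by
    intro k
    induction k with
    | zero =>
      intro S' hk _ hTS'
      rw [Finset.card_eq_zero] at hk
      subst hk
      have : T = ((∅ : Finset V) : Set V) := by
        apply Set.Subset.antisymm hTS'; simp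
      rwa [← this]
    | succ k ih =>
      intro S' hk hS' hTS'
      by_cases heq : T = S'
      · rwa [← heq]
      obtain ⟨v, hv, hvT, w, hw, hvw, hdom⟩ := h S' hS' (LE.le.ssubset_of_ne hTS' heq)
      have hcard : (S'.erase v).card = k := by rw [Finset.card_erase_of_mem hv, hk]; rfl
      have hac := ih (S'.erase v) hcard ((Finset.erase_subset _ _).trans hS') (fun u hu => by
        rw [Finset.mem_coe, Finset.mem_erase]
        exact ⟨fun h => hvT (h ▸ hu), hTS' hu⟩)
      rw [← Finset.insert_erase hv, Finset.coe_insert]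
      refine acyclic_insert (by simp) hac (acyclic_of_cone (w := w) ?_ ?_)
      · exact ⟨by simp [hw, (G.ne_of_adj hvw).symm], hvw⟩
      · rintro u ⟨hu, hvu⟩ huw
        exact hdom u (Finset.mem_of_mem_erase hu) hvu huw
  exact key _ S rfl (Finset.Subset.refl _) hTS

/-- If every descending link is empty or acyclic, the clique complex has no homology in positive
degrees. -/
lemma exists_bd_eq_of_descending (r : V → ℕ) (hr : Function.Injective r)
    (hD : ∀ v, {u | r u < r v ∧ G.Adj v u} = ∅ ∨ Acyclic G {u | r u < r v ∧ G.Adj v u})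
    {k : ℕ} (hk : 2 ≤ k) {c : Chain V}
    (hc : c ∈ chainsOn fun s => G.IsClique (s : Set V) ∧ s.card = k) (hbd : bd c = 0) :
    ∃ b ∈ chainsOn fun s => G.IsClique (s : Set V) ∧ s.card = k + 1, bd b = c := by
  have hpart : ∀ (j : ℕ) (P : Finset V → Prop) (b : Chain V), b ∈ chainsOn P →
      homPart j b ∈ chainsOn fun s => P s ∧ s.card = j := by
    intro j P b hb
    refine map_mem_chainsOn _ (fun s hs => ?_) hb
    rw [homPart_single]
    split_ifs with h
    · exact single_mem_chainsOn ⟨hs, h⟩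
    · exact Submodule.zero_mem _
  have key : ∀ (N : ℕ) (c : Chain V),
      c ∈ chainsOn (CliqueIn G {u | r u < N}) → homPart k c = c → bd c = 0 →
      ∃ b ∈ chainsOn (CliqueIn G Set.univ), bd b = c := by
    intro N
    induction N with
    | zero =>
      intro c hc hck _
      refine ⟨0, Submodule.zero_mem _, ?_⟩
      rw [map_zero, ← hck]
      symm
      refine chainsOn_induction (q := fun c => homPart k c = 0) (by simp) ?_ ?_ hc
      · intro a b ha hb
        rw [map_add, ha, hb, add_zero]
      · intro s hs
        rw [homPart_single, if_neg]
        intro hcard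
        obtain ⟨u, hu⟩ := Finset.card_pos.1 (by omega : 0 < s.card)
        have := hs.1 hu
        simp at this
    | succ N ih =>
      intro c hc hck hbd
      by_cases hex : ∃ v, r v = N
      · obtain ⟨v, hv⟩ := hex
        have hset : {u | r u < N + 1} = insert v {u | r u < N} := by
          ext u
          simp only [Set.mem_ofPred_eq, Set.mem_insert_iff]
          constructor
          · intro h
            by_cases h' : r u = N
            · left; exact hr (h'.trans hv.symm)
            · right; omega
          · rintro (rfl | h) <;> omega
        rw [hset] at hc
        have hlm := linkOp_mem hc
        have hDv : {u | u ∈ {u | r u < N} ∧ G.Adj v u} = {u | r u < r v ∧ G.Adj v u} := by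
          ext u; simp [hv]
        have hlk : homPart (k - 1) (linkOp v c) = linkOp v c := by
          have hc' : c ∈ chainsOn fun s => s.card = k := by
            rw [← hck]
            exact Finsupp.supported_mono (fun s hs => hs.2) (hpart k _ _ hc)
          have : linkOp v c ∈ chainsOn fun s => s.card = k - 1 := by
            refine map_mem_chainsOn _ (fun s hs => ?_) hc'
            rw [linkOp_single]
            split_ifs with h
            · refine single_mem_chainsOn ?_
              rw [Finset.card_erase_of_mem h, hs]
            · exact Submodule.zero_mem _
          exact homPart_eq_self (fun s hs => hs) this
        obtain ⟨b, hb, hbc⟩ : ∃ b ∈ chainsOn (CliqueIn G {u | u ∈ {u | r u < N} ∧ G.Adj v u}),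
            bd b = linkOp v c := by
          rcases hD v with h | h
          · refine ⟨0, Submodule.zero_mem _, ?_⟩
            rw [map_zero, ← hlk]
            symm
            refine chainsOn_induction (q := fun c => homPart (k - 1) c = 0) (by simp) ?_ ?_ hlm
            · intro a b ha hb
              rw [map_add, ha, hb, add_zero]
            · intro s hs
              rw [homPart_single, if_neg]
              intro hcard
              obtain ⟨u, hu⟩ := Finset.card_pos.1 (by omega : 0 < s.card)
              have hu' := hs.1 hu
              rw [hDv, h] at hu'
              exact hu'
          · rw [← hDv] at h
            exact h _ hlm (by rw [← linkOp_bd, hbd, map_zero])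
        have hvN : v ∉ {u | r u < N} := by simp [hv]
        have hb' : homPart k b ∈ chainsOn (CliqueIn G {u | u ∈ {u | r u < N} ∧ G.Adj v u}) :=
          Finsupp.supported_mono (fun s hs => hs.1) (hpart k _ _ hb)
        have hbc' : bd (homPart k b) = linkOp v c := by
          obtain ⟨j, rfl⟩ : ∃ j, k = j + 1 := ⟨k - 1, by omega⟩
          rw [bd_homPart, hbc]; exact hlk
        obtain ⟨h1, h2⟩ := exists_push hvN hc hb' hbc'
        have hcone : homPart (k + 1) (coneOp v (homPart k b)) = coneOp v (homPart k b) := by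
          have : coneOp v (homPart k b) ∈ chainsOn fun s => s.card = k + 1 := by
            refine map_mem_chainsOn _ (fun s hs => ?_) (hpart k _ _ hb)
            rw [coneOp_single]
            split_ifs with h
            · exact Submodule.zero_mem _
            · refine single_mem_chainsOn ?_
              rw [Finset.card_insert_of_notMem h, hs.2]
          exact homPart_eq_self (fun s hs => hs) this
        obtain ⟨d, hd, hdc⟩ := ih _ h2 (by
          rw [map_sub, hck, ← bd_homPart, hcone]) (by rw [map_sub, hbd, bd_bd, sub_zero])
        refine ⟨coneOp v (homPart k b) + d, Submodule.add_mem _ ?_ hd, ?_⟩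
        · exact Finsupp.supported_mono (fun s hs => CliqueIn.mono (Set.subset_univ _) hs) h1
        · rw [map_add, hdc]; abel
      · refine ih c ?_ hck hbd
        have : {u | r u < N + 1} = {u | r u < N} := by
          ext u
          simp only [Set.mem_ofPred_eq]
          have : r u ≠ N := fun h => hex ⟨u, h⟩
          omega
        rwa [this] at hc
  obtain ⟨N, hN⟩ : ∃ N, ∀ s ∈ c.support, ∀ u ∈ s, r u < N := by
    refine ⟨(c.support.biUnion id).sup r + 1, fun s hs u hu => Nat.lt_succ_of_le ?_⟩
    exact Finset.le_sup (f := r) (Finset.mem_biUnion.2 ⟨s, hs, hu⟩)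
  have hcN : c ∈ chainsOn (CliqueIn G {u | r u < N}) := by
    rw [Finsupp.mem_supported] at hc ⊢
    intro s hs
    have h1 : G.IsClique (s : Set V) ∧ s.card = k := hc hs
    exact (⟨fun u hu => hN s hs u hu, h1.1⟩ : CliqueIn G {u | r u < N} s)
  obtain ⟨b, hb, hbc⟩ := key N c hcN (homPart_eq_self (fun s hs => hs.2) hc) hbd
  refine ⟨homPart (k + 1) b, ?_, ?_⟩
  · refine Finsupp.supported_mono ?_ (hpart (k + 1) _ _ hb)
    intro s hs
    exact (⟨hs.1.2, hs.2⟩ : G.IsClique (s : Set V) ∧ s.card = k + 1)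
  · rw [bd_homPart, hbc, homPart_eq_self (fun s hs => hs.2) hc]

end CliqueComplex

/-! ### Ranks of free abelian groups acting on acyclic complexes -/

section Regular

variable {Γ X : Type*} [CommGroup Γ] [MulAction Γ X]

/-- The action of a group element on chains. -/
noncomputable def act (g : Γ) : (X →₀ ZMod 2) →ₗ[ZMod 2] (X →₀ ZMod 2) :=
  Finsupp.lmapDomain (ZMod 2) (ZMod 2) (g • ·)

lemma act_single (g : Γ) (x : X) :
    act g (Finsupp.single x (1 : ZMod 2)) = Finsupp.single (g • x) 1 := by
  simp [act]

lemma act_comm (g h : Γ) (c : X →₀ ZMod 2) : act g (act h c) = act h (act g c) := by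
  simp only [act, Finsupp.lmapDomain_apply, ← Finsupp.mapDomain_comp]
  congr 1
  ext x
  simp [smul_smul, mul_comm]

/-- The submodule generated by the differences `c - t i • c` with `i < j`. -/
noncomputable def augSub (t : ℕ → Γ) : ℕ → Submodule (ZMod 2) (X →₀ ZMod 2)
  | 0 => ⊥
  | j + 1 => augSub t j ⊔ LinearMap.range (LinearMap.id - act (X := X) (t j))

lemma mem_augSub_succ {t : ℕ → Γ} {j : ℕ} {c : X →₀ ZMod 2} :
    c ∈ augSub t (j + 1) ↔ ∃ w ∈ augSub t j, ∃ v : X →₀ ZMod 2, c = w + (v - act (t j) v) := by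
  rw [augSub, Submodule.mem_sup]
  constructor
  · rintro ⟨w, hw, _, ⟨v, rfl⟩, rfl⟩
    exact ⟨w, hw, v, by simp⟩
  · rintro ⟨w, hw, v, rfl⟩
    exact ⟨w, hw, _, ⟨v, rfl⟩, by simp⟩

lemma augSub_induction {t : ℕ → Γ} {f : (X →₀ ZMod 2) →ₗ[ZMod 2] (X →₀ ZMod 2)}
    (hf : ∀ g : Γ, ∀ c, f (act g c) = act g (f c)) :
    ∀ (j : ℕ) {c : X →₀ ZMod 2}, c ∈ augSub t j → f c ∈ augSub t j
  | 0, c, hc => by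
    simp only [augSub, Submodule.mem_bot] at hc ⊢
    rw [hc, map_zero]
  | j + 1, c, hc => by
    rw [mem_augSub_succ] at hc ⊢
    obtain ⟨w, hw, v, rfl⟩ := hc
    exact ⟨f w, augSub_induction hf j hw, f v, by rw [map_add, map_sub, hf]⟩

lemma single_sub_mem_augSub {t : ℕ → Γ} {j : ℕ} {h : Γ}
    (hh : h ∈ Subgroup.closure (t '' Set.Iio j)) :
    ∀ x : X, Finsupp.single x (1 : ZMod 2) - Finsupp.single (h • x) 1 ∈ augSub t j := by
  induction hh using Subgroup.closure_induction with
  | mem g hg =>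
    obtain ⟨i, hi, rfl⟩ := hg
    intro x
    have : ∀ j, i < j → Finsupp.single x (1 : ZMod 2) - Finsupp.single (t i • x) 1 ∈
        augSub t j := by
      intro j hij
      induction j with
      | zero => omega
      | succ j ih =>
        rcases Nat.lt_succ_iff_lt_or_eq.1 hij with h | rfl
        · exact Submodule.mem_sup_left (ih h)
        · exact mem_augSub_succ.2 ⟨0, Submodule.zero_mem _, Finsupp.single x 1, by
            rw [act_single, zero_add]⟩
    exact this j hi
  | one => intro x; simp
  | mul g h _ _ hg hh =>
    intro x
    have := Submodule.add_mem _ (hh x) (hg (h • x))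
    rwa [sub_add_sub_cancel, smul_smul] at this
  | inv g _ hg =>
    intro x
    have := Submodule.neg_mem _ (hg (g⁻¹ • x))
    rwa [smul_inv_smul, neg_sub] at this

lemma mem_augSub_of_sub_act_mem {t : ℕ → Γ} {j : ℕ} {v : X →₀ ZMod 2}
    (ht : ∀ k : ℕ, 0 < k → t j ^ k ∉ Subgroup.closure (t '' Set.Iio j))
    (hv : ∀ x ∈ v.support, ∀ g : Γ, g • x = x → g = 1)
    (h : v - act (t j) v ∈ augSub t j) : v ∈ augSub t j := by
  classical
  set H := Subgroup.closure (t '' Set.Iio j) with hH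
  let Q := MulAction.orbitRel.Quotient H X
  let mk : X → Q := Quotient.mk _
  have hmk : ∀ x y : X, mk x = mk y ↔ ∃ g ∈ H, g • y = x := by
    intro x y
    rw [Quotient.eq]
    show MulAction.orbitRel H X x y ↔ _
    rw [MulAction.orbitRel_apply, MulAction.mem_orbit_iff]
    constructor
    · rintro ⟨g, hg⟩; exact ⟨g, g.2, hg⟩
    · rintro ⟨g, hg, h⟩; exact ⟨⟨g, hg⟩, h⟩
  let τ : Q → Q := Quotient.map (t j • ·) (by
    intro x y hxy
    obtain ⟨g, hg, rfl⟩ := (hmk x y).1 (Quotient.sound hxy)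
    exact Quotient.exact ((hmk _ _).2 ⟨g, hg, by rw [smul_smul, smul_smul, mul_comm]⟩))
  have hτmk : ∀ x, τ (mk x) = mk (t j • x) := fun x => rfl
  have hτ : Function.Injective τ := by
    intro p q
    induction p using Quotient.inductionOn
    induction q using Quotient.inductionOn
    rename_i x y
    intro hxy
    obtain ⟨g, hg, hxy⟩ := (hmk _ _).1 hxy
    refine (hmk _ _).2 ⟨g, hg, ?_⟩
    apply MulAction.injective (t j)
    simp only at hxy ⊢
    rw [← hxy, smul_smul, smul_smul, mul_comm]
  let π : (X →₀ ZMod 2) →ₗ[ZMod 2] (Q →₀ ZMod 2) := Finsupp.lmapDomain _ _ mk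
  have hπ0 : ∀ i, i ≤ j → ∀ c ∈ augSub (X := X) t i, π c = 0 := by
    intro i
    induction i with
    | zero =>
      intro _ c hc
      simp only [augSub, Submodule.mem_bot] at hc
      rw [hc, map_zero]
    | succ i ih =>
      intro hi c hc
      obtain ⟨w, hw, u, rfl⟩ := mem_augSub_succ.1 hc
      rw [map_add, ih (by omega) w hw, zero_add, map_sub, sub_eq_zero]
      simp only [π, act, Finsupp.lmapDomain_apply, ← Finsupp.mapDomain_comp]
      congr 1
      ext x
      refine (hmk _ _).2 ⟨(t i)⁻¹, H.inv_mem (Subgroup.subset_closure ⟨i, hi, rfl⟩), ?_⟩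
      simp
  have hinv : ∀ q, π v (τ q) = π v q := by
    intro q
    have h1 : π v = π (act (t j) v) := by
      have := hπ0 j le_rfl _ h
      rwa [map_sub, sub_eq_zero] at this
    have h2 : π (act (t j) v) = Finsupp.mapDomain τ (π v) := by
      simp only [π, act, Finsupp.lmapDomain_apply, ← Finsupp.mapDomain_comp]
      rfl
    conv_lhs => rw [h1, h2]
    exact Finsupp.mapDomain_apply hτ _ _
  have hπv : π v = 0 := by
    by_contra hne
    obtain ⟨q, hq⟩ := Finsupp.support_nonempty_iff.2 hne
    obtain ⟨x, hx, rfl⟩ := Finset.mem_image.1 (Finsupp.mapDomain_support hq)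
    have hall : ∀ k : ℕ, mk (t j ^ k • x) ∈ (π v).support := by
      intro k
      induction k with
      | zero => simpa using hq
      | succ k ih =>
        rw [Finsupp.mem_support_iff] at ih ⊢
        rwa [pow_succ', mul_smul, ← hτmk, hinv]
    have hlt : ∀ a b : ℕ, a < b → mk (t j ^ a • x) ≠ mk (t j ^ b • x) := by
      intro a b hab he
      obtain ⟨g, hg, hgx⟩ := (hmk _ _).1 he.symm
      have h3 : (g⁻¹ * t j ^ (b - a)) • x = x := by
        have e : t j ^ b = t j ^ a * t j ^ (b - a) := by rw [← pow_add]; congr 1; omega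
        apply MulAction.injective (g * t j ^ a)
        simp only
        rw [smul_smul, mul_smul g, hgx, e]
        congr 1
        rw [mul_comm g⁻¹, ← mul_assoc, mul_comm g, mul_assoc, mul_assoc,  mul_comm _ g⁻¹,
          mul_inv_cancel_left]
      have h4 := hv x hx _ h3
      exact ht (b - a) (by omega) (by
        rw [← eq_of_inv_mul_eq_one h4]; exact hg)
    refine not_injective_infinite_finite
      (fun k : ℕ => (⟨mk (t j ^ k • x), hall k⟩ : (π v).support)) ?_
    intro a b hab
    by_contra hne
    have := Subtype.ext_iff.1 hab
    rcases lt_or_gt_of_ne hne with hlt' | hlt'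
    · exact hlt _ _ hlt' this
    · exact hlt _ _ hlt' this.symm
  let σ : (Q →₀ ZMod 2) →ₗ[ZMod 2] (X →₀ ZMod 2) :=
    Finsupp.linearCombination (ZMod 2) fun q => Finsupp.single q.out 1
  have hσ : ∀ c : X →₀ ZMod 2, c - σ (π c) ∈ augSub t j := by
    intro c
    induction c using Finsupp.induction_linear with
    | zero => simp
    | add f g hf hg =>
      have := Submodule.add_mem _ hf hg
      rw [map_add, map_add]
      convert this using 1
      abel
    | single x r =>
      have e1 : Finsupp.single x r = r • Finsupp.single x (1 : ZMod 2) := by simp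
      rw [e1, map_smul, map_smul, ← smul_sub]
      refine Submodule.smul_mem _ _ ?_
      have e2 : σ (π (Finsupp.single x 1)) = Finsupp.single (mk x).out 1 := by
        simp [σ, π]
      rw [e2]
      obtain ⟨g, hg, hgx⟩ := (hmk (mk x).out x).1 (Quotient.out_eq _)
      rw [← hgx]
      exact single_sub_mem_augSub hg x
  have := hσ v
  rwa [hπv, map_zero, sub_zero] at this

end Regular

section Rank

open scoped Pointwise

variable {Γ V : Type*} [CommGroup Γ] [DecidableEq V] [MulAction Γ V] {G : SimpleGraph V}

lemma smul_finset_free (htf : ∀ g : Γ, ∀ k : ℕ, 0 < k → g ^ k = 1 → g = 1)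
    (hfree : ∀ (g : Γ) (v : V), g • v = v → g = 1) {s : Finset V} (hs : s.Nonempty) {g : Γ}
    (h : g • s = s) : g = 1 := by
  obtain ⟨v, hv⟩ := hs
  have hall : ∀ k : ℕ, g ^ k • v ∈ s := by
    intro k
    induction k with
    | zero => simpa
    | succ k ih =>
      rw [pow_succ', mul_smul, ← h]
      exact Finset.smul_mem_smul_finset ih
  have hninj := not_injective_infinite_finite (fun k : ℕ => (⟨g ^ k • v, hall k⟩ : s))
  have key : ∀ a b : ℕ, a < b → g ^ a • v = g ^ b • v → g = 1 := by
    intro a b hab he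
    refine htf g (b - a) (by omega) (hfree _ v ?_)
    apply MulAction.injective (g ^ a)
    simp only
    rw [smul_smul, ← pow_add, he]
    congr 2
    omega
  by_contra hg
  apply hninj
  intro a b hab
  have := Subtype.ext_iff.1 hab
  by_contra hne
  rcases lt_or_gt_of_ne hne with hlt | hlt
  · exact hg (key _ _ hlt this)
  · exact hg (key _ _ hlt this.symm)

lemma bd_act (g : Γ) (c : Chain V) : bd (act g c) = act g (bd c) := by
  have : (bd (V := V)).comp (act g) = (act g).comp bd := by
    apply chain_ext_single
    intro s
    simp only [LinearMap.comp_apply, act_single, bd_single, map_sum]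
    rw [Finset.smul_finset_def, Finset.sum_image (fun a _ b _ h => MulAction.injective g h)]
    refine Finset.sum_congr rfl fun u _ => ?_
    rw [Finset.smul_finset_def, Finset.image_erase (MulAction.injective g)]
  exact LinearMap.congr_fun this c

/-- The cliques with `k` vertices. -/
def CliqueCard (G : SimpleGraph V) (k : ℕ) (s : Finset V) : Prop :=
  G.IsClique (s : Set V) ∧ s.card = k

open Classical in
/-- The projection of chains onto the clique chains of size `k`. -/
noncomputable def cliquePart (G : SimpleGraph V) (k : ℕ) : Chain V →ₗ[ZMod 2] Chain V :=
  Finsupp.linearCombination (ZMod 2) fun s =>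
    if CliqueCard G k s then Finsupp.single s 1 else 0

lemma cliquePart_mem (k : ℕ) (c : Chain V) : cliquePart G k c ∈ chainsOn (CliqueCard G k) := by
  classical
  refine map_mem_chainsOn (P := fun _ => True) _ (fun s _ => ?_) (by simp [chainsOn])
  rw [cliquePart, Finsupp.linearCombination_single, one_smul]
  split_ifs with h
  · exact single_mem_chainsOn h
  · exact Submodule.zero_mem _

lemma cliquePart_eq_self {k : ℕ} {c : Chain V} (hc : c ∈ chainsOn (CliqueCard G k)) :
    cliquePart G k c = c := by
  classical
  refine chainsOn_induction (q := fun c => cliquePart G k c = c) (by simp) ?_ ?_ hc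
  · intro a b ha hb
    rw [map_add, ha, hb]
  · intro s hs
    rw [cliquePart, Finsupp.linearCombination_single, one_smul, if_pos hs]

lemma isClique_smul (hadj : ∀ (g : Γ) (u v : V), G.Adj (g • u) (g • v) ↔ G.Adj u v) (g : Γ)
    (s : Finset V) : G.IsClique ((g • s : Finset V) : Set V) ↔ G.IsClique (s : Set V) := by
  simp only [SimpleGraph.isClique_iff, Set.Pairwise, Finset.mem_coe]
  constructor
  · intro h x hx y hy hxy
    rw [← hadj g]
    exact h (Finset.smul_mem_smul_finset hx) (Finset.smul_mem_smul_finset hy)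
      (fun e => hxy (MulAction.injective g e))
  · intro h x hx y hy hxy
    obtain ⟨x', hx', rfl⟩ := Finset.mem_smul_finset.1 hx
    obtain ⟨y', hy', rfl⟩ := Finset.mem_smul_finset.1 hy
    rw [hadj]
    exact h hx' hy' (fun e => hxy (by rw [e]))

lemma cliqueCard_smul (hadj : ∀ (g : Γ) (u v : V), G.Adj (g • u) (g • v) ↔ G.Adj u v) (g : Γ)
    (k : ℕ) (s : Finset V) : CliqueCard G k (g • s) ↔ CliqueCard G k s := by
  rw [CliqueCard, CliqueCard, isClique_smul hadj, Finset.card_smul_finset]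

lemma cliquePart_act (hadj : ∀ (g : Γ) (u v : V), G.Adj (g • u) (g • v) ↔ G.Adj u v) (k : ℕ)
    (g : Γ) (c : Chain V) : cliquePart G k (act g c) = act g (cliquePart G k c) := by
  classical
  have : (cliquePart G k).comp (act g) = (act g).comp (cliquePart G k) := by
    apply chain_ext_single
    intro s
    simp only [LinearMap.comp_apply, act_single, cliquePart, Finsupp.linearCombination_single,
      one_smul, cliqueCard_smul hadj]
    split_ifs
    · rw [act_single]
    · rw [map_zero]
  exact LinearMap.congr_fun this c

lemma bd_mem_chainsOn {k : ℕ} {c : Chain V} (hc : c ∈ chainsOn (CliqueCard G (k + 1))) :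
    bd c ∈ chainsOn (CliqueCard G k) := by
  refine map_mem_chainsOn _ (fun s hs => ?_) hc
  rw [bd_single]
  refine Submodule.sum_mem _ fun u hu => single_mem_chainsOn ⟨?_, ?_⟩
  · exact hs.1.subset (Finset.coe_subset.2 (Finset.erase_subset _ _))
  · rw [Finset.card_erase_of_mem hu, hs.2]; rfl

/-- A group containing a suitably independent sequence of `m` elements that acts freely on a graph
with acyclic clique complex forces a clique with `m + 1` vertices. -/
theorem exists_clique_of_independent [Nonempty V]
    (hadj : ∀ (g : Γ) (u v : V), G.Adj (g • u) (g • v) ↔ G.Adj u v)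
    (htf : ∀ g : Γ, ∀ k : ℕ, 0 < k → g ^ k = 1 → g = 1)
    (hfree : ∀ (g : Γ) (v : V), g • v = v → g = 1)
    (hconn : ∀ u v : V, ∃ b ∈ chainsOn (CliqueCard G 2),
      bd b = Finsupp.single {u} 1 - Finsupp.single {v} 1)
    (hac : ∀ k, 2 ≤ k → ∀ c ∈ chainsOn (CliqueCard G k), bd c = 0 →
      ∃ b ∈ chainsOn (CliqueCard G (k + 1)), bd b = c)
    (t : ℕ → Γ) (m : ℕ)
    (ht : ∀ j < m, ∀ k : ℕ, 0 < k → t j ^ k ∉ Subgroup.closure (t '' Set.Iio j)) :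
    ∃ s : Finset V, CliqueCard G (m + 1) s := by
  have hactC : ∀ (g : Γ) (k : ℕ) (c : Chain V), c ∈ chainsOn (CliqueCard G k) →
      act g c ∈ chainsOn (CliqueCard G k) := by
    intro g k c hc
    rw [← cliquePart_eq_self hc, ← cliquePart_act hadj]
    exact cliquePart_mem _ _
  have hsplit : ∀ (j k : ℕ) (c : Chain V), c ∈ chainsOn (CliqueCard G k) →
      c ∈ augSub t (j + 1) → ∃ w ∈ augSub t j, w ∈ chainsOn (CliqueCard G k) ∧
        ∃ v ∈ chainsOn (CliqueCard G k), c = w + (v - act (t j) v) := by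
    intro j k c hc hcI
    obtain ⟨w, hw, v, hwv⟩ := mem_augSub_succ.1 hcI
    refine ⟨cliquePart G k w, augSub_induction (fun g c => cliquePart_act hadj k g c) j hw,
      cliquePart_mem _ _, cliquePart G k v, cliquePart_mem _ _, ?_⟩
    rw [← cliquePart_act hadj, ← map_sub, ← map_add, ← hwv, cliquePart_eq_self hc]
  have hbdI : ∀ (j : ℕ) {c : Chain V}, c ∈ augSub t j → bd c ∈ augSub t j :=
    fun j c hc => augSub_induction (fun g c => bd_act g c) j hc
  have hactI : ∀ (g : Γ) (j : ℕ) {c : Chain V}, c ∈ augSub t j → act g c ∈ augSub t j :=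
    fun g j c hc => augSub_induction (fun h c => act_comm g h c) j hc
  have hle : ∀ (j : ℕ) {c : Chain V}, c ∈ augSub t j → c ∈ augSub t (j + 1) :=
    fun j c hc => Submodule.mem_sup_left hc
  have hs : ∀ (j : ℕ) (c : Chain V), c - act (t j) c ∈ augSub t (j + 1) :=
    fun j c => mem_augSub_succ.2 ⟨0, Submodule.zero_mem _, c, (zero_add _).symm⟩
  have hreg : ∀ j < m, ∀ (k : ℕ) (c : Chain V), c ∈ chainsOn (CliqueCard G (k + 1)) →
      c - act (t j) c ∈ augSub t j → c ∈ augSub t j := by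
    intro j hj k c hc h
    refine mem_augSub_of_sub_act_mem (ht j hj) ?_ h
    intro s hsupp g hg
    rw [Finsupp.mem_supported] at hc
    have h1 : CliqueCard G (k + 1) s := hc hsupp
    exact smul_finset_free htf hfree (Finset.card_pos.1 (by rw [h1.2]; omega)) hg
  have key : ∀ j ≤ m,
      (∃ z ∈ chainsOn (CliqueCard G (j + 1)),
        (∀ b ∈ chainsOn (CliqueCard G (j + 2)), z - bd b ∉ augSub t j) ∧
        ∀ a : Γ, ∃ b ∈ chainsOn (CliqueCard G (j + 2)), z - act a z - bd b ∈ augSub t j) ∧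
      ∀ i, j + 2 ≤ i → ∀ c ∈ chainsOn (CliqueCard G i), bd c ∈ augSub t j →
        ∃ b ∈ chainsOn (CliqueCard G (i + 1)), c - bd b ∈ augSub t j := by
    intro j
    induction j with
    | zero =>
      intro _
      refine ⟨?_, ?_⟩
      · obtain ⟨v⟩ := ‹Nonempty V›
        refine ⟨Finsupp.single {v} 1, single_mem_chainsOn ⟨by simp, by simp⟩, ?_, ?_⟩
        · intro b hb h
          simp only [augSub, Submodule.mem_bot, sub_eq_zero] at h
          have h2 := congrArg bd h
          rw [bd_bd, bd_single] at h2
          simp at h2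
        · intro a
          obtain ⟨b, hb, hbd⟩ := hconn v (a • v)
          refine ⟨b, hb, ?_⟩
          rw [hbd, act_single, Finset.smul_finset_singleton, sub_self]
          exact Submodule.zero_mem _
      · intro i hi c hc hbd
        simp only [augSub, Submodule.mem_bot] at hbd
        obtain ⟨b, hb, hbc⟩ := hac i (by omega) c hc hbd
        exact ⟨b, hb, by rw [hbc, sub_self]; exact Submodule.zero_mem _⟩
    | succ j ih =>
      intro hj
      obtain ⟨⟨z, hz, hz1, hz2⟩, hH⟩ := ih (by omega)
      refine ⟨?_, ?_⟩
      · obtain ⟨y, hy, hyw⟩ := hz2 (t j)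
        refine ⟨y, hy, ?_, ?_⟩
        · intro b hb hmem
          obtain ⟨w, hw, hwC, v, hv, hwv⟩ := hsplit j (j + 2) _
            (Submodule.sub_mem _ hy (bd_mem_chainsOn hb)) hmem
          refine hz1 v hv (hreg j (by omega) j _ (Submodule.sub_mem _ hz (bd_mem_chainsOn hv)) ?_)
          have h2 := congrArg bd hwv
          rw [map_sub, bd_bd, sub_zero, map_add, map_sub, bd_act] at h2
          have h3 := Submodule.add_mem _ hyw (hbdI j hw)
          rw [h2] at h3
          rw [map_sub]
          convert h3 using 1
          abel
        · intro a
          obtain ⟨u, hu, huw⟩ := hz2 a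
          have hc : y - act a y - (u - act (t j) u) ∈ chainsOn (CliqueCard G (j + 2)) :=
            Submodule.sub_mem _ (Submodule.sub_mem _ hy (hactC _ _ _ hy))
              (Submodule.sub_mem _ hu (hactC _ _ _ hu))
          obtain ⟨b, hb, hbI⟩ := hH (j + 2) le_rfl _ hc (by
            have h1 := Submodule.sub_mem _ hyw (hactI a j hyw)
            have h2 := Submodule.sub_mem _ huw (hactI (t j) j huw)
            have h3 := Submodule.sub_mem _ h2 h1
            convert h3 using 1
            simp only [map_sub, bd_act, act_comm a (t j)]
            abel)
          refine ⟨b, hb, ?_⟩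
          have := Submodule.add_mem _ (hle j hbI) (hs j u)
          convert this using 1
          abel
      · intro i hi c hc hbd
        obtain ⟨i, rfl⟩ : ∃ i', i = i' + 3 := ⟨i - 3, by omega⟩
        obtain ⟨w, hw, hwC, v, hv, hwv⟩ := hsplit j (i + 2) _ (bd_mem_chainsOn hc) hbd
        have h1 : bd v ∈ augSub t j := by
          refine hreg j (by omega) i _ (bd_mem_chainsOn hv) ?_
          have h2 := congrArg bd hwv
          rw [bd_bd, map_add, map_sub, bd_act] at h2
          rw [eq_neg_of_add_eq_zero_right h2.symm]
          exact Submodule.neg_mem _ (hbdI j hw)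
        obtain ⟨b, hb, hbI⟩ := hH (i + 2) (by omega) v hv h1
        obtain ⟨d, hd, hdI⟩ := hH (i + 3) (by omega) (c - (b - act (t j) b))
          (Submodule.sub_mem _ hc (Submodule.sub_mem _ hb (hactC _ _ _ hb))) (by
            have h3 := Submodule.add_mem _ hw (Submodule.sub_mem _ hbI (hactI (t j) j hbI))
            convert h3 using 1
            rw [map_sub, hwv]
            simp only [map_sub, bd_act]
            abel)
        refine ⟨d, hd, ?_⟩
        have := Submodule.add_mem _ (hle j hdI) (hs j b)
        convert this using 1
        abel
  obtain ⟨⟨z, hz, hz1, _⟩, _⟩ := key m le_rfl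
  have hz0 : z ≠ 0 := by
    rintro rfl
    have := hz1 0 (Submodule.zero_mem _)
    rw [map_zero, sub_zero] at this
    exact this (Submodule.zero_mem _)
  obtain ⟨s, hsupp⟩ := Finsupp.support_nonempty_iff.2 hz0
  rw [Finsupp.mem_supported] at hz
  exact ⟨s, hz hsupp⟩

end Rank

/-! ### Almost invariant subsets of a group -/

section AlmostInvariant

open Filter
open scoped Pointwise

variable {H : Type*} [Group H]

/-- The points where membership in `U` changes under right multiplication by `w`. -/
def dif (U : Set H) (w : H) : Set H := {g | ¬(g ∈ U ↔ g * w ∈ U)}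

/-- A set is almost invariant if right translations change it by finitely many points. -/
def AlmInv (U : Set H) : Prop := ∀ w, (dif U w).Finite

/-- The least number of changes along `w` among the sets almost equal to `U`. -/
noncomputable def len (U : Set H) (w : H) : ℕ :=
  sInf {k | ∃ U' : Set H, U' =ᶠ[cofinite] U ∧ (dif U' w).ncard = k}

lemma mem_dif {U : Set H} {w g : H} : g ∈ dif U w ↔ ¬(g ∈ U ↔ g * w ∈ U) := Iff.rfl

lemma almostEq_iff {U V : Set H} : U =ᶠ[cofinite] V ↔ {g | ¬(g ∈ U ↔ g ∈ V)}.Finite := by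
  rw [eventuallyEq_set]
  exact Filter.eventually_cofinite

lemma dif_congr_finite {U V : Set H} (h : U =ᶠ[cofinite] V) {w : H} (hU : (dif U w).Finite) :
    (dif V w).Finite := by
  rw [almostEq_iff] at h
  have h2 := h.preimage (f := (· * w)) (fun a _ b _ hab => mul_right_cancel hab)
  refine ((hU.union h).union h2).subset ?_
  intro g hg
  simp only [mem_dif, Set.mem_union, Set.mem_preimage, Set.mem_ofPred_eq] at hg ⊢
  tauto

lemma AlmInv.congr {U V : Set H} (h : U =ᶠ[cofinite] V) (hU : AlmInv U) : AlmInv V :=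
  fun w => dif_congr_finite h (hU w)

lemma dif_compl (U : Set H) (w : H) : dif Uᶜ w = dif U w := by
  ext g
  simp only [mem_dif, Set.mem_compl_iff]
  tauto

lemma AlmInv.compl {U : Set H} (hU : AlmInv U) : AlmInv Uᶜ := fun w => by
  rw [dif_compl]; exact hU w

lemma dif_inter_subset (U V : Set H) (w : H) : dif (U ∩ V) w ⊆ dif U w ∪ dif V w := by
  intro g
  simp only [mem_dif, Set.mem_inter_iff, Set.mem_union]
  tauto

lemma AlmInv.inter {U V : Set H} (hU : AlmInv U) (hV : AlmInv V) : AlmInv (U ∩ V) :=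
  fun w => ((hU w).union (hV w)).subset (dif_inter_subset U V w)

lemma AlmInv.union {U V : Set H} (hU : AlmInv U) (hV : AlmInv V) : AlmInv (U ∪ V) := by
  have := (hU.compl.inter hV.compl).compl
  rwa [← Set.compl_union, compl_compl] at this

lemma dif_mul_subset (U : Set H) (v w : H) :
    dif U (v * w) ⊆ dif U v ∪ (· * v) ⁻¹' dif U w := by
  intro g
  simp only [mem_dif, Set.mem_union, Set.mem_preimage, mul_assoc]
  tauto

lemma preimage_mul_right_ncard (A : Set H) (v : H) : ((· * v) ⁻¹' A).ncard = A.ncard :=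
  Set.ncard_preimage_of_injective_subset_range (mul_left_injective v)
    (fun x _ => ⟨x * v⁻¹, by simp⟩)

lemma preimage_mul_right_finite {A : Set H} (hA : A.Finite) (v : H) :
    ((· * v) ⁻¹' A).Finite :=
  hA.preimage (fun a _ b _ hab => mul_right_cancel hab)

lemma dif_mul_finite {U : Set H} {v w : H} (hv : (dif U v).Finite) (hw : (dif U w).Finite) :
    (dif U (v * w)).Finite :=
  (hv.union (preimage_mul_right_finite hw v)).subset (dif_mul_subset U v w)

lemma ncard_dif_mul_le {U : Set H} {v w : H} (hv : (dif U v).Finite) (hw : (dif U w).Finite) :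
    (dif U (v * w)).ncard ≤ (dif U v).ncard + (dif U w).ncard := by
  refine (Set.ncard_le_ncard (dif_mul_subset U v w)
    (hv.union (preimage_mul_right_finite hw v))).trans ?_
  refine (Set.ncard_union_le _ _).trans ?_
  rw [preimage_mul_right_ncard]

lemma dif_one (U : Set H) : dif U 1 = ∅ := by
  ext g; simp [mem_dif]

lemma dif_inv (U : Set H) (w : H) : dif U w⁻¹ = (· * w⁻¹) ⁻¹' dif U w := by
  ext g
  simp only [mem_dif, Set.mem_preimage, inv_mul_cancel_right]
  tauto

lemma almInv_of_closure {U : Set H} {S : Set H} (hS : Subgroup.closure S = ⊤)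
    (h : ∀ w ∈ S, (dif U w).Finite) : AlmInv U := by
  intro w
  have hw : w ∈ Subgroup.closure S := hS ▸ Subgroup.mem_top w
  induction hw using Subgroup.closure_induction with
  | mem w hw => exact h w hw
  | one => rw [dif_one]; exact Set.finite_empty
  | mul v w _ _ hv hw => exact dif_mul_finite hv hw
  | inv w _ hw =>
    rw [dif_inv]
    exact preimage_mul_right_finite hw _

lemma dif_smul (g : H) (U : Set H) (w : H) : dif (g • U) w = g • dif U w := by
  ext x
  simp only [mem_dif, Set.mem_smul_set_iff_inv_smul_mem, smul_eq_mul, mul_assoc]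

lemma AlmInv.smul {U : Set H} (hU : AlmInv U) (g : H) : AlmInv (g • U) := fun w => by
  rw [dif_smul]; exact (hU w).smul_set

lemma dif_image (φ : H ≃* H) (U : Set H) (w : H) : dif (φ '' U) w = φ '' dif U (φ.symm w) := by
  ext x
  have key : ∀ (A : Set H) (y : H), y ∈ φ '' A ↔ φ.symm y ∈ A := by
    intro A y
    constructor
    · rintro ⟨z, hz, rfl⟩; simpa
    · intro h; exact ⟨_, h, by simp⟩
  rw [key]
  simp only [mem_dif, key, map_mul]

lemma AlmInv.image {U : Set H} (hU : AlmInv U) (φ : H ≃* H) : AlmInv (φ '' U) := fun w => by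
  rw [dif_image]; exact (hU _).image _

lemma almostEq_image {U V : Set H} (h : U =ᶠ[cofinite] V) (φ : H ≃ H) :
    φ '' U =ᶠ[cofinite] φ '' V := by
  rw [almostEq_iff] at h ⊢
  refine (h.image φ).subset ?_
  intro x hx
  refine ⟨φ.symm x, ?_, by simp⟩
  simpa [Equiv.image_eq_preimage_symm] using hx

lemma almostEq_smul {U V : Set H} (h : U =ᶠ[cofinite] V) (g : H) :
    (g • U : Set H) =ᶠ[cofinite] (g • V : Set H) :=
  almostEq_image h (MulAction.toPerm g)

lemma len_le {U U' : Set H} (h : U' =ᶠ[cofinite] U) (w : H) : len U w ≤ (dif U' w).ncard :=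
  Nat.sInf_le ⟨U', h, rfl⟩

lemma exists_len (U : Set H) (w : H) :
    ∃ U' : Set H, U' =ᶠ[cofinite] U ∧ (dif U' w).ncard = len U w :=
  Nat.sInf_mem (s := {k | ∃ U' : Set H, U' =ᶠ[cofinite] U ∧ (dif U' w).ncard = k})
    ⟨_, U, EventuallyEq.rfl, rfl⟩

lemma len_congr {U V : Set H} (h : U =ᶠ[cofinite] V) (w : H) : len U w = len V w := by
  unfold len
  congr 1
  ext k
  constructor
  · rintro ⟨U', h1, h2⟩; exact ⟨U', h1.trans h, h2⟩
  · rintro ⟨U', h1, h2⟩; exact ⟨U', h1.trans h.symm, h2⟩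

lemma len_compl (U : Set H) (w : H) : len Uᶜ w = len U w := by
  have key : ∀ U : Set H, len Uᶜ w ≤ len U w := by
    intro U
    obtain ⟨U', h1, h2⟩ := exists_len U w
    rw [← h2, ← dif_compl U']
    exact len_le h1.compl w
  refine le_antisymm (key U) ?_
  simpa using key Uᶜ

lemma len_smul (g : H) (U : Set H) (w : H) : len (g • U) w = len U w := by
  have key : ∀ (g : H) (U : Set H), len (g • U) w ≤ len U w := by
    intro g U
    obtain ⟨U', h1, h2⟩ := exists_len U w
    rw [← h2]
    refine (len_le (almostEq_smul h1 g) w).trans ?_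
    rw [dif_smul, Set.ncard_smul_set]
  refine le_antisymm (key g U) ?_
  simpa using key g⁻¹ (g • U)

lemma len_image (φ : H ≃* H) (U : Set H) (w : H) : len (φ '' U) w = len U (φ.symm w) := by
  have key : ∀ (φ : H ≃* H) (U : Set H) (w : H), len (φ '' U) w ≤ len U (φ.symm w) := by
    intro φ U w
    obtain ⟨U', h1, h2⟩ := exists_len U (φ.symm w)
    rw [← h2]
    refine (len_le (almostEq_image h1 φ.toEquiv) w).trans ?_
    show (dif (φ '' U') w).ncard ≤ _
    rw [dif_image, Set.ncard_image_of_injective _ φ.injective]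
  refine le_antisymm (key φ U w) ?_
  have := key φ.symm (φ '' U) (φ.symm w)
  rw [Set.image_image] at this
  simpa using this

lemma len_conj {U : Set H} (hU : AlmInv U) (p w : H) : len U (p⁻¹ * w * p) = len U w := by
  have key : ∀ (p w : H), len U (p⁻¹ * w * p) ≤ len U w := by
    intro p w
    obtain ⟨U', h1, h2⟩ := exists_len U w
    rw [← h2]
    have hU' := hU.congr h1.symm
    have h3 : ((· * p⁻¹) ⁻¹' U') =ᶠ[cofinite] U := by
      refine EventuallyEq.trans ?_ h1
      rw [almostEq_iff]
      refine (hU' p⁻¹).subset fun g hg => ?_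
      simp only [Set.mem_preimage, Set.mem_ofPred_eq, mem_dif] at hg ⊢
      tauto
    refine (len_le h3 _).trans ?_
    have : dif ((· * p⁻¹) ⁻¹' U') (p⁻¹ * w * p) = (· * p⁻¹) ⁻¹' dif U' w := by
      ext g
      simp [mem_dif, mul_assoc]
    rw [this, preimage_mul_right_ncard]
  refine le_antisymm (key p w) ?_
  have := key p⁻¹ (p⁻¹ * w * p)
  simpa [mul_assoc] using this

lemma len_submodular {U V : Set H} (hU : AlmInv U) (hV : AlmInv V) (w : H) :
    len (U ∩ V) w + len (U ∪ V) w ≤ len U w + len V w := by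
  obtain ⟨U', hU1, hU2⟩ := exists_len U w
  obtain ⟨V', hV1, hV2⟩ := exists_len V w
  have fU := hU.congr hU1.symm w
  have fV := hV.congr hV1.symm w
  rw [← hU2, ← hV2]
  refine (add_le_add (len_le (hU1.inter hV1) w) (len_le (hU1.union hV1) w)).trans ?_
  have f1 : (dif (U' ∩ V') w).Finite := (fU.union fV).subset (dif_inter_subset _ _ _)
  have f2 : (dif (U' ∪ V') w).Finite := by
    rw [← dif_compl, Set.compl_union]
    refine (fU.union fV).subset ((dif_inter_subset _ _ _).trans ?_)
    rw [dif_compl, dif_compl]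
  rw [← Set.ncard_inter_add_ncard_union _ _ f1 f2, ← Set.ncard_inter_add_ncard_union _ _ fU fV]
  refine add_le_add (Set.ncard_le_ncard ?_ (fU.inter_of_left _))
    (Set.ncard_le_ncard ?_ (fU.union fV))
  · intro g
    simp only [mem_dif, Set.mem_inter_iff, Set.mem_union]
    tauto
  · intro g
    simp only [mem_dif, Set.mem_inter_iff, Set.mem_union]
    tauto

lemma exists_ncard_dif_pow_le {U : Set H} (hU : AlmInv U) (w : H) :
    ∃ C, ∀ k : ℕ, (dif U (w ^ k)).ncard ≤ k * len U w + C := by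
  obtain ⟨U', h1, h2⟩ := exists_len U w
  have hU' := hU.congr h1.symm
  have hE := almostEq_iff.1 h1
  set E := {g | ¬(g ∈ U' ↔ g ∈ U)}
  refine ⟨E.ncard + E.ncard, fun k => ?_⟩
  have hk : (dif U' (w ^ k)).ncard ≤ k * len U w := by
    induction k with
    | zero => simp [dif_one]
    | succ k ih =>
      rw [pow_succ]
      refine (ncard_dif_mul_le (hU' _) (hU' _)).trans ?_
      rw [h2, add_mul, one_mul]
      omega
  have hsub : dif U (w ^ k) ⊆ dif U' (w ^ k) ∪ (E ∪ (· * w ^ k) ⁻¹' E) := by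
    intro g
    simp only [mem_dif, Set.mem_union, Set.mem_preimage, E, Set.mem_ofPred_eq]
    tauto
  have hf := preimage_mul_right_finite hE (w ^ k)
  refine (Set.ncard_le_ncard hsub ((hU' _).union (hE.union hf))).trans ?_
  refine (Set.ncard_union_le _ _).trans (add_le_add hk ((Set.ncard_union_le _ _).trans ?_))
  rw [preimage_mul_right_ncard]

end AlmostInvariant

/-! ### Sectors of a free group -/

section Letters

variable {ι : Type*} [DecidableEq ι]

/-- The inverse letter. -/
def linv (a : ι × Bool) : ι × Bool := (a.1, !a.2)

@[simp] lemma linv_linv (a : ι × Bool) : linv (linv a) = a := by simp [linv]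

@[simp] lemma linv_ne (a : ι × Bool) : linv a ≠ a := by
  intro h; have := congrArg Prod.snd h; simp [linv] at this

@[simp] lemma ne_linv (a : ι × Bool) : a ≠ linv a := (linv_ne a).symm

lemma linv_injective : Function.Injective (linv (ι := ι)) := fun a b h => by
  rw [← linv_linv a, h, linv_linv]

@[simp] lemma linv_inj {a b : ι × Bool} : linv a = linv b ↔ a = b := linv_injective.eq_iff

lemma reduced_rel_iff {a b : ι × Bool} : (a.1 = b.1 → a.2 = b.2) ↔ b ≠ linv a := by
  obtain ⟨i, x⟩ := a
  obtain ⟨j, y⟩ := b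
  simp only [linv, ne_eq, Prod.mk.injEq]
  cases x <;> cases y <;> simp [eq_comm]

/-- The group element given by a letter. -/
def ltr (a : ι × Bool) : FreeGroup ι := FreeGroup.mk [a]

lemma ltr_linv (a : ι × Bool) : ltr (linv a) = (ltr a)⁻¹ := by
  simp [ltr, linv, FreeGroup.invRev]

lemma toWord_ltr (a : ι × Bool) : (ltr a).toWord = [a] := by
  simp [ltr, FreeGroup.reduce_singleton]

/-- The first letter of the reduced word. -/
def hd (g : FreeGroup ι) : Option (ι × Bool) := g.toWord.head?

/-- The last letter of the reduced word. -/
def lst (g : FreeGroup ι) : Option (ι × Bool) := g.toWord.getLast?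

@[simp] lemma hd_one : hd (1 : FreeGroup ι) = none := by simp [hd]

@[simp] lemma lst_one : lst (1 : FreeGroup ι) = none := by simp [lst]

@[simp] lemma hd_ltr (a : ι × Bool) : hd (ltr a) = some a := by simp [hd, toWord_ltr]

@[simp] lemma lst_ltr (a : ι × Bool) : lst (ltr a) = some a := by simp [lst, toWord_ltr]

lemma hd_eq_none {g : FreeGroup ι} : hd g = none ↔ g = 1 := by simp [hd]

lemma lst_eq_none {g : FreeGroup ι} : lst g = none ↔ g = 1 := by simp [lst]

lemma lst_inv (g : FreeGroup ι) : lst g⁻¹ = (hd g).map linv := by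
  simp only [lst, hd, FreeGroup.toWord_inv, FreeGroup.invRev, List.getLast?_reverse,
    List.head?_reverse, List.head?_map, List.getLast?_map]
  rfl

lemma hd_inv (g : FreeGroup ι) : hd g⁻¹ = (lst g).map linv := by
  simp only [lst, hd, FreeGroup.toWord_inv, FreeGroup.invRev, List.getLast?_reverse,
    List.head?_reverse, List.head?_map, List.getLast?_map]
  rfl

lemma toWord_mk_of_isReduced {w : List (ι × Bool)} (h : FreeGroup.IsReduced w) :
    (FreeGroup.mk w).toWord = w := by
  rw [FreeGroup.toWord_mk, h.reduce_eq]

lemma isReduced_append_iff {u v : List (ι × Bool)} : FreeGroup.IsReduced (u ++ v) ↔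
    FreeGroup.IsReduced u ∧ FreeGroup.IsReduced v ∧
      ∀ a, u.getLast? = some a → v.head? ≠ some (linv a) := by
  simp only [FreeGroup.IsReduced]
  rw [List.isChain_append]
  simp only [reduced_rel_iff, Option.mem_def]
  refine and_congr Iff.rfl (and_congr Iff.rfl ?_)
  constructor
  · intro h a ha hb
    exact h a ha _ hb rfl
  · rintro h a ha b hb rfl
    exact h a ha hb

lemma toWord_mul_of {g h : FreeGroup ι} (hgh : ∀ a, lst g = some a → hd h ≠ some (linv a)) :
    (g * h).toWord = g.toWord ++ h.toWord := by
  rw [FreeGroup.toWord_mul]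
  exact (isReduced_append_iff.2
    ⟨FreeGroup.isReduced_toWord, FreeGroup.isReduced_toWord, hgh⟩).reduce_eq

lemma hd_mul_of {g h : FreeGroup ι} (hg : g ≠ 1)
    (hgh : ∀ a, lst g = some a → hd h ≠ some (linv a)) : hd (g * h) = hd g := by
  rw [hd, toWord_mul_of hgh, List.head?_append_of_ne_nil]
  · rfl
  · simpa using hg

lemma lst_mul_of {g h : FreeGroup ι} (hh : h ≠ 1)
    (hgh : ∀ a, lst g = some a → hd h ≠ some (linv a)) : lst (g * h) = lst h := by
  rw [lst, toWord_mul_of hgh, List.getLast?_append_of_ne_nil]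
  · rfl
  · simpa using hh

lemma exists_of_hd {g : FreeGroup ι} {a : ι × Bool} (h : hd g = some a) :
    ∃ g', g = ltr a * g' ∧ g.toWord = a :: g'.toWord ∧ hd g' ≠ some (linv a) := by
  obtain ⟨t, ht⟩ : ∃ t, g.toWord = a :: t := by
    rw [hd] at h
    exact ⟨_, (List.cons_head?_tail h).symm⟩
  have hr : FreeGroup.IsReduced ([a] ++ t) := by
    have := FreeGroup.isReduced_toWord (x := g)
    rwa [ht] at this
  rw [isReduced_append_iff] at hr
  have ht' := toWord_mk_of_isReduced hr.2.1
  refine ⟨FreeGroup.mk t, ?_, ?_, ?_⟩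
  · rw [← FreeGroup.mk_toWord (x := g), ht, ltr, FreeGroup.mul_mk]; rfl
  · rw [ht', ht]
  · rw [hd, ht']
    exact hr.2.2 a rfl

lemma exists_of_lst {g : FreeGroup ι} {a : ι × Bool} (h : lst g = some a) :
    ∃ g', g = g' * ltr a ∧ g.toWord = g'.toWord ++ [a] ∧ lst g' ≠ some (linv a) := by
  have h1 : hd g⁻¹ = some (linv a) := by rw [hd_inv, h]; rfl
  obtain ⟨g', h2, h3, h4⟩ := exists_of_hd h1
  have h5 : lst g'⁻¹ ≠ some (linv a) := by
    rw [lst_inv]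
    intro h
    rw [Option.map_eq_some_iff] at h
    obtain ⟨b, hb, hba⟩ := h
    rw [linv_inj] at hba
    rw [hb, hba, linv_linv] at h4
    exact h4 rfl
  have h6 : g = g'⁻¹ * ltr a := by
    rw [← inv_inj, h2, ltr_linv]; simp
  refine ⟨g'⁻¹, h6, ?_, h5⟩
  conv_lhs => rw [h6]
  rw [toWord_mul_of, toWord_ltr]
  intro b hb
  rw [hd_ltr]
  rintro h
  rw [Option.some_inj] at h
  rw [hb, h, linv_linv] at h5
  exact h5 rfl

lemma hd_ltr_mul {g : FreeGroup ι} {a : ι × Bool} (h : hd g ≠ some (linv a)) :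
    hd (ltr a * g) = some a := by
  rw [hd_mul_of, hd_ltr]
  · intro h'; have := hd_ltr a; rw [h', hd_one] at this; cases this
  · intro b hb
    rw [lst_ltr, Option.some_inj] at hb
    rwa [← hb]

open scoped Pointwise

/-- The elements whose reduced word starts with a letter in `α`. -/
def sec (α : Finset (ι × Bool)) : Set (FreeGroup ι) := {g | ∃ a ∈ α, hd g = some a}

lemma mem_sec {α : Finset (ι × Bool)} {g : FreeGroup ι} :
    g ∈ sec α ↔ ∃ a ∈ α, hd g = some a := Iff.rfl

lemma mem_sec_iff {α : Finset (ι × Bool)} {g : FreeGroup ι} {a : ι × Bool} (h : hd g = some a) :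
    g ∈ sec α ↔ a ∈ α := by
  rw [mem_sec, h]
  constructor
  · rintro ⟨b, hb, hab⟩; rw [Option.some_inj] at hab; rwa [hab]
  · intro h; exact ⟨a, h, rfl⟩

lemma one_notMem_sec (α : Finset (ι × Bool)) : (1 : FreeGroup ι) ∉ sec α := by simp [mem_sec]

lemma mem_sec_singleton {a : ι × Bool} {g : FreeGroup ι} : g ∈ sec {a} ↔ hd g = some a := by
  simp [mem_sec]

lemma sec_union (α β : Finset (ι × Bool)) : sec (α ∪ β) = sec α ∪ sec β := by
  ext g; simp only [mem_sec, Finset.mem_union, Set.mem_union]; grind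

lemma sec_inter (α β : Finset (ι × Bool)) : sec (α ∩ β) = sec α ∩ sec β := by
  ext g
  simp only [mem_sec, Finset.mem_inter, Set.mem_inter_iff]
  constructor
  · rintro ⟨a, ⟨h1, h2⟩, h3⟩; exact ⟨⟨a, h1, h3⟩, a, h2, h3⟩
  · rintro ⟨⟨a, h1, h3⟩, b, h2, h4⟩
    have : a = b := by rw [h3] at h4; exact Option.some_inj.1 h4
    exact ⟨a, ⟨h1, this ▸ h2⟩, h3⟩

lemma sec_compl [Fintype ι] (α : Finset (ι × Bool)) : sec αᶜ = (sec α)ᶜ \ {1} := by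
  ext g
  simp only [Set.mem_sdiff, Set.mem_compl_iff, Set.mem_singleton_iff]
  by_cases hg : g = 1
  · simp [hg, one_notMem_sec]
  · obtain ⟨a, ha⟩ := Option.ne_none_iff_exists'.1 (fun h => hg (hd_eq_none.1 h))
    rw [mem_sec_iff ha, mem_sec_iff ha, Finset.mem_compl]
    tauto

lemma ltr_smul_sec (a : ι × Bool) : ltr a • sec {linv a} = (sec {a})ᶜ := by
  ext g
  rw [Set.mem_smul_set_iff_inv_smul_mem, smul_eq_mul, Set.mem_compl_iff, mem_sec_singleton,
    mem_sec_singleton, ← ltr_linv]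
  constructor
  · intro h h'
    obtain ⟨g', h1, _, h3⟩ := exists_of_hd h'
    rw [h1, ltr_linv, inv_mul_cancel_left] at h
    exact h3 h
  · intro h
    exact hd_ltr_mul (by rwa [linv_linv])

lemma dif_sec_ltr (α : Finset (ι × Bool)) (x : ι × Bool) :
    dif (sec α) (ltr x) = {g | (g = 1 ∧ x ∈ α) ∨ (g = ltr (linv x) ∧ linv x ∈ α)} := by
  ext g
  rw [mem_dif, Set.mem_ofPred_eq]
  by_cases h1 : g = 1
  · subst h1
    have : (1 : FreeGroup ι) ≠ ltr (linv x) := by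
      intro h
      have := hd_ltr (linv x)
      rw [← h, hd_one] at this
      cases this
    simp [one_notMem_sec, mem_sec, this]
  · by_cases h2 : lst g = some (linv x)
    · obtain ⟨g', h3, h4, h5⟩ := exists_of_lst h2
      by_cases h6 : g' = 1
      · subst h6
        rw [one_mul] at h3
        subst h3
        have : ltr (linv x) * ltr x = 1 := by rw [ltr_linv, inv_mul_cancel]
        rw [this]
        simp [one_notMem_sec, mem_sec, h1]
      · have h7 : hd g = hd g' := by
          rw [hd, h4, List.head?_append_of_ne_nil]
          · rfl
          · simpa using h6
        have h8 : g ≠ ltr (linv x) := by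
          rintro rfl
          rw [toWord_ltr] at h4
          have := congrArg List.length h4
          simp at this
          exact h6 this
        have h9 : g * ltr x = g' := by rw [h3, ltr_linv, inv_mul_cancel_right]
        rw [h9]
        simp [h1, h8, mem_sec, h7]
    · have h3 : hd (g * ltr x) = hd g := by
        refine hd_mul_of h1 fun a ha h => h2 ?_
        rw [hd_ltr, Option.some_inj] at h
        rw [h, linv_linv, ha]
      have h8 : g ≠ ltr (linv x) := by
        rintro rfl
        exact h2 (lst_ltr _)
      simp [mem_sec, h3, h1, h8]

lemma dif_sec_ltr_finite (α : Finset (ι × Bool)) (x : ι × Bool) :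
    (dif (sec α) (ltr x)).Finite := by
  refine (Set.toFinite {1, ltr (linv x)}).subset ?_
  rw [dif_sec_ltr]
  rintro g (h | h)
  · simp [h.1]
  · simp [h.1]

lemma closure_range_ltr : Subgroup.closure (Set.range (ltr (ι := ι))) = ⊤ := by
  rw [eq_top_iff, ← FreeGroup.closure_range_of]
  refine Subgroup.closure_mono ?_
  rintro _ ⟨i, rfl⟩
  exact ⟨(i, true), rfl⟩

lemma almInv_sec (α : Finset (ι × Bool)) : AlmInv (sec α) := by
  refine almInv_of_closure closure_range_ltr ?_
  rintro _ ⟨x, rfl⟩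
  exact dif_sec_ltr_finite α x

/-- The elements whose reduced word has the reduced word of `h` as a prefix. -/
def pre (h : FreeGroup ι) : Set (FreeGroup ι) := {g | h.toWord <+: g.toWord}

lemma mem_pre {h g : FreeGroup ι} : g ∈ pre h ↔ h.toWord <+: g.toWord := Iff.rfl

lemma pre_one : pre (1 : FreeGroup ι) = Set.univ := by
  ext g; simp [mem_pre]

lemma smul_sec_singleton {h : FreeGroup ι} {a : ι × Bool} (ha : lst h ≠ some (linv a)) :
    h • sec {a} = pre (h * ltr a) := by
  have hw : (h * ltr a).toWord = h.toWord ++ [a] := by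
    rw [toWord_mul_of, toWord_ltr]
    intro b hb hab
    rw [hd_ltr, Option.some_inj] at hab
    rw [hb, hab, linv_linv] at ha
    exact ha rfl
  ext g
  rw [Set.mem_smul_set_iff_inv_smul_mem, smul_eq_mul, mem_sec_singleton, mem_pre, hw]
  constructor
  · intro hg
    obtain ⟨g', h1, h2, h3⟩ := exists_of_hd hg
    have h4 : g = h * (h⁻¹ * g) := by simp
    have h5 := toWord_mul_of (g := h) (h := h⁻¹ * g) (by
      intro b hb hab
      rw [hg, Option.some_inj] at hab
      rw [hb, hab, linv_linv] at ha
      exact ha rfl)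
    rw [← h4, h2] at h5
    exact ⟨g'.toWord, by rw [h5]; simp⟩
  · rintro ⟨t, ht⟩
    have hr := FreeGroup.isReduced_toWord (x := g)
    rw [← ht, List.append_assoc, isReduced_append_iff] at hr
    have h1 : g = h * FreeGroup.mk ([a] ++ t) := by
      rw [← FreeGroup.mk_toWord (x := g), ← ht, List.append_assoc, ← FreeGroup.mul_mk,
        FreeGroup.mk_toWord]
    rw [h1, inv_mul_cancel_left, hd, toWord_mk_of_isReduced hr.2.1]
    rfl

end Letters

/-! ### Cyclic lengths -/

section CyclicLength

open scoped Pointwise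
open Filter

variable {ι : Type*} [DecidableEq ι]

lemma norm_eq_length (g : FreeGroup ι) : g.norm = g.toWord.length := rfl

lemma exists_split {w : FreeGroup ι} {j : ℕ} (hj : j < w.norm) :
    ∃ (u v : FreeGroup ι) (y : ι × Bool), u.norm = j ∧ w = u * ltr y * v ∧
      lst u ≠ some (linv y) ∧ hd v ≠ some (linv y) := by
  have hr := FreeGroup.isReduced_toWord (x := w)
  rw [norm_eq_length] at hj
  have hw : w.toWord = w.toWord.take j ++ ([w.toWord[j]] ++ w.toWord.drop (j + 1)) := by
    simp
  rw [hw, isReduced_append_iff, isReduced_append_iff] at hr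
  obtain ⟨hu, ⟨hy, hv, hyv⟩, huy⟩ := hr
  refine ⟨FreeGroup.mk (w.toWord.take j), FreeGroup.mk (w.toWord.drop (j + 1)), w.toWord[j],
    ?_, ?_, ?_, ?_⟩
  · rw [norm_eq_length, toWord_mk_of_isReduced hu, List.length_take]
    omega
  · conv_lhs => rw [← FreeGroup.mk_toWord (x := w), hw]
    rw [← FreeGroup.mul_mk, ← FreeGroup.mul_mk, mul_assoc]
    rfl
  · intro h
    rw [lst, toWord_mk_of_isReduced hu] at h
    exact huy _ h (by simp)
  · intro h
    rw [hd, toWord_mk_of_isReduced hv] at h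
    exact hyv _ rfl h

/-- The set of elements starting with the `i`-th generator. -/
abbrev gsec (i : ι) : Set (FreeGroup ι) := sec {(i, true)}

lemma len_sec_linv (a : ι × Bool) (w : FreeGroup ι) : len (sec {linv a}) w = len (sec {a}) w := by
  rw [← len_smul (ltr a), ltr_smul_sec, len_compl]

lemma ltr_ne_one (a : ι × Bool) : ltr a ≠ 1 := by
  intro h; have := hd_ltr a; rw [h] at this; simp at this

lemma len_ne_of_split {α : Finset (ι × Bool)} {a b c : ι × Bool} (hb : b ∈ α)
    (ha' : linv a ∉ α) (ha : a ∈ α) (hba : b ≠ a) (hc : c ∉ α) (hca : c ≠ linv a) :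
    len (sec α) ((ltr b)⁻¹ * ltr c) ≠ len (sec {a}) ((ltr b)⁻¹ * ltr c) := by
  have hbc : b ≠ c := fun h => hc (h ▸ hb)
  have h0 : len (sec {a}) ((ltr b)⁻¹ * ltr c) = 0 := by
    have e : dif (sec {a}) ((ltr b)⁻¹ * ltr c) = ∅ := by
      rw [← Set.subset_empty_iff]
      refine (dif_mul_subset _ _ _).trans ?_
      rw [← ltr_linv, dif_sec_ltr, dif_sec_ltr]
      have h1 : linv b ≠ a := fun h => ha' (by rw [← h, linv_linv]; exact hb)
      have h2 : c ≠ a := fun h => hc (h ▸ ha)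
      have h3 : linv c ≠ a := fun h => hca (by rw [← h, linv_linv])
      simp [h1, h2, h3, hba]
    have := len_le (U := sec {a}) EventuallyEq.rfl ((ltr b)⁻¹ * ltr c)
    rw [e, Set.ncard_empty] at this
    omega
  rw [h0]
  intro h
  obtain ⟨U', h1, h2⟩ := exists_len (sec α) ((ltr b)⁻¹ * ltr c)
  rw [h, Set.ncard_eq_zero ((almInv_sec α).congr h1.symm _)] at h2
  set w := (ltr b)⁻¹ * ltr c with hw
  have hinv : ∀ g, g ∈ U' ↔ g * w ∈ U' := by
    intro g
    by_contra hg
    have : g ∈ dif U' w := hg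
    rw [h2] at this
    exact this
  have hinvk : ∀ (k : ℕ) g, g ∈ U' ↔ g * w ^ k ∈ U' := by
    intro k
    induction k with
    | zero => intro g; simp
    | succ k ih => intro g; rw [pow_succ', ← mul_assoc, ← ih, ← hinv]
  have hdk : ∀ (b c : ι × Bool), b ≠ c → ∀ k : ℕ, hd (ltr c * ((ltr b)⁻¹ * ltr c) ^ k) = some c := by
    intro b c hbc k
    induction k with
    | zero => simp
    | succ k ih =>
      rw [pow_succ', mul_assoc (ltr b)⁻¹]
      apply hd_ltr_mul
      rw [show (ltr b)⁻¹ * (ltr c * ((ltr b)⁻¹ * ltr c) ^ k) =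
        ltr (linv b) * (ltr c * ((ltr b)⁻¹ * ltr c) ^ k) by rw [ltr_linv], hd_ltr_mul]
      · intro h
        exact hbc (linv_inj.1 (Option.some_inj.1 h))
      · rw [ih, linv_linv]
        simp [hbc.symm]
  have hw1 : w ≠ 1 := by
    intro h
    rw [hw, inv_mul_eq_one] at h
    have := hd_ltr b
    rw [h, hd_ltr] at this
    exact hbc (Option.some_inj.1 this).symm
  have hinj : Function.Injective fun k : ℕ => w ^ k :=
    injective_pow_iff_not_isOfFinOrder.2 (fun h => hw1 ((isOfFinOrder_iff_eq_one _).1 h))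
  rw [almostEq_iff] at h1
  have hex1 : ∃ k : ℕ, ¬ (ltr c * w ^ k ∈ U') := by
    by_contra hcon
    push Not at hcon
    refine Set.infinite_of_injective_forall_mem (f := fun k : ℕ => ltr c * w ^ k)
      (fun i j hij => hinj (mul_left_cancel hij)) (fun k => ?_) h1
    have := mem_sec_iff (α := α) (hdk b c hbc k)
    rw [Set.mem_ofPred_eq, this]
    simp [hcon k, hc]
  have hex2 : ∃ k : ℕ, ltr b * w⁻¹ ^ k ∈ U' := by
    by_contra hcon
    push Not at hcon
    refine Set.infinite_of_injective_forall_mem (f := fun k : ℕ => ltr b * w⁻¹ ^ k)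
      (fun i j hij => hinj ?_) (fun k => ?_) h1
    · have := mul_left_cancel hij
      simpa using this
    · have hwi : w⁻¹ = (ltr c)⁻¹ * ltr b := by simp [hw]
      have := mem_sec_iff (α := α) (hdk c b hbc.symm k)
      rw [← hwi] at this
      rw [Set.mem_ofPred_eq, this]
      simp [hb]
      simpa using hcon k
  obtain ⟨k, hk⟩ := hex1
  obtain ⟨l, hl⟩ := hex2
  rw [← hinvk] at hk
  rw [hinvk l] at hl
  rw [mul_assoc, inv_pow, inv_mul_cancel, mul_one, hinv, hw, mul_inv_cancel_left] at hl
  exact hk hl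

variable [Fintype ι]

lemma norm_le_sum_ncard_dif (w : FreeGroup ι) : w.norm ≤ ∑ i, (dif (gsec i) w).ncard := by
  classical
  have hfin : ∀ i : ι, (dif (gsec i) w).Finite := fun i => almInv_sec _ w
  have hcard : ∑ i, (dif (gsec i) w).ncard =
      (Finset.univ.sigma fun i => (hfin i).toFinset).card := by
    rw [Finset.card_sigma]
    exact Finset.sum_congr rfl fun i _ => Set.ncard_eq_toFinset_card _ (hfin i)
  rw [hcard]
  have key : ∀ j ∈ Finset.range w.norm, ∃ (u v : FreeGroup ι) (y : ι × Bool),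
      u.norm = j ∧ w = u * ltr y * v ∧ lst u ≠ some (linv y) ∧ hd v ≠ some (linv y) :=
    fun j hj => exists_split (Finset.mem_range.1 hj)
  rcases Nat.eq_zero_or_pos w.norm with h0 | h0
  · omega
  have : Nonempty (ι × Bool) := by
    obtain ⟨-, -, y, -⟩ := exists_split h0
    exact ⟨y⟩
  choose! u v y hu hw hlu hhv using key
  rw [← Finset.card_range w.norm]
  refine Finset.card_le_card_of_injOn
    (fun j => (⟨(y j).1, if (y j).2 then (u j)⁻¹ else (u j * ltr (y j))⁻¹⟩ :
      Σ _ : ι, FreeGroup ι)) ?_ ?_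
  · intro j hj
    have hj' := Finset.mem_coe.1 hj
    simp only [Finset.coe_sigma, Set.mem_sigma_iff, Finset.mem_coe, Finset.mem_univ, true_and,
      Set.Finite.mem_toFinset]
    rw [mem_dif, mem_sec_singleton, mem_sec_singleton]
    have e1 : (u j)⁻¹ * w = ltr (y j) * v j := by
      conv_lhs => rw [hw j hj']
      simp [mul_assoc]
    have e2 : (u j * ltr (y j))⁻¹ * w = v j := by
      conv_lhs => rw [hw j hj']
      simp [mul_assoc]
    rcases hy : (y j).2 with _ | _
    · have hyj : y j = ((y j).1, false) := by rw [← hy]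
      have hl : linv (y j) = ((y j).1, true) := by rw [linv, hy]; rfl
      simp only [Bool.false_eq_true, if_false]
      rw [e2, ← hl, hd_inv, lst_mul_of]
      · simp [hhv j hj']
      · intro h; have := hd_ltr (y j); rw [h] at this; simp at this
      · intro b hb hab
        rw [hd_ltr, Option.some_inj] at hab
        exact hlu j hj' (by rw [hb, hab, linv_linv])
    · have hyj : y j = ((y j).1, true) := by rw [← hy]
      simp only [if_true]
      rw [e1, ← hyj, hd_ltr_mul (hhv j hj'), hd_inv]
      have : ¬ (Option.map linv (lst (u j)) = some (y j)) := by
        intro h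
        rw [Option.map_eq_some_iff] at h
        obtain ⟨b, hb, hb'⟩ := h
        exact hlu j hj' (by rw [hb, ← hb', linv_linv])
      simp [this]
  · have hn : ∀ j ∈ Finset.range w.norm, (u j * ltr (y j)).norm = j + 1 := by
      intro j hj
      rw [norm_eq_length, toWord_mul_of, toWord_ltr, List.length_append, ← norm_eq_length, hu j hj]
      · rfl
      · intro b hb hab
        rw [hd_ltr, Option.some_inj] at hab
        exact hlu j hj (by rw [hb, hab, linv_linv])
    have hmix : ∀ j ∈ Finset.range w.norm, ∀ k ∈ Finset.range w.norm, (y j).1 = (y k).1 →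
        (y j).2 = true → (y k).2 = false → u j ≠ u k * ltr (y k) := by
      intro j hj k hk h1 h2 h3 h4
      apply hlu j hj
      have hl : linv (y j) = y k := by
        rw [linv, h2, h1]
        exact Prod.ext rfl h3.symm
      rw [h4, hl, lst_mul_of, lst_ltr]
      · intro h; have := hd_ltr (y k); rw [h] at this; simp at this
      · intro b hb hab
        rw [hd_ltr, Option.some_inj] at hab
        exact hlu k hk (by rw [hb, hab, linv_linv])
    intro j hj k hk hjk
    have hj := Finset.mem_coe.1 hj
    have hk := Finset.mem_coe.1 hk
    simp only [Sigma.mk.injEq, heq_eq_eq] at hjk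
    obtain ⟨h1, h2⟩ := hjk
    rcases hyj : (y j).2 with _ | _ <;> rcases hyk : (y k).2 with _ | _ <;>
      simp only [hyj, hyk, if_true, Bool.false_eq_true, if_false, inv_inj] at h2
    · have := hn j hj
      rw [h2, hn k hk] at this
      omega
    · exact absurd h2.symm (hmix k hk j hj h1.symm hyk hyj)
    · exact absurd h2 (hmix j hj k hk h1 hyj hyk)
    · have := hu j hj
      rw [h2, hu k hk] at this
      exact this.symm

/-- The cyclic length of an element, measured by the generator sectors. -/
noncomputable def cyclen (w : FreeGroup ι) : ℕ := ∑ i, len (gsec i) w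

lemma cyclen_conj (p w : FreeGroup ι) : cyclen (p⁻¹ * w * p) = cyclen w :=
  Finset.sum_congr rfl fun i _ => len_conj (almInv_sec _) p w

lemma sum_ncard_dif_ltr_le (x : ι × Bool) : ∑ i, (dif (gsec i) (ltr x)).ncard ≤ 1 := by
  have : ∀ i, (dif (gsec i) (ltr x)).ncard ≤ if i = x.1 then 1 else 0 := by
    intro i
    rw [dif_sec_ltr]
    split_ifs with h
    · subst h
      rw [Set.ncard_le_one (by
        refine (Set.toFinite {1, ltr (linv x)}).subset ?_
        rintro g (h | h) <;> simp [h.1])]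
      obtain ⟨i, b⟩ := x
      cases b <;> simp [linv]
    · obtain ⟨k, b⟩ := x
      have h1 : k ≠ i := fun e => h e.symm
      simp [linv, h1]
  refine (Finset.sum_le_sum fun i _ => this i).trans ?_
  simp

lemma cyclen_le_norm (w : FreeGroup ι) : cyclen w ≤ w.norm := by
  have key : ∀ (n : ℕ) (w : FreeGroup ι), w.norm = n → ∑ i, (dif (gsec i) w).ncard ≤ n := by
    intro n
    induction n with
    | zero =>
      intro w hw
      rw [FreeGroup.norm_eq_zero] at hw
      subst hw
      simp [dif_one]
    | succ n ih =>
      intro w hw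
      have hne : hd w ≠ none := by
        rw [Ne, hd_eq_none]
        rintro rfl
        simp at hw
      obtain ⟨a, ha⟩ := Option.ne_none_iff_exists'.1 hne
      obtain ⟨w', h1, h2, _⟩ := exists_of_hd ha
      rw [norm_eq_length, h2, List.length_cons, ← norm_eq_length] at hw
      have h3 := ih w' (by omega)
      have h4 : ∀ i, (dif (gsec i) w).ncard ≤
          (dif (gsec i) (ltr a)).ncard + (dif (gsec i) w').ncard := by
        intro i
        rw [h1]
        exact ncard_dif_mul_le (almInv_sec _ _) (almInv_sec _ _)
      refine (Finset.sum_le_sum fun i _ => h4 i).trans ?_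
      rw [Finset.sum_add_distrib]
      have := sum_ncard_dif_ltr_le a
      omega
  exact (Finset.sum_le_sum fun i _ => len_le EventuallyEq.rfl w).trans (key _ w rfl)

lemma norm_le_cyclen {w : FreeGroup ι} (hw : FreeGroup.IsCyclicallyReduced w.toWord) :
    w.norm ≤ cyclen w := by
  choose C hC using fun i : ι => exists_ncard_dif_pow_le (almInv_sec {(i, true)}) w
  have hpow : ∀ k : ℕ, (w ^ k).norm = k * w.norm := by
    intro k
    rw [norm_eq_length, FreeGroup.toWord_pow, (hw.flatten_replicate k).isReduced.reduce_eq]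
    simp [norm_eq_length]
  have h1 : ∀ k : ℕ, k * w.norm ≤ k * cyclen w + ∑ i, C i := by
    intro k
    rw [← hpow k]
    refine (norm_le_sum_ncard_dif _).trans ((Finset.sum_le_sum fun i _ => hC i k).trans ?_)
    rw [Finset.sum_add_distrib, ← Finset.mul_sum, cyclen]
  by_contra h
  push Not at h
  have h2 := h1 (∑ i, C i + 1)
  have h3 := Nat.mul_le_mul_left (∑ i, C i + 1) (Nat.succ_le_of_lt h)
  rw [Nat.succ_eq_add_one, mul_add] at h3
  omega

end CyclicLength

/-! ### Reductive subsets and dismantling -/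

section Reductive

variable {L : Type*} [Fintype L] [DecidableEq L]

/-- Two subsets are nested if one of the four corners is empty. -/
def NestF (α β : Finset L) : Prop :=
  α ⊆ β ∨ β ⊆ α ∨ Disjoint α β ∨ α ∪ β = Finset.univ

lemma NestF.symm {α β : Finset L} (h : NestF α β) : NestF β α := by
  rcases h with h | h | h | h
  · exact Or.inr (Or.inl h)
  · exact Or.inl h
  · exact Or.inr (Or.inr (Or.inl h.symm))
  · exact Or.inr (Or.inr (Or.inr (by rw [Finset.union_comm, h])))

lemma nestF_refl (α : Finset L) : NestF α α := Or.inl subset_rfl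

lemma nestF_iff {α β : Finset L} : NestF α β ↔
    (∀ x, x ∈ α → x ∈ β) ∨ (∀ x, x ∈ β → x ∈ α) ∨ (∀ x, x ∈ α → x ∉ β) ∨
      (∀ x, x ∉ α → x ∈ β) := by
  rw [NestF, Finset.subset_iff, Finset.subset_iff, Finset.disjoint_left, Finset.ext_iff]
  simp only [Finset.mem_union, Finset.mem_univ, iff_true, or_iff_not_imp_left]

lemma nestF_compl_left {α β : Finset L} : NestF αᶜ β ↔ NestF α β := by
  simp only [nestF_iff, Finset.mem_compl]
  constructor <;> rintro (h | h | h | h) <;> grind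

lemma nestF_compl_right {α β : Finset L} : NestF α βᶜ ↔ NestF α β :=
  ⟨fun h => (nestF_compl_left.1 h.symm).symm, fun h => (nestF_compl_left.2 h.symm).symm⟩

lemma NestF.inter_of_cross {β X μ : Finset L} (hX : NestF β X) (hμ : NestF β μ)
    (hc : ¬ NestF X μ) : NestF β (X ∩ μ) := by
  simp only [nestF_iff, Finset.mem_inter] at *
  push Not at hc
  obtain ⟨⟨a, _⟩, ⟨b, _⟩, ⟨c, _⟩, ⟨d, _⟩⟩ := hc
  rcases hX with h | h | h | h <;> rcases hμ with h' | h' | h' | h' <;> grind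

variable {Λ : Type*} [AddCommGroup Λ] [LinearOrder Λ] [IsOrderedAddMonoid Λ]

/-- `α` separates `a` from its inverse and has smaller weight than `a`. -/
def RedVia (σ : L → L) (wt : Finset L → Λ) (α : Finset L) (a : L) : Prop :=
  a ∈ α ∧ σ a ∉ α ∧ wt α < wt {a}

/-- Axioms for the weights. -/
structure IsWeight (σ : L → L) (wt : Finset L → Λ) : Prop where
  invol : ∀ a, σ (σ a) = a
  compl : ∀ α, wt αᶜ = wt α
  submod : ∀ α β, wt (α ∩ β) + wt (α ∪ β) ≤ wt α + wt β
  single : ∀ a, wt {σ a} = wt {a}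

variable {σ : L → L} {wt : Finset L → Λ}

lemma RedVia.compl (hw : IsWeight σ wt) {α : Finset L} {a : L} (h : RedVia σ wt α a) :
    RedVia σ wt αᶜ (σ a) := by
  refine ⟨by simpa using h.2.1, by simpa [hw.invol] using h.1, ?_⟩
  rw [hw.compl, hw.single]
  exact h.2.2

lemma IsWeight.opposite (hw : IsWeight σ wt) (X Y : Finset L) :
    wt (X ∩ Y) + wt (Xᶜ ∩ Yᶜ) ≤ wt X + wt Y := by
  have := hw.submod X Y
  rwa [← hw.compl (X ∪ Y), Finset.compl_union] at this

lemma exists_reductive_corner (hw : IsWeight σ wt) {μ X : Finset L} {m a : L}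
    (hμ : RedVia σ wt μ m)
    (hmax : ∀ κ b, RedVia σ wt κ b → wt {b} - wt κ ≤ wt {m} - wt μ)
    (hX : RedVia σ wt X a) (hmX : m ∉ X) :
    (∃ b, RedVia σ wt (X ∩ μ) b) ∨ ∃ b, RedVia σ wt (X ∩ μᶜ) b := by
  obtain ⟨hm, hm', hwm⟩ := hμ
  obtain ⟨ha, ha', hwa⟩ := hX
  have hinv := hw.invol
  have hs := hw.single
  have key : ∀ κ b, b ∈ κ → σ b ∉ κ → wt {b} - (wt {m} - wt μ) ≤ wt κ := by
    intro κ b h1 h2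
    rcases lt_or_ge (wt κ) (wt {b}) with h | h
    · have := hmax κ b ⟨h1, h2, h⟩
      rwa [sub_le_comm] at this
    · refine le_trans ?_ h
      rw [sub_le_self_iff, sub_nonneg]
      exact hwm.le
  have o1 := hw.opposite X μ
  have o2 := hw.opposite X μᶜ
  rw [compl_compl, hw.compl] at o2
  by_cases hm2 : σ m ∈ X
  · have k1 := key (Xᶜ ∩ μ) m (by simp [hm, hmX]) (by simp [hm'])
    by_cases haμ' : σ a ∈ μ
    · have k2 := key (Xᶜ ∩ μ) (σ a) (by simp [haμ', ha']) (by simp [hinv, ha])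
      rw [hs] at k2
      refine Or.inr ⟨σ m, by simp [hm2, hm'], by simp [hinv, hmX], ?_⟩
      rw [hs]
      grind
    · by_cases haμ : a ∈ μ
      · rcases lt_or_ge (wt X) (wt {m}) with h | h
        · refine Or.inr ⟨σ m, by simp [hm2, hm'], by simp [hinv, hmX], ?_⟩
          rw [hs]
          grind
        · have k2 := key (Xᶜ ∩ μᶜ) (σ a) (by simp [haμ', ha']) (by simp [hinv, ha])
          rw [hs] at k2
          refine Or.inl ⟨a, by simp [ha, haμ], by simp [ha'], ?_⟩
          grind
      · refine Or.inr ⟨a, by simp [ha, haμ], by simp [ha'], ?_⟩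
        grind
  · have k1 := key (Xᶜ ∩ μ) m (by simp [hm, hmX]) (by simp [hm'])
    have k2 := key (Xᶜ ∩ μᶜ) (σ m) (by simp [hm', hm2]) (by simp [hinv, hm])
    rw [hs] at k2
    by_cases haμ : a ∈ μ
    · refine Or.inl ⟨a, by simp [ha, haμ], by simp [ha'], ?_⟩
      grind
    · refine Or.inr ⟨a, by simp [ha, haμ], by simp [ha'], ?_⟩
      grind

/-- A finite graph whose vertices carry families of subsets, each with a reductive member which is
itself realised by a vertex, is acyclic. -/
theorem acyclic_of_reductive_families {V : Type*} [DecidableEq V] (hw : IsWeight σ wt)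
    {G : SimpleGraph V}
    (P : Finset V) (fam : V → Set (Finset L)) (ω : Finset L → V)
    (hadj : ∀ u ∈ P, ∀ v ∈ P, u ≠ v →
      (G.Adj u v ↔ ∀ α ∈ fam u, ∀ β ∈ fam v, NestF α β))
    (hfam : ∀ u ∈ P, ∀ α ∈ fam u, ∀ β ∈ fam u, NestF α β)
    (hω : ∀ α a, RedVia σ wt α a → ω α ∈ P ∧ α ∈ fam (ω α) ∧
      ∀ β ∈ fam (ω α), ∀ γ, NestF α γ → NestF β γ)
    (hP : ∀ u ∈ P, (∃ α ∈ fam u, ∃ a, RedVia σ wt α a) ∨ ∀ α ∈ fam u, ∀ γ, NestF α γ) :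
    P = ∅ ∨ Acyclic G (P : Set V) := by
  classical
  by_cases htw : ∃ u ∈ P, ∀ α ∈ fam u, ∀ γ, NestF α γ
  · obtain ⟨u, hu, hu'⟩ := htw
    right
    refine acyclic_of_cone (w := u) hu fun v hv hvu => ?_
    rw [hadj u hu v hv hvu.symm]
    exact fun α hα β _ => hu' α hα β
  push Not at htw
  replace hP : ∀ u ∈ P, ∃ α ∈ fam u, ∃ a, RedVia σ wt α a := by
    intro u hu
    rcases hP u hu with h | h
    · exact h
    · obtain ⟨α, hα, γ, hγ⟩ := htw u hu
      exact absurd (h α hα γ) hγ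
  rcases P.eq_empty_or_nonempty with hPe | ⟨u₀, hu₀⟩
  · exact Or.inl hPe
  right
  obtain ⟨α₀, -, a₀, hα₀⟩ := hP u₀ hu₀
  obtain ⟨⟨μ, m⟩, hμ, hmax⟩ := Finset.exists_max_image
    (Finset.univ.filter fun p : Finset L × L => RedVia σ wt p.1 p.2)
    (fun p => wt {p.2} - wt p.1) ⟨(α₀, a₀), by simpa using hα₀⟩
  simp only [Finset.mem_filter, Finset.mem_univ, true_and, Prod.forall] at hμ hmax
  -- adjacency to a reductive vertex
  have hωadj : ∀ κ a, RedVia σ wt κ a → ∀ u ∈ P, u ≠ ω κ → (∀ β ∈ fam u, NestF κ β) →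
      G.Adj (ω κ) u := by
    intro κ a hκ u hu hne h
    obtain ⟨h1, h2, h3⟩ := hω κ a hκ
    rw [hadj _ h1 u hu hne.symm]
    intro β hβ γ hγ
    exact h3 β hβ γ (h γ hγ)
  have hωadj2 : ∀ κ a β b, RedVia σ wt κ a → RedVia σ wt β b → ω β ≠ ω κ → NestF κ β →
      G.Adj (ω κ) (ω β) := by
    intro κ a β b hκ hβ hne h
    refine hωadj κ a hκ _ (hω β b hβ).1 hne fun γ hγ => ?_
    exact ((hω β b hβ).2.2 γ hγ κ h.symm).symm
  set R : Finset V := (Finset.univ.filter fun κ => ∃ a, RedVia σ wt κ a).image ω with hR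
  set T : Finset V :=
    (Finset.univ.filter fun κ => (∃ a, RedVia σ wt κ a) ∧ NestF μ κ).image ω with hT
  have memR : ∀ u, u ∈ R ↔ ∃ κ a, RedVia σ wt κ a ∧ ω κ = u := by
    intro u; simp [hR]
  have memT : ∀ u, u ∈ T ↔ ∃ κ a, RedVia σ wt κ a ∧ NestF μ κ ∧ ω κ = u := by
    intro u; simp [hT, and_assoc]
  have hTac : Acyclic G (T : Set V) := by
    refine acyclic_of_cone (w := ω μ) ?_ fun u hu hne => ?_
    · exact (memT _).2 ⟨μ, m, hμ, nestF_refl μ, rfl⟩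
    · obtain ⟨κ, a, h1, h2, rfl⟩ := (memT _).1 hu
      exact hωadj2 μ m κ a hμ h1 hne h2
  have hTR : T ⊆ R := by
    intro u hu
    obtain ⟨κ, a, h1, h2, rfl⟩ := (memT _).1 hu
    exact (memR _).2 ⟨κ, a, h1, rfl⟩
  have hRac : Acyclic G (R : Set V) := by
    refine acyclic_of_dismantle hTac R (by exact_mod_cast hTR) fun S' hS' hTS' => ?_
    obtain ⟨hTS, v₀, hv₀, hv₀T⟩ := Set.ssubset_iff_exists.1 hTS'
    obtain ⟨κ₀, a₀, hκ₀, rfl⟩ := (memR v₀).1 (hS' hv₀)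
    set Y : Finset L → Finset L := fun κ => if m ∈ κ then κᶜ else κ with hY
    have hYm : ∀ κ, m ∉ Y κ := by
      intro κ; simp only [hY]; split_ifs with h <;> simp [h]
    have hYn : ∀ κ β, NestF β (Y κ) ↔ NestF β κ := by
      intro κ β; simp only [hY]; split_ifs
      · exact nestF_compl_right
      · rfl
    obtain ⟨ν, hν, hmin⟩ := Finset.exists_min_image
      (Finset.univ.filter fun κ => (∃ a, RedVia σ wt κ a) ∧ ω κ ∈ S' ∧ ω κ ∉ T)
      (fun κ => (Y κ).card) ⟨κ₀, by simpa using ⟨⟨a₀, hκ₀⟩, hv₀, hv₀T⟩⟩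
    simp only [Finset.mem_filter, Finset.mem_univ, true_and] at hν hmin
    obtain ⟨⟨a, hνa⟩, hνS, hνT⟩ := hν
    have hcr : ¬ NestF (Y ν) μ := by
      intro h
      exact hνT ((memT _).2 ⟨ν, a, hνa, (hYn _ _).1 h.symm, rfl⟩)
    have hcr' : ¬ NestF (Y ν) μᶜ := fun h => hcr (nestF_compl_right.1 h)
    obtain ⟨a', ha'⟩ : ∃ a', RedVia σ wt (Y ν) a' := by
      simp only [hY]; split_ifs
      · exact ⟨_, hνa.compl hw⟩
      · exact ⟨a, hνa⟩
    obtain ⟨κ, hκ, ⟨b, hb⟩⟩ : ∃ κ, (κ = Y ν ∩ μ ∨ κ = Y ν ∩ μᶜ) ∧ ∃ b, RedVia σ wt κ b := by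
      rcases exists_reductive_corner hw hμ hmax ha' (hYm ν) with h | h
      · exact ⟨_, Or.inl rfl, h⟩
      · exact ⟨_, Or.inr rfl, h⟩
    have hκμ : NestF μ κ := by
      rcases hκ with rfl | rfl
      · exact Or.inr (Or.inl Finset.inter_subset_right)
      · refine Or.inr (Or.inr (Or.inl ?_))
        exact (disjoint_compl_right (a := μ)).mono_right Finset.inter_subset_right
    have hκY : κ ⊆ Y ν := by
      rcases hκ with rfl | rfl <;> exact Finset.inter_subset_left
    have hκT : ω κ ∈ T := (memT _).2 ⟨κ, b, hb, hκμ, rfl⟩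
    have hcompat : ∀ β, NestF β ν → NestF β μ → NestF κ β := by
      intro β h1 h2
      rw [← hYn] at h1
      rcases hκ with rfl | rfl
      · exact (h1.inter_of_cross h2 hcr).symm
      · exact (h1.inter_of_cross (nestF_compl_right.2 h2) hcr').symm
    refine ⟨ω ν, hνS, hνT, ω κ, hTS hκT, ?_, fun u hu hvu huw => ?_⟩
    · refine (hωadj2 κ b ν a hb hνa (fun h => hνT (h ▸ hκT)) ?_)
        |>.symm
      exact (hYn _ _).1 (Or.inl hκY)
    · have hne : ω ν ≠ u := hvu.ne
      by_cases huT : u ∈ T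
      · obtain ⟨β, c, h1, h2, rfl⟩ := (memT _).1 huT
        refine hωadj2 κ b β c hb h1 huw (hcompat β ?_ h2.symm)
        have := (hadj _ (hω ν a hνa).1 _ (hω β c h1).1 hne).1 hvu
        exact (this ν (hω ν a hνa).2.1 β (hω β c h1).2.1).symm
      · obtain ⟨β, c, h1, rfl⟩ := (memR _).1 (hS' hu)
        refine hωadj2 κ b β c hb h1 huw ?_
        have hνβ : NestF ν β := by
          have := (hadj _ (hω ν a hνa).1 _ (hω β c h1).1 hne).1 hvu
          exact this ν (hω ν a hνa).2.1 β (hω β c h1).2.1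
        have hle := hmin β ⟨⟨c, h1⟩, hu, huT⟩
        rw [← hYn] at hνβ ⊢
        have hνβ := ((hYn _ _).2 hνβ.symm)
        rcases hνβ with h | h | h | h
        · rw [Finset.eq_of_subset_of_card_le h hle]
          exact Or.inl hκY
        · exact Or.inl (hκY.trans h)
        · exact Or.inr (Or.inr (Or.inl (h.symm.mono_left hκY)))
        · have : m ∈ Y β ∪ Y ν := by rw [h]; exact Finset.mem_univ _
          rw [Finset.mem_union] at this
          exact absurd this (by simp [hYm])
  have hRP : R ⊆ P := by
    intro u hu
    obtain ⟨κ, a, h1, rfl⟩ := (memR _).1 hu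
    exact (hω κ a h1).1
  refine acyclic_of_dismantle hRac P (by exact_mod_cast hRP) fun S' hS' hRS' => ?_
  obtain ⟨hRS, v, hv, hvR⟩ := Set.ssubset_iff_exists.1 hRS'
  obtain ⟨κ, hκ, a, hκa⟩ := hP v (hS' hv)
  have hκR : ω κ ∈ R := (memR _).2 ⟨κ, a, hκa, rfl⟩
  refine ⟨v, hv, hvR, ω κ, hRS hκR, ?_, fun u hu hvu huw => ?_⟩
  · refine (hωadj κ a hκa v (hS' hv) (fun h => hvR (h ▸ hκR)) fun β hβ => ?_).symm
    exact hfam v (hS' hv) κ hκ β hβ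
  · refine hωadj κ a hκa u (hS' hu) huw fun β hβ => ?_
    exact (hadj v (hS' hv) u (hS' hu) hvu.ne).1 hvu κ hκ β hβ

end Reductive

/-! ### Nested almost invariant sets -/

section Nested

open Filter
open scoped Pointwise

variable {H : Type*}

/-- Two sets are nested if, up to finite sets, one of the four corners is empty. -/
def Nested (U V : Set H) : Prop :=
  (∀ᶠ x in cofinite, x ∈ U → x ∈ V) ∨ (∀ᶠ x in cofinite, x ∈ V → x ∈ U) ∨
    (∀ᶠ x in cofinite, x ∈ U → x ∉ V) ∨ (∀ᶠ x in cofinite, x ∉ U → x ∈ V)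

lemma Nested.symm {U V : Set H} (h : Nested U V) : Nested V U := by
  rcases h with h | h | h | h
  · exact Or.inr (Or.inl h)
  · exact Or.inl h
  · exact Or.inr (Or.inr (Or.inl (h.mono fun x hx h1 h2 => hx h2 h1)))
  · refine Or.inr (Or.inr (Or.inr (h.mono fun x hx h1 => ?_)))
    by_contra h2
    exact h1 (hx h2)

lemma nested_comm {U V : Set H} : Nested U V ↔ Nested V U := ⟨Nested.symm, Nested.symm⟩

lemma Nested.compl_left {U V : Set H} (h : Nested U V) : Nested Uᶜ V := by
  rcases h with h | h | h | h
  · exact Or.inr (Or.inr (Or.inr (h.mono fun x hx h1 => hx (by simpa using h1))))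
  · exact Or.inr (Or.inr (Or.inl (h.mono fun x hx h1 h2 => h1 (hx h2))))
  · exact Or.inr (Or.inl (h.mono fun x hx h1 h2 => hx h2 h1))
  · exact Or.inl h

lemma nested_compl_left {U V : Set H} : Nested Uᶜ V ↔ Nested U V :=
  ⟨fun h => by simpa using h.compl_left, Nested.compl_left⟩

lemma nested_compl_right {U V : Set H} : Nested U Vᶜ ↔ Nested U V := by
  rw [nested_comm, nested_compl_left, nested_comm]

lemma Nested.congr_left {U U' V : Set H} (h : Nested U V) (hU : U =ᶠ[cofinite] U') :
    Nested U' V := by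
  have hU := hU.mem_iff
  rcases h with h | h | h | h
  · exact Or.inl (by filter_upwards [h, hU] with x h1 h2; rwa [← h2])
  · exact Or.inr (Or.inl (by filter_upwards [h, hU] with x h1 h2; rwa [← h2]))
  · exact Or.inr (Or.inr (Or.inl (by filter_upwards [h, hU] with x h1 h2; rwa [← h2])))
  · exact Or.inr (Or.inr (Or.inr (by filter_upwards [h, hU] with x h1 h2; rwa [← h2])))

lemma nested_congr {U U' V V' : Set H} (hU : U =ᶠ[cofinite] U') (hV : V =ᶠ[cofinite] V') :
    Nested U V ↔ Nested U' V' :=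
  ⟨fun h => ((h.congr_left hU).symm.congr_left hV).symm,
    fun h => ((h.congr_left hU.symm).symm.congr_left hV.symm).symm⟩

lemma eventually_image_iff {H' : Type*} (φ : H ≃ H') {p : H' → Prop} :
    (∀ᶠ x in cofinite, p x) ↔ ∀ᶠ x in cofinite, p (φ x) := by
  simp only [eventually_cofinite]
  constructor
  · intro h
    exact h.preimage φ.injective.injOn
  · intro h
    refine (h.image φ).subset fun x hx => ⟨φ.symm x, by simpa using hx, by simp⟩

lemma nested_image_iff {H' : Type*} (φ : H ≃ H') {U V : Set H} :
    Nested (φ '' U) (φ '' V) ↔ Nested U V := by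
  simp only [Nested, eventually_image_iff φ, φ.injective.mem_set_image]

lemma nested_smul_iff [Group H] (g : H) {U V : Set H} : Nested (g • U) (g • V) ↔ Nested U V :=
  nested_image_iff (Equiv.mulLeft g)

lemma nested_smul_left_iff [Group H] (g : H) {U V : Set H} :
    Nested (g • U) V ↔ Nested U (g⁻¹ • V) := by
  rw [← nested_smul_iff g⁻¹, inv_smul_smul]

lemma Nested.inter_of_cross {B X M : Set H} (hX : Nested B X) (hM : Nested B M)
    (hc : ¬ Nested X M) : Nested B (X ∩ M) := by
  simp only [Nested, Set.mem_inter_iff, not_or] at *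
  obtain ⟨c1, c2, c3, c4⟩ := hc
  rcases hX with h | h | h | h <;> rcases hM with h' | h' | h' | h' <;>
  first
  | exact Or.inl (by filter_upwards [h, h'] with x; tauto)
  | exact Or.inr (Or.inl (by filter_upwards [h, h'] with x; tauto))
  | exact Or.inr (Or.inr (Or.inl (by filter_upwards [h, h'] with x; tauto)))
  | exact Or.inr (Or.inr (Or.inr (by filter_upwards [h, h'] with x; tauto)))
  | exact absurd (by filter_upwards [h, h'] with x; tauto) c1
  | exact absurd (by filter_upwards [h, h'] with x; tauto) c2
  | exact absurd (by filter_upwards [h, h'] with x; tauto) c3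
  | exact absurd (by filter_upwards [h, h'] with x; tauto) c4

end Nested

section NestedSectors

open Filter
open scoped Pointwise

variable {ι : Type*} [DecidableEq ι]

lemma sec_compl_almostEq [Fintype ι] (α : Finset (ι × Bool)) :
    sec αᶜ =ᶠ[cofinite] ((sec α)ᶜ : Set (FreeGroup ι)) := by
  rw [almostEq_iff, sec_compl]
  refine (Set.finite_singleton 1).subset fun g hg => ?_
  by_contra h
  exact hg (by simp; intro _; exact h)

lemma sec_singleton_infinite (a : ι × Bool) : (sec {a}).Infinite := by
  have hk : ∀ k : ℕ, hd (ltr a ^ (k + 1)) = some a := by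
    intro k
    induction k with
    | zero => simp
    | succ k ih =>
      rw [pow_succ', hd_ltr_mul]
      rw [ih]
      simp
  refine Set.infinite_of_injective_forall_mem (f := fun k : ℕ => ltr a ^ (k + 1)) ?_ fun k => ?_
  · have hinj : Function.Injective fun k : ℕ => ltr a ^ k :=
      injective_pow_iff_not_isOfFinOrder.2
        (fun h => ltr_ne_one a ((isOfFinOrder_iff_eq_one _).1 h))
    intro i j hij
    have := hinj hij
    omega
  · rw [mem_sec_singleton, hk]

lemma not_eventually_of_infinite {H : Type*} {U : Set H} {p : H → Prop} (hU : U.Infinite)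
    (h : ∀ x ∈ U, ¬ p x) : ¬ ∀ᶠ x in cofinite, p x := by
  rw [eventually_cofinite]
  exact fun hf => hU (hf.subset h)

lemma nested_sec_iff [Fintype ι] {α β : Finset (ι × Bool)} :
    Nested (sec α) (sec β) ↔ NestF α β := by
  have key : ∀ {p : FreeGroup ι → Prop} (a : ι × Bool), (∀ᶠ x in cofinite, p x) →
      ∃ x, hd x = some a ∧ p x := by
    intro p a h
    by_contra hcon
    push Not at hcon
    exact not_eventually_of_infinite (sec_singleton_infinite a)
      (fun x hx => hcon x (mem_sec_singleton.1 hx)) h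
  rw [nestF_iff]
  constructor
  · rintro (h | h | h | h)
    · refine Or.inl fun a ha => ?_
      obtain ⟨x, hx, h⟩ := key a h
      rw [mem_sec_iff hx, mem_sec_iff hx] at h
      exact h ha
    · refine Or.inr (Or.inl fun a ha => ?_)
      obtain ⟨x, hx, h⟩ := key a h
      rw [mem_sec_iff hx, mem_sec_iff hx] at h
      exact h ha
    · refine Or.inr (Or.inr (Or.inl fun a ha => ?_))
      obtain ⟨x, hx, h⟩ := key a h
      rw [mem_sec_iff hx, mem_sec_iff hx] at h
      exact h ha
    · refine Or.inr (Or.inr (Or.inr fun a ha => ?_))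
      obtain ⟨x, hx, h⟩ := key a h
      rw [mem_sec_iff hx, mem_sec_iff hx] at h
      exact h ha
  · rintro (h | h | h | h)
    · exact Or.inl (.of_forall fun x ⟨a, ha, hx⟩ => ⟨a, h a ha, hx⟩)
    · exact Or.inr (Or.inl (.of_forall fun x ⟨a, ha, hx⟩ => ⟨a, h a ha, hx⟩))
    · refine Or.inr (Or.inr (Or.inl (.of_forall fun x ⟨a, ha, hx⟩ => ?_)))
      rw [mem_sec_iff hx]
      exact h a ha
    · refine Or.inr (Or.inr (Or.inr ?_))
      rw [eventually_cofinite]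
      refine (Set.finite_singleton 1).subset fun g hg => ?_
      by_contra h1
      obtain ⟨a, ha⟩ := Option.ne_none_iff_exists'.1 (fun h2 => h1 (hd_eq_none.1 h2))
      apply hg
      rw [mem_sec_iff ha, mem_sec_iff ha]
      exact h a

lemma nested_sec_smul {α β : Finset (ι × Bool)} {g : FreeGroup ι} (hg : g ≠ 1) :
    Nested (sec α) (g • sec β) := by
  obtain ⟨b, hb⟩ := Option.ne_none_iff_exists'.1 (fun h => hg (hd_eq_none.1 h))
  obtain ⟨c, hc⟩ := Option.ne_none_iff_exists'.1 (fun h => hg (lst_eq_none.1 h))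
  have key : ∀ h, hd h ≠ some b → (h ∈ g • sec β ↔ linv c ∈ β) := by
    intro h hh
    rw [Set.mem_smul_set_iff_inv_smul_mem, smul_eq_mul]
    refine mem_sec_iff ?_
    rw [hd_mul_of, hd_inv, hc, Option.map_some]
    · simpa using hg
    · intro a ha
      rw [lst_inv, hb, Option.map_some, Option.some_inj] at ha
      rwa [← ha, linv_linv]
  by_cases hcβ : linv c ∈ β
  · simp only [hcβ, iff_true] at key
    by_cases hbα : b ∈ α
    · refine Or.inr (Or.inr (Or.inr (.of_forall fun x hx => key x fun h => ?_)))
      exact hx ((mem_sec_iff h).2 hbα)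
    · refine Or.inl (.of_forall fun x hx => key x fun h => ?_)
      exact hbα ((mem_sec_iff h).1 hx)
  · simp only [hcβ, iff_false] at key
    by_cases hbα : b ∈ α
    · refine Or.inr (Or.inl (.of_forall fun x hx => ?_))
      by_contra h1
      refine key x (fun h => h1 ((mem_sec_iff h).2 hbα)) hx
    · refine Or.inr (Or.inr (Or.inl (.of_forall fun x hx => key x fun h => ?_)))
      exact hbα ((mem_sec_iff h).1 hx)

lemma nested_sec_smul_iff [Fintype ι] {α β : Finset (ι × Bool)} :
    (∀ g : FreeGroup ι, Nested (sec α) (g • sec β)) ↔ NestF α β := by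
  constructor
  · intro h
    have := h 1
    rwa [one_smul, nested_sec_iff] at this
  · intro h g
    by_cases hg : g = 1
    · rw [hg, one_smul, nested_sec_iff]; exact h
    · exact nested_sec_smul hg

/-- `V` is, up to finite sets, a translate of the sector `α` or of its complement. -/
def IsSector (V : Set (FreeGroup ι)) (α : Finset (ι × Bool)) : Prop :=
  ∃ g : FreeGroup ι, V =ᶠ[cofinite] (g • sec α : Set (FreeGroup ι)) ∨
    (Vᶜ : Set (FreeGroup ι)) =ᶠ[cofinite] (g • sec α : Set (FreeGroup ι))

lemma IsSector.compl {V : Set (FreeGroup ι)} {α : Finset (ι × Bool)} (h : IsSector V α) :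
    IsSector Vᶜ α := by
  obtain ⟨g, h | h⟩ := h
  · exact ⟨g, Or.inr (by simpa using h)⟩
  · exact ⟨g, Or.inl h⟩

lemma IsSector.compl_right [Fintype ι] {V : Set (FreeGroup ι)} {α : Finset (ι × Bool)}
    (h : IsSector V α) : IsSector V αᶜ := by
  obtain ⟨g, h | h⟩ := h
  · refine ⟨g, Or.inr (h.compl.trans ?_)⟩
    rw [← Set.smul_set_compl]
    exact almostEq_smul (sec_compl_almostEq α).symm g
  · refine ⟨g, Or.inl ?_⟩
    have := h.compl
    rw [compl_compl] at this
    refine this.trans ?_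
    rw [← Set.smul_set_compl]
    exact almostEq_smul (sec_compl_almostEq α).symm g

lemma IsSector.congr {V V' : Set (FreeGroup ι)} {α : Finset (ι × Bool)} (h : IsSector V α)
    (hV : V =ᶠ[cofinite] V') : IsSector V' α := by
  obtain ⟨g, h | h⟩ := h
  · exact ⟨g, Or.inl (hV.symm.trans h)⟩
  · exact ⟨g, Or.inr (hV.compl.symm.trans h)⟩

lemma IsSector.len_eq {V : Set (FreeGroup ι)} {α : Finset (ι × Bool)} (h : IsSector V α)
    (w : FreeGroup ι) : len V w = len (sec α) w := by
  obtain ⟨g, h | h⟩ := h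
  · rw [len_congr h, len_smul]
  · rw [← len_compl, len_congr h, len_smul]

lemma IsSector.exists_nested_iff {V : Set (FreeGroup ι)} {α : Finset (ι × Bool)} (h : IsSector V α) :
    ∃ g : FreeGroup ι, ∀ U, Nested V U ↔ Nested (sec α) (g • U) := by
  obtain ⟨g, h | h⟩ := h
  · refine ⟨g⁻¹, fun U => ?_⟩
    rw [nested_congr h (EventuallyEq.refl _ U), nested_smul_left_iff]
  · refine ⟨g⁻¹, fun U => ?_⟩
    rw [← nested_compl_left, nested_congr h (EventuallyEq.refl _ U), nested_smul_left_iff]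

lemma IsSector.forall_nested_iff [Fintype ι] {V V' : Set (FreeGroup ι)} {α β : Finset (ι × Bool)}
    (h : IsSector V α) (h' : IsSector V' β) :
    (∀ g : FreeGroup ι, Nested V (g • V')) ↔ NestF α β := by
  obtain ⟨p, hp⟩ := h.exists_nested_iff
  obtain ⟨q, hq⟩ := h'.exists_nested_iff
  rw [← nested_sec_smul_iff]
  have : ∀ g : FreeGroup ι, Nested V (g • V') ↔
      Nested (sec α) ((p * g * q⁻¹) • sec β) := by
    intro g
    rw [hp, nested_comm, smul_smul, nested_smul_left_iff, hq, nested_comm, smul_smul,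
      nested_smul_left_iff]
    congr! 2
    simp [mul_assoc]
  simp only [this]
  constructor
  · intro h g
    have := h (p⁻¹ * g * q)
    simpa [mul_assoc] using this
  · intro h g
    exact h _

end NestedSectors

/-! ### Classification of sets nested with all sectors -/

section Classification

open Filter
open scoped Pointwise

variable {ι : Type*} [DecidableEq ι]

lemma norm_le_of_mem_pre {h k : FreeGroup ι} (hk : k ∈ pre h) : h.norm ≤ k.norm :=
  (mem_pre.1 hk).length_le

lemma norm_mul_ltr {h : FreeGroup ι} {b : ι × Bool} (hb : lst h ≠ some (linv b)) :
    (h * ltr b).toWord = h.toWord ++ [b] := by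
  rw [toWord_mul_of, toWord_ltr]
  intro a ha hab
  rw [hd_ltr, Option.some_inj] at hab
  exact hb (by rw [ha, hab, linv_linv])

lemma exists_mem_pre_mul {h k : FreeGroup ι} (hk : k ∈ pre h) (hne : k ≠ h) :
    ∃ b, lst h ≠ some (linv b) ∧ k ∈ pre (h * ltr b) := by
  obtain ⟨t, ht⟩ := mem_pre.1 hk
  rcases t with _ | ⟨b, t⟩
  · exact absurd (FreeGroup.toWord_injective (by simpa using ht.symm)) hne
  · have hr := FreeGroup.isReduced_toWord (x := k)
    rw [← ht, isReduced_append_iff] at hr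
    have hb : lst h ≠ some (linv b) := fun hl => hr.2.2 _ hl (by simp)
    refine ⟨b, hb, mem_pre.2 ⟨t, ?_⟩⟩
    rw [norm_mul_ltr hb, ← ht]
    simp

lemma pre_eq_smul {h : FreeGroup ι} (hh : h ≠ 1) :
    ∃ (g : FreeGroup ι) (a : ι × Bool), pre h = g • sec {a} := by
  obtain ⟨c, hc⟩ := Option.ne_none_iff_exists'.1 (fun h1 => hh (lst_eq_none.1 h1))
  obtain ⟨g, h1, -, h2⟩ := exists_of_lst hc
  exact ⟨g, c, by rw [smul_sec_singleton h2, h1]⟩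

lemma sec_linv_eq (a : ι × Bool) : sec {linv a} = ((ltr a)⁻¹ • sec {a})ᶜ := by
  rw [← Set.smul_set_compl, ← ltr_smul_sec, inv_smul_smul]

lemma nested_pre_of_nested_gsec {V : Set (FreeGroup ι)}
    (h : ∀ i (g : FreeGroup ι), Nested V (g • gsec i)) {k : FreeGroup ι} (hk : k ≠ 1) :
    Nested V (pre k) := by
  obtain ⟨g, ⟨i, b⟩, h1⟩ := pre_eq_smul hk
  rw [h1]
  cases b
  · have : sec {((i, false) : ι × Bool)} = ((ltr (i, true))⁻¹ • sec {(i, true)})ᶜ :=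
      sec_linv_eq (i, true)
    rw [this, Set.smul_set_compl, nested_compl_right, smul_smul]
    exact h i _
  · exact h i g

variable [Fintype ι]

lemma AlmInv.exists_bound {V : Set (FreeGroup ι)} (hV : AlmInv V) :
    ∃ R, ∀ h : FreeGroup ι, R < h.norm → (∀ k ∈ pre h, k ∈ V) ∨ ∀ k ∈ pre h, k ∉ V := by
  have hD : (⋃ a : ι × Bool, dif V (ltr a)).Finite := Set.finite_iUnion fun a => hV _
  obtain ⟨R, hR⟩ := (hD.image FreeGroup.norm).bddAbove
  have key : ∀ h : FreeGroup ι, R < h.norm → ∀ (n : ℕ) (k : FreeGroup ι), k.norm = n →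
      k ∈ pre h → (k ∈ V ↔ h ∈ V) := by
    intro h hh n
    induction n with
    | zero =>
      intro k hk hkh
      have := norm_le_of_mem_pre hkh
      omega
    | succ n ih =>
      intro k hk hkh
      have hk1 : lst k ≠ none := by
        rw [Ne, lst_eq_none]; rintro rfl; simp at hk
      obtain ⟨a, ha⟩ := Option.ne_none_iff_exists'.1 hk1
      obtain ⟨k', h1, h2, -⟩ := exists_of_lst ha
      have hkn : k'.norm = n := by
        rw [norm_eq_length, h2, List.length_append] at hk
        rw [norm_eq_length]
        simpa using hk
      rw [mem_pre, h2, List.prefix_concat_iff, ← h2] at hkh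
      rcases hkh with h3 | h3
      · rw [FreeGroup.toWord_injective h3]
      · rw [← ih k' hkn h3]
        have h4 : k' ∉ dif V (ltr a) := by
          intro h5
          have := hR (Set.mem_image_of_mem _ (Set.mem_iUnion.2 ⟨a, h5⟩))
          have := norm_le_of_mem_pre (mem_pre.2 h3)
          omega
        rw [mem_dif, not_not] at h4
        rw [h1, h4]
  refine ⟨R, fun h hh => ?_⟩
  by_cases hV : h ∈ V
  · exact Or.inl fun k hk => (key h hh _ k rfl hk).2 hV
  · exact Or.inr fun k hk hkV => hV ((key h hh _ k rfl hk).1 hkV)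

lemma AlmInv.isSector {V : Set (FreeGroup ι)} (hV : AlmInv V) (hinf : V.Infinite)
    (hinf' : (Vᶜ : Set _).Infinite) (hn : ∀ h : FreeGroup ι, h ≠ 1 → Nested V (pre h)) :
    ∃ α, IsSector V α := by
  classical
  obtain ⟨R, hR⟩ := hV.exists_bound
  -- the case of a prefix set
  have hpre : ∀ (V' : Set (FreeGroup ι)) (h : FreeGroup ι), h ≠ 1 → V' =ᶠ[cofinite] pre h →
      ∃ α, IsSector V' α := by
    intro V' h hh hV'
    obtain ⟨g, a, h1⟩ := pre_eq_smul hh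
    exact ⟨{a}, g, Or.inl (by rwa [← h1])⟩
  have hlong : ∀ V' : Set (FreeGroup ι), V'.Infinite → ∀ h : FreeGroup ι,
      ((∀ k ∈ pre h, k ∈ V') ∨ ∀ k ∈ pre h, k ∉ V') → h ≠ 1 →
      (∀ᶠ x in cofinite, x ∈ V' → x ∈ pre h) → ∃ α, IsSector V' α := by
    intro V' hV' h h1 hh h2
    rcases h1 with h1 | h1
    · refine hpre V' h hh ?_
      filter_upwards [h2] with x hx
      exact propext ⟨hx, h1 x⟩
    · exfalso
      refine hV' ?_
      rw [eventually_cofinite] at h2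
      refine h2.subset fun x hx hx' => h1 x (hx' hx) hx
  -- the main case
  have hmain : ∀ V' : Set (FreeGroup ι), (∀ h : FreeGroup ι, h ≠ 1 → Nested V' (pre h)) →
      ∀ h : FreeGroup ι, (∀ᶠ x in cofinite, x ∈ V' → x ∈ pre h) →
      (∀ h' : FreeGroup ι, h.norm < h'.norm → (¬ ∀ᶠ x in cofinite, x ∈ V' → x ∈ pre h') ∧
        ¬ ∀ᶠ x in cofinite, x ∉ V' → x ∈ pre h') → ∃ α, IsSector V' α := by
    intro V' hn h hh hmax
    set α : Finset (ι × Bool) := Finset.univ.filter fun b =>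
      lst h ≠ some (linv b) ∧ ∀ᶠ x in cofinite, x ∈ pre (h * ltr b) → x ∈ V' with hα
    have h1 : ∀ b, lst h ≠ some (linv b) → b ∉ α →
        ∀ᶠ x in cofinite, x ∈ pre (h * ltr b) → x ∉ V' := by
      intro b hb hbα
      have hlen : h.norm < (h * ltr b).norm := by
        rw [norm_eq_length, norm_eq_length, norm_mul_ltr hb]
        simp
      have hne : h * ltr b ≠ 1 := by
        intro h0
        rw [h0, FreeGroup.norm_one] at hlen
        omega
      obtain ⟨m1, m2⟩ := hmax _ hlen
      rcases hn _ hne with h3 | h3 | h3 | h3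
      · exact absurd h3 m1
      · exact absurd (Finset.mem_filter.2 ⟨Finset.mem_univ _, hb, h3⟩) hbα
      · exact h3.mono fun x hx hx1 hx2 => hx hx2 hx1
      · exact absurd h3 m2
    refine ⟨α, h, Or.inl ?_⟩
    have hA : ∀ᶠ x in cofinite, ∀ b, b ∈ α → x ∈ pre (h * ltr b) → x ∈ V' := by
      rw [eventually_all]
      intro b
      by_cases hb : b ∈ α
      · have := (Finset.mem_filter.1 hb).2.2
        filter_upwards [this] with x hx _
        exact hx
      · exact .of_forall fun x hx => absurd hx hb
    have hB : ∀ᶠ x in cofinite, ∀ b, lst h ≠ some (linv b) → b ∉ α →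
        x ∈ pre (h * ltr b) → x ∉ V' := by
      rw [eventually_all]
      intro b
      by_cases hb : lst h ≠ some (linv b) ∧ b ∉ α
      · filter_upwards [h1 b hb.1 hb.2] with x hx _ _
        exact hx
      · exact .of_forall fun x hx1 hx2 => absurd ⟨hx1, hx2⟩ hb
    have hC : ∀ᶠ x in cofinite, x ≠ h := (Set.finite_singleton h).eventually_cofinite_notMem
    filter_upwards [hA, hB, hC, hh] with x hxA hxB hxC hxh
    refine propext ⟨fun hx => ?_, fun hx => ?_⟩
    · obtain ⟨b, hb, hxb⟩ := exists_mem_pre_mul (hxh hx) hxC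
      have hbα : b ∈ α := by
        by_contra hbα
        exact hxB b hb hbα hxb hx
      rw [← smul_sec_singleton hb] at hxb
      change x ∈ h • sec α
      rw [Set.mem_smul_set_iff_inv_smul_mem] at hxb ⊢
      exact ⟨b, hbα, mem_sec_singleton.1 hxb⟩
    · change x ∈ h • sec α at hx
      rw [Set.mem_smul_set_iff_inv_smul_mem] at hx
      obtain ⟨b, hbα, hb⟩ := hx
      refine hxA b hbα ?_
      rw [← smul_sec_singleton (Finset.mem_filter.1 hbα).2.1,
        Set.mem_smul_set_iff_inv_smul_mem, mem_sec_singleton]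
      exact hb
  have hn' : ∀ h : FreeGroup ι, h ≠ 1 → Nested Vᶜ (pre h) := fun h hh => (hn h hh).compl_left
  have hcompl : (∃ α, IsSector Vᶜ α) → ∃ α, IsSector V α := by
    rintro ⟨α, h⟩
    exact ⟨α, by simpa using h.compl⟩
  let Q : ℕ → Prop := fun n => ∃ h : FreeGroup ι, h.norm = n ∧
    ((∀ᶠ x in cofinite, x ∈ V → x ∈ pre h) ∨ ∀ᶠ x in cofinite, x ∉ V → x ∈ pre h)
  by_cases hQ : ∃ n, R < n ∧ Q n
  · obtain ⟨n, hn1, h, rfl, h1⟩ := hQ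
    have hh : h ≠ 1 := by rintro rfl; simp at hn1
    rcases h1 with h1 | h1
    · exact hlong V hinf h (hR h hn1) hh h1
    · refine hcompl (hlong Vᶜ hinf' h ?_ hh h1)
      rcases hR h hn1 with h2 | h2
      · exact Or.inr fun k hk hk' => hk' (h2 k hk)
      · exact Or.inl h2
  · push Not at hQ
    have hQ0 : Q 0 := ⟨1, by simp, Or.inl (.of_forall fun x _ => by rw [pre_one]; trivial)⟩
    have hle : ∀ n, Q n → n ≤ R := fun n hn => by
      by_contra hlt
      exact hQ n (by omega) hn
    obtain ⟨h, hh, h1⟩ := Nat.findGreatest_spec (P := Q) (Nat.zero_le R) hQ0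
    have hmax : ∀ h' : FreeGroup ι, h.norm < h'.norm → ¬ Q h'.norm := by
      intro h' hlt hq
      have := Nat.le_findGreatest (hle _ hq) hq
      omega
    rcases h1 with h1 | h1
    · refine hmain V hn h h1 fun h' hlt => ⟨fun h2 => ?_, fun h2 => ?_⟩
      · exact hmax h' hlt ⟨h', rfl, Or.inl h2⟩
      · exact hmax h' hlt ⟨h', rfl, Or.inr h2⟩
    · refine hcompl (hmain Vᶜ hn' h h1 fun h' hlt => ⟨fun h2 => ?_, fun h2 => ?_⟩)
      · exact hmax h' hlt ⟨h', rfl, Or.inr h2⟩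
      · refine hmax h' hlt ⟨h', rfl, Or.inl (h2.mono fun x hx hx' => hx (by simpa using hx'))⟩

end Classification

/-! ### Whitehead automorphisms -/

section Whitehead

open Filter
open scoped Pointwise

variable {ι : Type*} [DecidableEq ι]

/-- The Whitehead endomorphism with multiplier `x_k ^ s`. -/
def whiteheadHom (k : ι) (α : Finset (ι × Bool)) (s : ℤ) : FreeGroup ι →* FreeGroup ι :=
  FreeGroup.lift fun i => if i = k then FreeGroup.of k else
    (if (i, true) ∈ α then FreeGroup.of k ^ (-s) else 1) * FreeGroup.of i *
      (if (i, false) ∈ α then FreeGroup.of k ^ s else 1)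

lemma whiteheadHom_self (k : ι) (α : Finset (ι × Bool)) (s : ℤ) :
    whiteheadHom k α s (FreeGroup.of k) = FreeGroup.of k := by
  simp [whiteheadHom]

lemma whiteheadHom_of {k i : ι} (α : Finset (ι × Bool)) (s : ℤ) (h : i ≠ k) :
    whiteheadHom k α s (FreeGroup.of i) =
      (if (i, true) ∈ α then FreeGroup.of k ^ (-s) else 1) * FreeGroup.of i *
      (if (i, false) ∈ α then FreeGroup.of k ^ s else 1) := by
  simp [whiteheadHom, h]

lemma whiteheadHom_comp (k : ι) (α : Finset (ι × Bool)) (s : ℤ) :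
    (whiteheadHom k α s).comp (whiteheadHom k α (-s)) = MonoidHom.id _ := by
  refine FreeGroup.ext_hom _ _ fun i => ?_
  by_cases h : i = k
  · subst h
    simp [whiteheadHom_self]
  · rw [MonoidHom.comp_apply, whiteheadHom_of α _ h]
    by_cases h1 : (i, true) ∈ α <;> by_cases h2 : (i, false) ∈ α <;>
      simp [h1, h2, whiteheadHom_of α _ h, whiteheadHom_self, mul_assoc]

/-- The Whitehead automorphism with multiplier `x_k`. -/
def whitehead (k : ι) (α : Finset (ι × Bool)) : MulAut (FreeGroup ι) :=
  MonoidHom.toMulEquiv (whiteheadHom k α 1) (whiteheadHom k α (-1))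
    (by simpa using whiteheadHom_comp k α (-1)) (whiteheadHom_comp k α 1)

lemma whitehead_self (k : ι) (α : Finset (ι × Bool)) :
    whitehead k α (FreeGroup.of k) = FreeGroup.of k := whiteheadHom_self k α 1

lemma whitehead_of {k i : ι} (α : Finset (ι × Bool)) (h : i ≠ k) :
    whitehead k α (FreeGroup.of i) =
      (if (i, true) ∈ α then (FreeGroup.of k)⁻¹ else 1) * FreeGroup.of i *
      (if (i, false) ∈ α then FreeGroup.of k else 1) := by
  have := whiteheadHom_of α 1 h
  simp only [zpow_neg, zpow_one] at this
  exact this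

lemma mem_dif_mul {H : Type*} [Group H] {U : Set H} {v w g : H} :
    g ∈ dif U (v * w) ↔ ¬(g ∈ dif U v ↔ g * v ∈ dif U w) := by
  simp only [mem_dif, ← mul_assoc]
  tauto

lemma eq_or_eq_compl_of_dif {H : Type*} [Group H] {U V : Set H} {S : Set H}
    (hS : Subgroup.closure S = ⊤) (h : ∀ w ∈ S, dif U w = dif V w) : U = V ∨ U = Vᶜ := by
  have key : ∀ w : H, ∀ g, ((g ∈ U ↔ g ∈ V) ↔ (g * w ∈ U ↔ g * w ∈ V)) := by
    intro w
    have hw : w ∈ Subgroup.closure S := by rw [hS]; trivial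
    induction hw using Subgroup.closure_induction with
    | mem w hw =>
      intro g
      have : g ∈ dif U w ↔ g ∈ dif V w := by rw [h w hw]
      simp only [mem_dif] at this
      tauto
    | one => simp
    | mul v w _ _ hv hw =>
      intro g
      rw [hv g, hw (g * v), mul_assoc]
    | inv w _ hw =>
      intro g
      rw [hw (g * w⁻¹)]
      simp
  by_cases h1 : ((1 : H) ∈ U ↔ (1 : H) ∈ V)
  · left
    ext g
    have := key g 1
    rw [one_mul] at this
    exact this.1 h1
  · right
    ext g
    have := key g 1
    rw [one_mul] at this
    rw [Set.mem_compl_iff]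
    tauto

lemma closure_range_of_image (φ : MulAut (FreeGroup ι)) :
    Subgroup.closure (Set.range fun i => φ (FreeGroup.of i)) = ⊤ := by
  have h1 : (Set.range fun i => φ (FreeGroup.of i)) =
      (φ.toMonoidHom : FreeGroup ι →* FreeGroup ι) '' Set.range FreeGroup.of := by
    rw [← Set.range_comp]; rfl
  rw [h1, ← MonoidHom.map_closure, FreeGroup.closure_range_of, ← MonoidHom.range_eq_map]
  exact MonoidHom.range_eq_top.2 φ.surjective

lemma mem_dif_sec_of {α : Finset (ι × Bool)} {i : ι} {g : FreeGroup ι} :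
    g ∈ dif (sec α) (FreeGroup.of i) ↔
      (g = 1 ∧ (i, true) ∈ α) ∨ (g * FreeGroup.of i = 1 ∧ (i, false) ∈ α) := by
  have h := dif_sec_ltr α (i, true)
  have e : linv ((i, true) : ι × Bool) = (i, false) := rfl
  rw [ltr_linv, e] at h
  have e2 : ltr ((i, true) : ι × Bool) = FreeGroup.of i := rfl
  rw [e2] at h
  rw [h, Set.mem_ofPred_eq, mul_eq_one_iff_eq_inv]

lemma mem_dif_sec_of_inv {α : Finset (ι × Bool)} {i : ι} {g : FreeGroup ι} :
    g ∈ dif (sec α) (FreeGroup.of i)⁻¹ ↔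
      (g = 1 ∧ (i, false) ∈ α) ∨ (g = FreeGroup.of i ∧ (i, true) ∈ α) := by
  have h := dif_sec_ltr α (i, false)
  have e : linv ((i, false) : ι × Bool) = (i, true) := rfl
  rw [e] at h
  have e2 : ltr ((i, true) : ι × Bool) = FreeGroup.of i := rfl
  have e3 : ltr ((i, false) : ι × Bool) = (FreeGroup.of i)⁻¹ := rfl
  rw [e2, e3] at h
  rw [h, Set.mem_ofPred_eq]

lemma whitehead_image_self {k : ι} {α : Finset (ι × Bool)} (h1 : (k, true) ∈ α)
    (h2 : (k, false) ∉ α) : IsSector (whitehead k α '' gsec k) α := by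
  have key : whitehead k α '' gsec k = sec α ∨ whitehead k α '' gsec k = (sec α)ᶜ := by
    refine eq_or_eq_compl_of_dif (closure_range_of_image (whitehead k α)) ?_
    rintro _ ⟨i, rfl⟩
    have e : dif (whitehead k α '' gsec k) (whitehead k α (FreeGroup.of i)) =
        whitehead k α '' dif (gsec k) (FreeGroup.of i) := by
      rw [dif_image]
      congr 2
      exact (whitehead k α).symm_apply_apply _
    dsimp only
    rw [e]
    by_cases hi : i = k
    · subst hi
      rw [whitehead_self]
      ext g
      rw [mem_dif_sec_of]
      constructor
      · rintro ⟨x, hx, rfl⟩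
        rw [mem_dif_sec_of] at hx
        simp at hx
        simp [hx, h1]
      · rintro (⟨rfl, -⟩ | ⟨-, h⟩)
        · exact ⟨1, by simp [mem_dif_sec_of], map_one _⟩
        · exact absurd h h2
    · have e1 : dif (gsec k) (FreeGroup.of i) = ∅ := by
        ext g
        simp [mem_dif_sec_of, hi]
      rw [e1, Set.image_empty, whitehead_of α hi]
      symm
      rw [Set.eq_empty_iff_forall_notMem]
      intro g
      by_cases h3 : (i, true) ∈ α <;> by_cases h4 : (i, false) ∈ α <;>
        simp only [h3, h4, if_true, if_false, one_mul, mul_one, mem_dif_mul, mem_dif_sec_of,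
          mem_dif_sec_of_inv, h1, h2, and_true, and_false, or_false, false_or] <;>
        try simp only [mul_inv_eq_one, ← mul_assoc]
      · have : g = FreeGroup.of k → g * (FreeGroup.of k)⁻¹ * FreeGroup.of i ≠ 1 := by
          rintro rfl; simp
        tauto
      · tauto
      · have : g = 1 → g * FreeGroup.of i ≠ 1 := by
          rintro rfl; simp
        tauto
      · tauto
  refine ⟨1, ?_⟩
  rw [one_smul]
  rcases key with h | h
  · exact Or.inl (by rw [h]; exact EventuallyEq.rfl)
  · exact Or.inr (by rw [h, compl_compl]; exact EventuallyEq.rfl)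

lemma whitehead_image_of_ne {k c : ι} {α : Finset (ι × Bool)} (hc : c ≠ k) :
    IsSector (whitehead k α '' gsec c) {(c, true)} := by
  set p : FreeGroup ι := if (c, true) ∈ α then (FreeGroup.of k)⁻¹ else 1 with hp
  have key : whitehead k α '' gsec c = p • gsec c ∨
      whitehead k α '' gsec c = (p • gsec c)ᶜ := by
    refine eq_or_eq_compl_of_dif (closure_range_of_image (whitehead k α)) ?_
    rintro _ ⟨i, rfl⟩
    have e : dif (whitehead k α '' gsec c) (whitehead k α (FreeGroup.of i)) =
        whitehead k α '' dif (gsec c) (FreeGroup.of i) := by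
      rw [dif_image]
      congr 2
      exact (whitehead k α).symm_apply_apply _
    dsimp only
    rw [e, dif_smul]
    have e0 : dif (gsec c) (FreeGroup.of k) = ∅ := by
      ext g
      simp [mem_dif_sec_of, hc.symm]
    have e0' : dif (gsec c) (FreeGroup.of k)⁻¹ = ∅ := by
      ext g
      simp [mem_dif_sec_of_inv, hc.symm]
    by_cases hi : i = k
    · subst hi
      rw [whitehead_self, e0]
      simp
    · have e1 : dif (gsec c) (whitehead k α (FreeGroup.of i)) = (fun g => g *
          (if (i, true) ∈ α then (FreeGroup.of k)⁻¹ else 1)) ⁻¹'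
          dif (gsec c) (FreeGroup.of i) := by
        ext g
        rw [whitehead_of α hi]
        by_cases h3 : (i, true) ∈ α <;> by_cases h4 : (i, false) ∈ α <;>
          simp [h3, h4, mem_dif_mul, e0, e0']
      rw [e1]
      by_cases hic : i = c
      · subst hic
        rw [← hp]
        have e2 : dif (gsec i) (FreeGroup.of i) = {1} := by
          ext g
          simp [mem_dif_sec_of]
        rw [e2, Set.image_singleton, map_one]
        ext g
        rw [Set.mem_smul_set_iff_inv_smul_mem]
        simp only [Set.mem_singleton_iff, Set.mem_preimage, smul_eq_mul]
        rw [mul_assoc, inv_mul_eq_one]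
        constructor
        · rintro rfl; simp
        · intro h; simpa using h.symm
      · have e2 : dif (gsec c) (FreeGroup.of i) = ∅ := by
          ext g
          simp [mem_dif_sec_of, hic]
        rw [e2]
        simp
  refine ⟨p, ?_⟩
  rcases key with h | h
  · exact Or.inl (by rw [h]; exact EventuallyEq.rfl)
  · exact Or.inr (by rw [h, compl_compl]; exact EventuallyEq.rfl)

/-- Every set of letters splitting a generator is realised by an automorphism. -/
lemma exists_mulAut_image [Fintype ι] {k : ι} {α : Finset (ι × Bool)}
    (h : ¬((k, true) ∈ α ↔ (k, false) ∈ α)) :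
    ∃ ψ : MulAut (FreeGroup ι), IsSector (ψ '' gsec k) α ∧
      ∀ i, i ≠ k → IsSector (ψ '' gsec i) {(i, true)} := by
  by_cases h1 : (k, true) ∈ α
  · have h2 : (k, false) ∉ α := by tauto
    exact ⟨whitehead k α, whitehead_image_self h1 h2, fun i hi => whitehead_image_of_ne hi⟩
  · have h2 : (k, false) ∈ α := by tauto
    refine ⟨whitehead k αᶜ, ?_, fun i hi => whitehead_image_of_ne hi⟩
    have := (whitehead_image_self (k := k) (α := αᶜ) (by simpa using h1) (by simpa using h2))
    simpa using this.compl_right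

end Whitehead

/-! ### Parity of crossings -/

section Parity

open Filter
open scoped Pointwise

variable {H : Type*} [Group H]

/-- The parity of the number of changes of membership. -/
noncomputable def parity (U : Set H) (w : H) : ZMod 2 := ((dif U w).ncard : ZMod 2)

lemma natCast_ncard_symmDiff {A B : Set H} (hA : A.Finite) (hB : B.Finite) :
    ((symmDiff A B).ncard : ZMod 2) = A.ncard + B.ncard := by
  have h1 := Set.ncard_inter_add_ncard_sdiff_eq_ncard A B hA
  have h2 := Set.ncard_inter_add_ncard_sdiff_eq_ncard B A hB
  have h3 : (symmDiff A B).ncard = (A \ B).ncard + (B \ A).ncard := by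
    rw [Set.symmDiff_def, Set.ncard_union_eq disjoint_sdiff_sdiff hA.sdiff hB.sdiff]
  rw [h3, ← h1, ← h2, Set.inter_comm B A]
  push_cast
  linear_combination -(CharTwo.add_self_eq_zero ((A ∩ B).ncard : ZMod 2))

lemma parity_mul {U : Set H} (hU : AlmInv U) (v w : H) :
    parity U (v * w) = parity U v + parity U w := by
  have : dif U (v * w) = symmDiff (dif U v) ((· * v) ⁻¹' dif U w) := by
    ext g
    rw [mem_dif_mul, Set.mem_symmDiff, Set.mem_preimage]
    tauto
  rw [parity, this, natCast_ncard_symmDiff (hU v) (preimage_mul_right_finite (hU w) v),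
    preimage_mul_right_ncard]
  rfl

lemma parity_congr {U V : Set H} (hU : AlmInv U) (h : U =ᶠ[cofinite] V) (w : H) :
    parity U w = parity V w := by
  have hV : AlmInv V := hU.congr h
  rw [almostEq_iff] at h
  have : symmDiff (dif U w) (dif V w) =
      symmDiff {g | ¬(g ∈ U ↔ g ∈ V)} ((· * w) ⁻¹' {g | ¬(g ∈ U ↔ g ∈ V)}) := by
    ext g
    simp only [Set.mem_symmDiff, mem_dif, Set.mem_preimage, Set.mem_ofPred_eq]
    tauto
  have h2 := congrArg (fun s : Set H => (s.ncard : ZMod 2)) this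
  beta_reduce at h2
  rw [natCast_ncard_symmDiff (hU w) (hV w),
    natCast_ncard_symmDiff h (preimage_mul_right_finite h w), preimage_mul_right_ncard,
    CharTwo.add_self_eq_zero] at h2
  exact CharTwo.add_eq_zero.1 h2

lemma parity_compl (U : Set H) (w : H) : parity Uᶜ w = parity U w := by
  rw [parity, dif_compl, parity]

lemma parity_smul (g : H) (U : Set H) (w : H) : parity (g • U) w = parity U w := by
  rw [parity, dif_smul, parity, Set.ncard_smul_set]

lemma parity_image (φ : H ≃* H) (U : Set H) (w : H) :
    parity (φ '' U) (φ w) = parity U w := by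
  rw [parity, dif_image, parity, Set.ncard_image_of_injective _ φ.injective]
  simp

end Parity

section ParityFree

open Filter
open scoped Pointwise

variable {ι : Type*} [DecidableEq ι]

lemma IsSector.almInv {V : Set (FreeGroup ι)} {α : Finset (ι × Bool)} (h : IsSector V α) :
    AlmInv V := by
  obtain ⟨g, h | h⟩ := h
  · exact ((almInv_sec α).smul g).congr h.symm
  · have := (((almInv_sec α).smul g).congr h.symm).compl
    rwa [compl_compl] at this

lemma IsSector.parity_eq {V : Set (FreeGroup ι)} {α : Finset (ι × Bool)} (h : IsSector V α)
    (w : FreeGroup ι) : parity V w = parity (sec α) w := by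
  have hV := h.almInv
  obtain ⟨g, h | h⟩ := h
  · rw [parity_congr hV h, parity_smul]
  · rw [← parity_compl, parity_congr hV.compl h, parity_smul]

lemma parity_sec_of (α : Finset (ι × Bool)) (i : ι) :
    parity (sec α) (FreeGroup.of i) =
      (if (i, true) ∈ α then 1 else 0) + if (i, false) ∈ α then 1 else 0 := by
  have h1 : (FreeGroup.of i)⁻¹ ≠ (1 : FreeGroup ι) := by simp
  have : dif (sec α) (FreeGroup.of i) = {g | (g = 1 ∧ (i, true) ∈ α) ∨
      (g = (FreeGroup.of i)⁻¹ ∧ (i, false) ∈ α)} := by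
    ext g
    rw [mem_dif_sec_of, mul_eq_one_iff_eq_inv]
    rfl
  rw [parity, this]
  by_cases h3 : (i, true) ∈ α <;> by_cases h4 : (i, false) ∈ α <;> simp only [h3, h4, and_true,
    and_false, or_false, false_or, if_true, if_false]
  · have : {g : FreeGroup ι | g = 1 ∨ g = (FreeGroup.of i)⁻¹} = {1, (FreeGroup.of i)⁻¹} := rfl
    rw [this, Set.ncard_pair h1.symm]
    rfl
  · have : {g : FreeGroup ι | g = 1} = {1} := rfl
    rw [this, Set.ncard_singleton]
    rfl
  · have : {g : FreeGroup ι | g = (FreeGroup.of i)⁻¹} = {(FreeGroup.of i)⁻¹} := rfl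
    rw [this, Set.ncard_singleton]
    rfl
  · simp

lemma eq_sum_parity [Fintype ι] {c : FreeGroup ι → ZMod 2} (hc : ∀ v w, c (v * w) = c v + c w)
    (w : FreeGroup ι) : c w = ∑ k, parity (gsec k) w * c (FreeGroup.of k) := by
  have hc1 : c 1 = 0 := by simpa using hc 1 1
  let f : FreeGroup ι →* Multiplicative (ZMod 2) :=
    { toFun := fun w => Multiplicative.ofAdd (c w)
      map_one' := by rw [hc1]; rfl
      map_mul' := fun v w => by rw [hc]; rfl }
  have hd1 : ∀ v w, (∑ k, parity (gsec k) (v * w) * c (FreeGroup.of k)) =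
      (∑ k, parity (gsec k) v * c (FreeGroup.of k)) +
      ∑ k, parity (gsec k) w * c (FreeGroup.of k) := by
    intro v w
    rw [← Finset.sum_add_distrib]
    refine Finset.sum_congr rfl fun k _ => ?_
    rw [parity_mul (almInv_sec _), add_mul]
  let f' : FreeGroup ι →* Multiplicative (ZMod 2) :=
    { toFun := fun w => Multiplicative.ofAdd (∑ k, parity (gsec k) w * c (FreeGroup.of k))
      map_one' := by
        have := hd1 1 1
        rw [one_mul] at this
        rw [left_eq_add.1 this]; rfl
      map_mul' := fun v w => by rw [hd1]; rfl }
  have : f = f' := by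
    refine FreeGroup.ext_hom _ _ fun i => ?_
    change Multiplicative.ofAdd (c (FreeGroup.of i)) =
      Multiplicative.ofAdd (∑ k, parity (gsec k) (FreeGroup.of i) * c (FreeGroup.of k))
    congr 1
    rw [Finset.sum_eq_single i]
    · simp [parity_sec_of]
    · intro k _ hk
      simp [parity_sec_of, hk.symm]
    · simp
  have h2 := congrArg (fun F : FreeGroup ι →* Multiplicative (ZMod 2) => (F w).toAdd) this
  exact h2

/-- The sectors representing an automorphism split the generators in some order. -/
lemma exists_perm_split [Fintype ι] (ψ : MulAut (FreeGroup ι)) (A : ι → Finset (ι × Bool))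
    (hA : ∀ i, IsSector (ψ '' gsec i) (A i)) :
    ∃ π : Equiv.Perm ι, ∀ i, ¬((π i, true) ∈ A i ↔ (π i, false) ∈ A i) := by
  let M : Matrix ι ι (ZMod 2) := Matrix.of fun i j => parity (ψ '' gsec i) (FreeGroup.of j)
  let N : Matrix ι ι (ZMod 2) := Matrix.of fun k l => parity (gsec k) (ψ (FreeGroup.of l))
  have hMN : M * N = 1 := by
    ext i l
    rw [Matrix.mul_apply]
    have h1 := eq_sum_parity (fun v w => parity_mul (hA i).almInv v w) (ψ (FreeGroup.of l))
    rw [parity_image, parity_sec_of] at h1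
    calc ∑ k, M i k * N k l = ∑ k, parity (gsec k) (ψ (FreeGroup.of l)) *
          parity (ψ '' gsec i) (FreeGroup.of k) :=
        Finset.sum_congr rfl fun k _ => mul_comm _ _
      _ = _ := by
        rw [← h1, Matrix.one_apply]
        simp [eq_comm]
  have hdet : M.det ≠ 0 := by
    have := congrArg Matrix.det hMN
    rw [Matrix.det_mul, Matrix.det_one] at this
    exact left_ne_zero_of_mul_eq_one this
  rw [Matrix.det_apply] at hdet
  obtain ⟨σ, -, hσ⟩ := Finset.exists_ne_zero_of_sum_ne_zero hdet
  have hσ' : ∏ i, M (σ i) i ≠ 0 := fun h => hσ (by rw [h, smul_zero])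
  rw [Finset.prod_ne_zero_iff] at hσ'
  refine ⟨σ⁻¹, fun i h => ?_⟩
  have h1 := hσ' (σ⁻¹ i) (Finset.mem_univ _)
  rw [show σ (σ⁻¹ i) = i by simp] at h1
  apply h1
  change parity (ψ '' gsec i) (FreeGroup.of (σ⁻¹ i)) = 0
  rw [(hA i).parity_eq, parity_sec_of]
  simp only [h]
  exact CharTwo.add_self_eq_zero _

end ParityFree

/-! ### Automorphisms of bounded translation lengths -/

section Properness

variable {ι : Type*} [DecidableEq ι]

lemma exists_hd_lst_of_not_cyclicallyReduced {u : FreeGroup ι}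
    (h : ¬ FreeGroup.IsCyclicallyReduced u.toWord) :
    ∃ b, hd u = some b ∧ lst u = some (linv b) := by
  have h1 : ¬ ∀ a ∈ u.toWord.getLast?, ∀ b ∈ u.toWord.head?, a.1 = b.1 → a.2 = b.2 :=
    fun h2 => h ⟨FreeGroup.isReduced_toWord, h2⟩
  push Not at h1
  obtain ⟨a, ha, b, hb, hab⟩ := h1
  refine ⟨b, hb, ?_⟩
  have h2 : ¬ b ≠ linv a := fun h3 => hab.2 (reduced_rel_iff.2 h3 hab.1)
  push Not at h2
  rw [h2, linv_linv]
  exact ha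

lemma norm_conj_ltr_le_of_hd {u : FreeGroup ι} {b : ι × Bool} (h : hd u = some b) :
    ((ltr b)⁻¹ * u * ltr b).norm ≤ u.norm := by
  obtain ⟨g', hg, hw, -⟩ := exists_of_hd h
  have h1 : (ltr b)⁻¹ * u * ltr b = g' * ltr b := by rw [hg]; group
  have h2 : u.norm = g'.norm + 1 := by rw [norm_eq_length, norm_eq_length, hw]; rfl
  have h3 : (ltr b).norm = 1 := by rw [norm_eq_length, toWord_ltr]; rfl
  rw [h1, h2, ← h3]
  exact FreeGroup.norm_mul_le _ _

lemma norm_conj_ltr_inv (u : FreeGroup ι) (b : ι × Bool) :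
    ((ltr b)⁻¹ * u⁻¹ * ltr b).norm = ((ltr b)⁻¹ * u * ltr b).norm := by
  rw [← FreeGroup.norm_inv_eq]
  congr 1
  group

lemma norm_conj_ltr_le_of_lst {u : FreeGroup ι} {b : ι × Bool} (h : lst u = some (linv b)) :
    ((ltr b)⁻¹ * u * ltr b).norm ≤ u.norm := by
  have h1 : hd u⁻¹ = some b := by rw [hd_inv, h]; simp
  have := norm_conj_ltr_le_of_hd h1
  rwa [norm_conj_ltr_inv, FreeGroup.norm_inv_eq] at this

lemma norm_conj_ltr_lt {u : FreeGroup ι} {b : ι × Bool} (h : hd u = some b)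
    (h' : lst u = some (linv b)) : ((ltr b)⁻¹ * u * ltr b).norm < u.norm := by
  obtain ⟨g', hg, hw, -⟩ := exists_of_hd h
  have h2 : u.norm = g'.norm + 1 := by rw [norm_eq_length, norm_eq_length, hw]; rfl
  have hg' : g' ≠ 1 := by
    rintro rfl
    rw [mul_one] at hg
    rw [hg, lst_ltr] at h'
    simp at h'
  have h3 : lst g' = some (linv b) := by
    rw [← h', lst, lst, hw]
    obtain ⟨c, hc⟩ := Option.ne_none_iff_exists'.1 (mt lst_eq_none.1 hg')
    rw [lst] at hc
    rw [List.getLast?_cons, hc]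
    rfl
  obtain ⟨k, hk, hkw, -⟩ := exists_of_lst h3
  have h4 : g'.norm = k.norm + 1 := by rw [norm_eq_length, norm_eq_length, hkw]; simp
  have h1 : (ltr b)⁻¹ * u * ltr b = k := by rw [hg, hk, ltr_linv]; group
  rw [h1]
  omega

variable {κ : Type*} [Fintype κ]

lemma norm_le_cyclen_of_minimal [Fintype ι] {t : κ → FreeGroup ι}
    (hmin : ∀ q, ∑ i, (t i).norm ≤ ∑ i, (q⁻¹ * t i * q).norm) (i : κ) :
    (t i).norm ≤ cyclen (t i) ∨ ∃ j, t j ≠ 1 ∧ (t i).norm + (t j).norm ≤ cyclen (t i * t j) := by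
  by_cases hc : FreeGroup.IsCyclicallyReduced (t i).toWord
  · exact Or.inl (norm_le_cyclen hc)
  obtain ⟨b, hb, hb'⟩ := exists_hd_lst_of_not_cyclicallyReduced hc
  right
  have h1 : ∃ j, (t j).norm < ((ltr b)⁻¹ * t j * ltr b).norm := by
    by_contra! h
    exact absurd (hmin (ltr b)) (not_le.2 (Finset.sum_lt_sum (fun j _ => h j)
      ⟨i, Finset.mem_univ i, norm_conj_ltr_lt hb hb'⟩))
  obtain ⟨j, hj⟩ := h1
  have hj1 : t j ≠ 1 := by
    intro h
    rw [h] at hj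
    simp at hj
  have hjh : hd (t j) ≠ some b := fun h => (norm_conj_ltr_le_of_hd h).not_gt hj
  have hjl : lst (t j) ≠ some (linv b) := fun h => (norm_conj_ltr_le_of_lst h).not_gt hj
  refine ⟨j, hj1, ?_⟩
  have hi1 : t i ≠ 1 := by
    intro h
    rw [h] at hb
    simp at hb
  have hij : ∀ a, lst (t i) = some a → hd (t j) ≠ some (linv a) := by
    intro a ha
    rw [hb', Option.some_inj] at ha
    rw [← ha, linv_linv]
    exact hjh
  have hw := toWord_mul_of hij
  have hn : (t i).norm + (t j).norm = (t i * t j).norm := by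
    rw [norm_eq_length, norm_eq_length, norm_eq_length, hw, List.length_append]
  rw [hn]
  apply norm_le_cyclen
  refine ⟨FreeGroup.isReduced_toWord, fun a ha c hc' => ?_⟩
  have ha' : lst (t i * t j) = some a := ha
  have hc'' : hd (t i * t j) = some c := hc'
  rw [lst_mul_of hj1 hij] at ha'
  rw [hd_mul_of hi1 hij, hb, Option.some_inj] at hc''
  rw [reduced_rel_iff, ← hc'']
  intro h
  apply hjl
  rw [ha', h, linv_linv]

lemma exists_minimal_conj (t : κ → FreeGroup ι) :
    ∃ p : FreeGroup ι, ∀ q, ∑ i, (p⁻¹ * t i * p).norm ≤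
      ∑ i, (q⁻¹ * (p⁻¹ * t i * p) * q).norm := by
  let f : FreeGroup ι → ℕ := fun p => ∑ i, (p⁻¹ * t i * p).norm
  refine ⟨Function.argmin f, fun q => ?_⟩
  have h := Function.argmin_le f (Function.argmin f * q)
  refine h.trans_eq (Finset.sum_congr rfl fun i _ => ?_)
  congr 1
  group

lemma finite_norm_le [Fintype ι] (M : ℕ) : {w : FreeGroup ι | w.norm ≤ M}.Finite :=
  ((List.finite_length_le (ι × Bool) M).preimage FreeGroup.toWord_injective.injOn).subset
    fun _ h => h

variable [Fintype ι]

lemma finite_mulAut_norm_le (M : ℕ) :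
    {ψ : MulAut (FreeGroup ι) | ∀ i, (ψ (FreeGroup.of i)).norm ≤ M}.Finite := by
  have h : (Set.univ.pi fun _ : ι => {w : FreeGroup ι | w.norm ≤ M}).Finite :=
    Set.Finite.pi fun _ => finite_norm_le M
  refine (h.preimage (f := fun (ψ : MulAut (FreeGroup ι)) i => ψ (FreeGroup.of i)) ?_).subset ?_
  · intro ψ _ χ _ h
    apply MulEquiv.toMonoidHom_injective
    exact FreeGroup.ext_hom _ _ fun i => congrFun h i
  · intro ψ h i _
    exact h i

lemma mk_mul_conj (φ : MulAut (FreeGroup ι)) (p : FreeGroup ι) :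
    ((φ * MulAut.conj p : MulAut (FreeGroup ι)) : OuterAutomorphismGroup (FreeGroup ι)) = φ :=
  QuotientGroup.mk_mul_of_mem _ ⟨p, rfl⟩

/-- Only finitely many outer automorphisms have bounded translation lengths. -/
lemma finite_cyclen_le (M : ℕ) :
    {x : OuterAutomorphismGroup (FreeGroup ι) | ∃ φ : MulAut (FreeGroup ι),
      (φ : OuterAutomorphismGroup (FreeGroup ι)) = x ∧
      (∀ i, cyclen (φ⁻¹ (FreeGroup.of i)) ≤ M) ∧
      ∀ i j, cyclen (φ⁻¹ (FreeGroup.of i * FreeGroup.of j)) ≤ M}.Finite := by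
  refine ((finite_mulAut_norm_le (ι := ι) M).image fun ψ =>
    ((ψ⁻¹ : MulAut (FreeGroup ι)) : OuterAutomorphismGroup (FreeGroup ι))).subset ?_
  rintro x ⟨φ, rfl, h1, h2⟩
  obtain ⟨p, hp⟩ := exists_minimal_conj fun i => φ⁻¹ (FreeGroup.of i)
  refine ⟨(φ * MulAut.conj p)⁻¹, fun i => ?_, ?_⟩
  · have he : (φ * MulAut.conj p)⁻¹ (FreeGroup.of i) = p⁻¹ * φ⁻¹ (FreeGroup.of i) * p := by
      rw [mul_inv_rev, MulAut.mul_apply, MulAut.conj_inv_apply]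
    rw [he]
    rcases norm_le_cyclen_of_minimal hp i with h | ⟨j, -, h⟩
    · exact h.trans ((cyclen_conj _ _).trans_le (h1 i))
    · have h3 : p⁻¹ * φ⁻¹ (FreeGroup.of i) * p * (p⁻¹ * φ⁻¹ (FreeGroup.of j) * p) =
          p⁻¹ * φ⁻¹ (FreeGroup.of i * FreeGroup.of j) * p := by rw [map_mul]; group
      rw [h3, cyclen_conj] at h
      exact le_trans (by omega) (h.trans (h2 i j))
  · change (((φ * MulAut.conj p)⁻¹⁻¹ : MulAut (FreeGroup ι)) :
      OuterAutomorphismGroup (FreeGroup ι)) = _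
    rw [inv_inv, mk_mul_conj]

end Properness

/-! ### The graph of compatible outer automorphisms -/

section OutGraph

open Filter
open scoped Pointwise

variable {ι : Type*} [DecidableEq ι]

/-- The generating cuts of `φ` and `ψ` are pairwise nested. -/
def Compat (φ ψ : MulAut (FreeGroup ι)) : Prop :=
  ∀ i j (g : FreeGroup ι), Nested (φ '' gsec i) (g • (ψ '' gsec j : Set (FreeGroup ι)))

lemma Compat.symm {φ ψ : MulAut (FreeGroup ι)} (h : Compat φ ψ) : Compat ψ φ := by
  intro i j g
  have h1 := (nested_smul_iff g).2 (h j i g⁻¹)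
  rw [smul_inv_smul] at h1
  exact h1.symm

lemma mulAut_image_smul (χ : MulAut (FreeGroup ι)) (g : FreeGroup ι) (S : Set (FreeGroup ι)) :
    χ '' (g • S) = χ g • (χ '' S : Set (FreeGroup ι)) :=
  Set.image_smul_distrib χ g S

lemma mulAut_mul_image (χ φ : MulAut (FreeGroup ι)) (S : Set (FreeGroup ι)) :
    (χ * φ : MulAut (FreeGroup ι)) '' S = χ '' (φ '' S) := by
  rw [← Set.image_comp]
  rfl

lemma mulAut_one_image (S : Set (FreeGroup ι)) :
    (1 : MulAut (FreeGroup ι)) '' S = S := Set.image_id S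

lemma compat_mul_left (χ φ ψ : MulAut (FreeGroup ι)) :
    Compat (χ * φ) (χ * ψ) ↔ Compat φ ψ := by
  have h : ∀ i j g, Nested ((χ * φ : MulAut (FreeGroup ι)) '' gsec i)
      (χ g • ((χ * ψ : MulAut (FreeGroup ι)) '' gsec j : Set (FreeGroup ι))) ↔
      Nested (φ '' gsec i) (g • (ψ '' gsec j : Set (FreeGroup ι))) := by
    intro i j g
    rw [mulAut_mul_image, mulAut_mul_image, ← mulAut_image_smul]
    exact nested_image_iff χ.toEquiv
  refine ⟨fun H i j g => (h i j g).1 (H i j _), fun H i j g => ?_⟩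
  obtain ⟨g, rfl⟩ := χ.surjective g
  exact (h i j g).2 (H i j g)

lemma image_conj_almostEq {U : Set (FreeGroup ι)} (hU : AlmInv U) (p : FreeGroup ι) :
    (MulAut.conj p '' U : Set (FreeGroup ι)) =ᶠ[cofinite] (p • U : Set (FreeGroup ι)) := by
  rw [almostEq_iff]
  refine ((hU p).smul_set (a := p)).subset fun g hg => ?_
  rw [Set.mem_smul_set_iff_inv_smul_mem, mem_dif]
  intro h
  apply hg
  rw [Set.mem_smul_set_iff_inv_smul_mem, h]
  constructor
  · rintro ⟨u, hu, rfl⟩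
    simpa [MulAut.conj_apply, mul_assoc] using hu
  · intro h2
    exact ⟨_, h2, by simp [MulAut.conj_apply, mul_assoc]⟩

lemma mul_conj_image_almostEq (ψ : MulAut (FreeGroup ι)) (p : FreeGroup ι) (i : ι) :
    ((ψ * MulAut.conj p : MulAut (FreeGroup ι)) '' gsec i : Set (FreeGroup ι)) =ᶠ[cofinite]
      (ψ p • (ψ '' gsec i : Set (FreeGroup ι)) : Set (FreeGroup ι)) := by
  rw [mulAut_mul_image, ← mulAut_image_smul]
  exact almostEq_image (image_conj_almostEq (almInv_sec _) p) ψ.toEquiv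

lemma compat_mul_conj_right (φ ψ : MulAut (FreeGroup ι)) (p : FreeGroup ι) :
    Compat φ (ψ * MulAut.conj p) ↔ Compat φ ψ := by
  have h : ∀ i j g, Nested (φ '' gsec i)
      (g • ((ψ * MulAut.conj p : MulAut (FreeGroup ι)) '' gsec j : Set (FreeGroup ι))) ↔
      Nested (φ '' gsec i) ((g * ψ p) • (ψ '' gsec j : Set (FreeGroup ι))) := by
    intro i j g
    rw [mul_smul]
    exact nested_congr (EventuallyEq.refl _ _) (almostEq_smul (mul_conj_image_almostEq ψ p j) g)
  refine ⟨fun H i j g => ?_, fun H i j g => (h i j g).2 (H i j _)⟩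
  have := (h i j (g * (ψ p)⁻¹)).1 (H i j _)
  rwa [inv_mul_cancel_right] at this

lemma exists_mul_conj {φ ψ : MulAut (FreeGroup ι)}
    (h : (φ : OuterAutomorphismGroup (FreeGroup ι)) = ψ) :
    ∃ p, ψ = φ * MulAut.conj p := by
  obtain ⟨p, hp⟩ := QuotientGroup.eq.1 h
  exact ⟨p, by rw [hp, mul_inv_cancel_left]⟩

lemma compat_congr {φ φ' ψ ψ' : MulAut (FreeGroup ι)}
    (h : (φ : OuterAutomorphismGroup (FreeGroup ι)) = φ')
    (h' : (ψ : OuterAutomorphismGroup (FreeGroup ι)) = ψ') : Compat φ ψ ↔ Compat φ' ψ' := by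
  obtain ⟨p, rfl⟩ := exists_mul_conj h
  obtain ⟨q, rfl⟩ := exists_mul_conj h'
  rw [compat_mul_conj_right]
  constructor
  · exact fun H => ((compat_mul_conj_right _ _ _).2 H.symm).symm
  · exact fun H => ((compat_mul_conj_right _ _ _).1 H.symm).symm

lemma mk_out (x : OuterAutomorphismGroup (FreeGroup ι)) :
    ((Quotient.out x : MulAut (FreeGroup ι)) : OuterAutomorphismGroup (FreeGroup ι)) = x :=
  QuotientGroup.out_eq' x

/-- Outer automorphisms are adjacent if they are distinct and compatible. -/
def outGraph (ι : Type*) [DecidableEq ι] :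
    SimpleGraph (OuterAutomorphismGroup (FreeGroup ι)) where
  Adj x y := x ≠ y ∧ Compat (Quotient.out x) (Quotient.out y)
  symm := ⟨fun _ _ h => ⟨h.1.symm, h.2.symm⟩⟩
  loopless := ⟨fun _ h => h.1 rfl⟩

lemma outGraph_adj {φ ψ : MulAut (FreeGroup ι)} : (outGraph ι).Adj φ ψ ↔
    (φ : OuterAutomorphismGroup (FreeGroup ι)) ≠ ψ ∧ Compat φ ψ :=
  and_congr_right fun _ => compat_congr (mk_out _) (mk_out _)

lemma outGraph_adj_mul (z x y : OuterAutomorphismGroup (FreeGroup ι)) :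
    (outGraph ι).Adj (z * x) (z * y) ↔ (outGraph ι).Adj x y := by
  induction z using QuotientGroup.induction_on with | H χ => ?_
  induction x using QuotientGroup.induction_on with | H φ => ?_
  induction y using QuotientGroup.induction_on with | H ψ => ?_
  rw [← QuotientGroup.mk_mul, ← QuotientGroup.mk_mul, outGraph_adj, outGraph_adj,
    compat_mul_left]
  simp

variable [Fintype ι]

lemma gsec_compl_infinite (i : ι) : ((gsec i)ᶜ : Set (FreeGroup ι)).Infinite := by
  refine (sec_singleton_infinite (i, false)).mono fun g hg hg' => ?_
  rw [mem_sec_singleton] at hg hg'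
  rw [hg] at hg'
  simp at hg'

lemma Compat.exists_sector {ψ : MulAut (FreeGroup ι)} (h : Compat 1 ψ) (i : ι) :
    ∃ α, IsSector (ψ '' gsec i) α := by
  refine AlmInv.isSector ((almInv_sec _).image ψ) ?_ ?_ fun k hk => ?_
  · exact (sec_singleton_infinite _).image ψ.injective.injOn
  · rw [← Set.image_compl_eq ψ.bijective]
    exact (gsec_compl_infinite i).image ψ.injective.injOn
  · refine nested_pre_of_nested_gsec (fun j g => ?_) hk
    have := h.symm i j g
    rwa [mulAut_one_image] at this

lemma compat_iff_nestF {φ ψ χ : MulAut (FreeGroup ι)} {A B : ι → Finset (ι × Bool)}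
    (hA : ∀ i, IsSector ((χ⁻¹ * φ : MulAut (FreeGroup ι)) '' gsec i) (A i))
    (hB : ∀ i, IsSector ((χ⁻¹ * ψ : MulAut (FreeGroup ι)) '' gsec i) (B i)) :
    Compat φ ψ ↔ ∀ i j, NestF (A i) (B j) := by
  rw [← compat_mul_left χ⁻¹]
  exact forall_congr' fun i => forall_congr' fun j => (hA i).forall_nested_iff (hB j)

lemma isSector_gsec (i : ι) : IsSector (gsec i) {(i, true)} :=
  ⟨1, Or.inl (by rw [one_smul]; exact EventuallyEq.refl _ _)⟩

lemma nestF_singleton (a : ι × Bool) (γ : Finset (ι × Bool)) : NestF {a} γ := by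
  by_cases h : a ∈ γ
  · exact Or.inl (by simpa using h)
  · exact Or.inr (Or.inr (Or.inl (by simpa using h)))

lemma compat_one_of_sectors {ψ : MulAut (FreeGroup ι)}
    (h : ∀ i, ∃ α, IsSector (ψ '' gsec i) α) : Compat 1 ψ := by
  choose A hA using h
  refine (compat_iff_nestF (χ := 1) (A := fun i => {(i, true)}) (B := A) (fun i => ?_)
    fun i => ?_).2 fun i j => nestF_singleton _ _
  · rw [inv_one, one_mul, mulAut_one_image]
    exact isSector_gsec i
  · rw [inv_one, one_mul]
    exact hA i

lemma cyclen_inv_apply (φ : MulAut (FreeGroup ι)) (w : FreeGroup ι) :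
    cyclen (φ⁻¹ w) = ∑ i, len (φ '' gsec i) w :=
  Finset.sum_congr rfl fun i _ => (len_image φ (gsec i) w).symm

lemma finite_compat_one :
    {x : OuterAutomorphismGroup (FreeGroup ι) | Compat 1 (Quotient.out x)}.Finite := by
  let b : FreeGroup ι → ℕ := fun w => ∑ _i : ι, ∑ α : Finset (ι × Bool), len (sec α) w
  let M : ℕ := (∑ i : ι, b (FreeGroup.of i)) +
    ∑ i : ι, ∑ j : ι, b (FreeGroup.of i * FreeGroup.of j)
  refine (finite_cyclen_le (ι := ι) M).subset fun x hx => ⟨Quotient.out x, mk_out x, ?_⟩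
  have hb : ∀ w, cyclen ((Quotient.out x : MulAut (FreeGroup ι))⁻¹ w) ≤ b w := by
    intro w
    rw [cyclen_inv_apply]
    refine Finset.sum_le_sum fun i _ => ?_
    obtain ⟨α, hα⟩ := Compat.exists_sector hx i
    rw [hα.len_eq]
    exact Finset.single_le_sum (f := fun α => len (sec α) w) (fun _ _ => Nat.zero_le _)
      (Finset.mem_univ α)
  refine ⟨fun i => (hb _).trans ?_, fun i j => (hb _).trans ?_⟩
  · exact (Finset.single_le_sum (f := fun i => b (FreeGroup.of i)) (fun _ _ => Nat.zero_le _)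
      (Finset.mem_univ i)).trans (Nat.le_add_right _ _)
  · refine le_trans ?_ (Nat.le_add_left _ _)
    refine le_trans ?_ (Finset.single_le_sum
      (f := fun i => ∑ j, b (FreeGroup.of i * FreeGroup.of j)) (fun _ _ => Nat.zero_le _)
      (Finset.mem_univ i))
    exact Finset.single_le_sum (f := fun j => b (FreeGroup.of i * FreeGroup.of j))
      (fun _ _ => Nat.zero_le _) (Finset.mem_univ j)

/-- Cliques have bounded size. -/
lemma exists_clique_bound : ∃ d, ∀ s : Finset (OuterAutomorphismGroup (FreeGroup ι)),
    (outGraph ι).IsClique (s : Set _) → s.card ≤ d := by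
  classical
  refine ⟨(finite_compat_one (ι := ι)).toFinset.card + 1, fun s hs => ?_⟩
  rcases s.eq_empty_or_nonempty with rfl | ⟨z, hz⟩
  · simp
  rw [← Finset.card_erase_add_one hz, add_le_add_iff_right]
  refine Finset.card_le_card_of_injOn (fun x => z⁻¹ * x) (fun x hx => ?_)
    (mul_right_injective _).injOn
  rw [Finset.mem_coe, Finset.mem_erase] at hx
  have h := hs hz hx.2 hx.1.symm
  rw [← outGraph_adj_mul z⁻¹, inv_mul_cancel] at h
  rw [Finset.mem_coe, Set.Finite.mem_toFinset]
  change Compat 1 (Quotient.out (z⁻¹ * x))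
  rw [← mk_out (z⁻¹ * x), ← QuotientGroup.mk_one, outGraph_adj] at h
  exact h.2

end OutGraph

/-! ### Descending links of the graph of outer automorphisms -/

section DescendingLinks

open Filter
open scoped Pointwise

lemma exists_rank {V Λ : Type*} [LinearOrder Λ] (N : V → Λ)
    (hfin : ∀ v, {u | N u ≤ N v}.Finite) :
    ∃ r : V → ℕ, Function.Injective r ∧ ∀ u v, N u < N v → r u < r v := by
  classical
  let _ : LinearOrder V := linearOrderOfSTO WellOrderingRel
  let key : V → Λ ×ₗ V := fun v => toLex (N v, v)
  have hkey : Function.Injective key := fun u v h => congrArg (fun p => (ofLex p).2) h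
  have hlow : ∀ v, {u | key u < key v}.Finite := fun v => (hfin v).subset fun u hu => by
    rcases (Prod.Lex.lt_iff.1 hu) with h | h
    · exact h.le
    · exact h.1.le
  have hr : ∀ u v, key u < key v → {x | key x < key u}.ncard < {x | key x < key v}.ncard := by
    intro u v h
    refine Set.ncard_lt_ncard ⟨fun x hx => lt_trans hx h, fun hsub => ?_⟩ (hlow v)
    exact lt_irrefl (key u) (hsub h)
  refine ⟨fun v => {u | key u < key v}.ncard, fun u v huv => ?_, fun u v h => ?_⟩
  · by_contra hne
    rcases lt_or_gt_of_ne (hkey.ne hne) with h | h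
    · exact (hr u v h).ne huv
    · exact (hr v u h).ne huv.symm
  · exact hr u v (Prod.Lex.lt_iff.2 (Or.inl h))

variable {ι : Type*} [DecidableEq ι]

lemma IsSector.smul {V : Set (FreeGroup ι)} {α : Finset (ι × Bool)} (h : IsSector V α)
    (g : FreeGroup ι) : IsSector (g • V) α := by
  obtain ⟨k, h | h⟩ := h
  · exact ⟨g * k, Or.inl (by rw [mul_smul]; exact almostEq_smul h g)⟩
  · exact ⟨g * k, Or.inr (by
      rw [mul_smul, ← Set.smul_set_compl]; exact almostEq_smul h g)⟩

lemma IsSector.of_mk_eq {χ φ ψ : MulAut (FreeGroup ι)} {i : ι} {α : Finset (ι × Bool)}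
    (hs : IsSector ((χ * φ : MulAut (FreeGroup ι)) '' gsec i) α)
    (h : (φ : OuterAutomorphismGroup (FreeGroup ι)) = ψ) :
    IsSector ((χ * ψ : MulAut (FreeGroup ι)) '' gsec i) α := by
  obtain ⟨p, rfl⟩ := exists_mul_conj h
  rw [← mul_assoc]
  exact (hs.smul _).congr (mul_conj_image_almostEq _ p i).symm

lemma compat_self [Fintype ι] (φ : MulAut (FreeGroup ι)) : Compat φ φ := by
  have h : Compat (1 : MulAut (FreeGroup ι)) 1 := compat_one_of_sectors fun i =>
    ⟨{(i, true)}, by rw [mulAut_one_image]; exact isSector_gsec i⟩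
  rw [← compat_mul_left φ, mul_one] at h
  exact h

lemma IsSector.nestF_trans [Fintype ι] {V : Set (FreeGroup ι)} {α β γ : Finset (ι × Bool)}
    (hα : IsSector V α) (hβ : IsSector V β) (h : NestF α γ) : NestF β γ := by
  have hγ : IsSector (sec γ) γ := ⟨1, Or.inl (by rw [one_smul]; exact EventuallyEq.refl _ _)⟩
  exact (hβ.forall_nested_iff hγ).1 ((hα.forall_nested_iff hγ).2 h)

lemma exists_words (ι : Type*) [DecidableEq ι] [Fintype ι] : ∃ W : ℕ → Finset (FreeGroup ι),
    (∀ i, FreeGroup.of i ∈ W 0) ∧ (∀ i j, FreeGroup.of i * FreeGroup.of j ∈ W 0) ∧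
      ∀ w, ∃ k, W k = {w} := by
  have : Countable (FreeGroup ι) := FreeGroup.toWord_injective.countable
  obtain ⟨e, he⟩ := exists_surjective_nat (FreeGroup ι)
  refine ⟨fun k => Nat.casesOn k (Finset.univ.image FreeGroup.of ∪
    Finset.univ.image fun p : ι × ι => FreeGroup.of p.1 * FreeGroup.of p.2) fun k => {e k},
    fun i => ?_, fun i j => ?_, fun w => ?_⟩
  · exact Finset.mem_union_left _ (Finset.mem_image_of_mem _ (Finset.mem_univ _))
  · exact Finset.mem_union_right _ (Finset.mem_image.2 ⟨(i, j), Finset.mem_univ _, rfl⟩)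
  · obtain ⟨k, rfl⟩ := he w
    exact ⟨k + 1, rfl⟩

/-- The weight of a set of letters in the coordinates given by `φ`. -/
noncomputable def wtLex (W : ℕ → Finset (FreeGroup ι)) (φ : MulAut (FreeGroup ι))
    (α : Finset (ι × Bool)) : Lex (ℕ → ℤ) :=
  toLex fun k => ∑ w ∈ W k, (len (sec α) (φ⁻¹ w) : ℤ)

/-- The total translation lengths of an outer automorphism. -/
noncomputable def normLex [Fintype ι] (W : ℕ → Finset (FreeGroup ι))
    (x : OuterAutomorphismGroup (FreeGroup ι)) : Lex (ℕ → ℤ) :=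
  toLex fun k => ∑ w ∈ W k, ∑ i, (len ((Quotient.out x : MulAut (FreeGroup ι)) '' gsec i) w : ℤ)

variable [Fintype ι] {W : ℕ → Finset (FreeGroup ι)}

lemma isWeight_wtLex (φ : MulAut (FreeGroup ι)) : IsWeight linv (wtLex W φ) where
  invol := linv_linv
  compl α := by
    simp only [wtLex, len_congr (sec_compl_almostEq α), len_compl]
  submod α β := by
    change toLex _ ≤ toLex _
    refine Pi.toLex_monotone fun k => ?_
    change (∑ w ∈ W k, (len (sec (α ∩ β)) (φ⁻¹ w) : ℤ)) +
        ∑ w ∈ W k, (len (sec (α ∪ β)) (φ⁻¹ w) : ℤ) ≤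
      (∑ w ∈ W k, (len (sec α) (φ⁻¹ w) : ℤ)) + ∑ w ∈ W k, (len (sec β) (φ⁻¹ w) : ℤ)
    rw [← Finset.sum_add_distrib, ← Finset.sum_add_distrib]
    refine Finset.sum_le_sum fun w _ => ?_
    rw [sec_inter, sec_union]
    exact_mod_cast len_submodular (almInv_sec α) (almInv_sec β) _
  single a := by simp only [wtLex, len_sec_linv]

lemma normLex_eq_sum {φ : MulAut (FreeGroup ι)} {x : OuterAutomorphismGroup (FreeGroup ι)}
    {A : ι → Finset (ι × Bool)}
    (hA : ∀ i, IsSector ((φ⁻¹ * Quotient.out x : MulAut (FreeGroup ι)) '' gsec i) (A i)) :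
    normLex W x = ∑ i, wtLex W φ (A i) := by
  have h : ∀ i w, len ((Quotient.out x : MulAut (FreeGroup ι)) '' gsec i) w =
      len (sec (A i)) (φ⁻¹ w) := by
    intro i w
    rw [← (hA i).len_eq]
    have : (Quotient.out x : MulAut (FreeGroup ι)) '' gsec i =
        φ '' ((φ⁻¹ * Quotient.out x : MulAut (FreeGroup ι)) '' gsec i) := by
      rw [← mulAut_mul_image, mul_inv_cancel_left]
    rw [this]
    exact len_image φ _ w
  have h2 : ∀ s : Finset ι, ∑ i ∈ s, wtLex W φ (A i) =
      toLex fun k => ∑ i ∈ s, ∑ w ∈ W k, (len (sec (A i)) (φ⁻¹ w) : ℤ) := by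
    intro s
    induction s using Finset.induction_on with
    | empty => simp only [Finset.sum_empty]; rfl
    | insert i s hi ih =>
      simp only [Finset.sum_insert hi]
      rw [ih]
      rfl
  rw [h2, normLex]
  congr 1
  funext k
  rw [Finset.sum_comm]
  simp only [h]

lemma finite_normLex_le (hW1 : ∀ i, FreeGroup.of i ∈ W 0)
    (hW2 : ∀ i j, FreeGroup.of i * FreeGroup.of j ∈ W 0)
    (x : OuterAutomorphismGroup (FreeGroup ι)) :
    {y | normLex W y ≤ normLex W x}.Finite := by
  obtain ⟨M, hM⟩ : ∃ M : ℕ, ofLex (normLex W x) 0 = M :=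
    Int.eq_ofNat_of_zero_le (Finset.sum_nonneg fun _ _ => Finset.sum_nonneg fun _ _ =>
      Int.natCast_nonneg _)
  refine (finite_cyclen_le (ι := ι) M).subset fun y hy => ⟨Quotient.out y, mk_out y, ?_⟩
  have h0 : ofLex (normLex W y) 0 ≤ M := by
    rw [← hM]
    rcases (show normLex W y ≤ normLex W x from hy).lt_or_eq with h | h
    · obtain ⟨i, hi, hlt⟩ := h
      rcases Nat.eq_zero_or_pos i with rfl | hpos
      · exact le_of_lt hlt
      · exact (hi 0 hpos).le
    · rw [h]
  have h1 : ∀ w ∈ W 0, cyclen ((Quotient.out y : MulAut (FreeGroup ι))⁻¹ w) ≤ M := by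
    intro w hw
    rw [cyclen_inv_apply]
    have h2 : (∑ i, (len ((Quotient.out y : MulAut (FreeGroup ι)) '' gsec i) w : ℤ)) ≤
        ofLex (normLex W y) 0 :=
      Finset.single_le_sum (f := fun w =>
        ∑ i, (len ((Quotient.out y : MulAut (FreeGroup ι)) '' gsec i) w : ℤ))
        (fun _ _ => Finset.sum_nonneg fun _ _ => Int.natCast_nonneg _) hw
    exact_mod_cast h2.trans h0
  exact ⟨fun i => h1 _ (hW1 i), fun i j => h1 _ (hW2 i j)⟩

lemma nestF_of_wtLex_eq (hW : ∀ w, ∃ k, W k = {w}) {φ : MulAut (FreeGroup ι)}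
    {α : Finset (ι × Bool)} {a : ι × Bool} (ha : a ∈ α) (ha' : linv a ∉ α)
    (h : wtLex W φ α = wtLex W φ {a}) (γ : Finset (ι × Bool)) : NestF α γ := by
  have hlen : ∀ w, len (sec α) w = len (sec {a}) w := by
    intro w
    obtain ⟨k, hk⟩ := hW (φ w)
    have h1 := congrFun (congrArg ofLex h) k
    simp only [wtLex, ofLex_toLex, hk, Finset.sum_singleton, MulAut.inv_apply_self] at h1
    exact_mod_cast h1
  by_cases hb : ∃ b ∈ α, b ≠ a
  · obtain ⟨b, hb, hba⟩ := hb
    have hα : αᶜ = {linv a} := by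
      ext c
      rw [Finset.mem_compl, Finset.mem_singleton]
      refine ⟨fun hc => ?_, fun hc => hc ▸ ha'⟩
      by_contra hca
      exact len_ne_of_split hb ha' ha hba hc hca (hlen _)
    rw [← nestF_compl_left, hα]
    exact nestF_singleton _ _
  · push Not at hb
    have hα : α = {a} := Finset.eq_singleton_iff_unique_mem.2 ⟨ha, hb⟩
    rw [hα]
    exact nestF_singleton _ _

/-- The descending links are empty or acyclic. -/
lemma acyclic_descending_link [DecidableEq (OuterAutomorphismGroup (FreeGroup ι))]
    (hW1 : ∀ i, FreeGroup.of i ∈ W 0)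
    (hW2 : ∀ i j, FreeGroup.of i * FreeGroup.of j ∈ W 0) (hW : ∀ w, ∃ k, W k = {w})
    {r : OuterAutomorphismGroup (FreeGroup ι) → ℕ}
    (hr : ∀ x y, normLex W x < normLex W y → r x < r y)
    (v : OuterAutomorphismGroup (FreeGroup ι)) :
    {u | r u < r v ∧ (outGraph ι).Adj v u} = ∅ ∨
      Acyclic (outGraph ι) {u | r u < r v ∧ (outGraph ι).Adj v u} := by
  classical
  set D := {u | r u < r v ∧ (outGraph ι).Adj v u} with hD
  have hle : ∀ u ∈ D, normLex W u ≤ normLex W v := fun u hu =>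
    not_lt.1 fun h => (hr v u h).not_gt hu.1
  have hDfin : D.Finite := (finite_normLex_le hW1 hW2 v).subset hle
  set φ : MulAut (FreeGroup ι) := Quotient.out v with hφ
  have hφv : (φ : OuterAutomorphismGroup (FreeGroup ι)) = v := mk_out v
  let T : OuterAutomorphismGroup (FreeGroup ι) → ι → Set (FreeGroup ι) := fun u i =>
    (φ⁻¹ * Quotient.out u : MulAut (FreeGroup ι)) '' gsec i
  let fam : OuterAutomorphismGroup (FreeGroup ι) → Set (Finset (ι × Bool)) :=
    fun u => {α | ∃ i, IsSector (T u i) α}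
  have hv : normLex W v = ∑ i, wtLex W φ {(i, true)} := normLex_eq_sum fun i => by
    rw [← hφ, inv_mul_cancel, mulAut_one_image]
    exact isSector_gsec i
  have hsec : ∀ u ∈ D, ∃ A : ι → Finset (ι × Bool), ∀ i, IsSector (T u i) (A i) := by
    intro u hu
    have h1 : Compat φ (Quotient.out u) := hu.2.2
    rw [← compat_mul_left φ⁻¹, inv_mul_cancel] at h1
    exact ⟨_, fun i => (h1.exists_sector i).choose_spec⟩
  have hω : ∀ α : Finset (ι × Bool), ∃ u, ∀ a, RedVia linv (wtLex W φ) α a →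
      u ∈ D ∧ α ∈ fam u ∧ ∀ β ∈ fam u, ∀ γ, NestF α γ → NestF β γ := by
    intro α
    by_cases hα : ∃ a, RedVia linv (wtLex W φ) α a
    swap
    · exact ⟨v, fun a ha => absurd ⟨a, ha⟩ hα⟩
    obtain ⟨⟨k, e⟩, h1, h2, h3⟩ := hα
    have hsplit : ¬((k, true) ∈ α ↔ (k, false) ∈ α) := by
      cases e
      · change (k, true) ∉ α at h2
        tauto
      · change (k, false) ∉ α at h2
        tauto
    have h3' : wtLex W φ α < wtLex W φ {(k, true)} := by
      cases e
      · have := (isWeight_wtLex (W := W) φ).single (k, false)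
        change wtLex W φ {(k, true)} = _ at this
        rwa [this]
      · exact h3
    obtain ⟨ψ, hψk, hψ⟩ := exists_mulAut_image hsplit
    have hT : ∀ i β, IsSector (ψ '' gsec i) β → IsSector
        (T ((φ * ψ : MulAut (FreeGroup ι)) : OuterAutomorphismGroup (FreeGroup ι)) i) β := by
      intro i β hβ
      refine IsSector.of_mk_eq (φ := φ * ψ) ?_ (mk_out _).symm
      rwa [inv_mul_cancel_left]
    set u : OuterAutomorphismGroup (FreeGroup ι) := ((φ * ψ : MulAut (FreeGroup ι)) :
      OuterAutomorphismGroup (FreeGroup ι)) with hu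
    have hA : ∀ i, IsSector (T u i) (if i = k then α else {(i, true)}) := by
      intro i
      by_cases hik : i = k
      · rw [if_pos hik]
        exact hT i _ (hik ▸ hψk)
      · rw [if_neg hik]
        exact hT i _ (hψ i hik)
    have hlt : normLex W u < normLex W v := by
      rw [hv, normLex_eq_sum hA]
      refine Finset.sum_lt_sum (fun i _ => ?_) ⟨k, Finset.mem_univ _, ?_⟩
      · by_cases hik : i = k
        · rw [if_pos hik, hik]
          exact h3'.le
        · rw [if_neg hik]
      · rw [if_pos rfl]
        exact h3'
    refine ⟨u, fun a _ => ⟨⟨hr _ _ hlt, ?_⟩, ⟨k, hT k α hψk⟩, ?_⟩⟩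
    · rw [← hφv, hu, outGraph_adj]
      refine ⟨fun h => ?_, ?_⟩
      · rw [hφv, ← hu] at h
        rw [← h] at hlt
        exact lt_irrefl _ hlt
      · have := (compat_mul_left φ 1 ψ).2 (compat_one_of_sectors fun i => ?_)
        · rwa [mul_one] at this
        · by_cases hik : i = k
          · exact ⟨α, hik ▸ hψk⟩
          · exact ⟨_, hψ i hik⟩
    · rintro β ⟨i, hβ⟩ γ hγ
      refine (hA i).nestF_trans hβ ?_
      by_cases hik : i = k
      · rwa [if_pos hik]
      · rw [if_neg hik]
        exact nestF_singleton _ _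
  choose ω hω using hω
  have key := acyclic_of_reductive_families (isWeight_wtLex (W := W) φ) (G := outGraph ι)
    hDfin.toFinset fam ω ?_ ?_ ?_ ?_
  · rw [hDfin.coe_toFinset] at key
    simpa using key
  · intro u hu v' hv' hne
    rw [hDfin.mem_toFinset] at hu hv'
    have h1 : (outGraph ι).Adj u v' ↔ Compat (φ⁻¹ * Quotient.out u) (φ⁻¹ * Quotient.out v') := by
      rw [compat_mul_left]
      exact and_iff_right hne
    rw [h1]
    constructor
    · rintro h α ⟨i, hα⟩ β ⟨j, hβ⟩
      exact (hα.forall_nested_iff hβ).1 (h i j)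
    · intro h i j
      obtain ⟨A, hA⟩ := hsec u hu
      obtain ⟨B, hB⟩ := hsec v' hv'
      exact ((hA i).forall_nested_iff (hB j)).2 (h _ ⟨i, hA i⟩ _ ⟨j, hB j⟩)
  · rintro u - α ⟨i, hα⟩ β ⟨j, hβ⟩
    exact (hα.forall_nested_iff hβ).1 (compat_self _ i j)
  · intro α a ha
    rw [hDfin.mem_toFinset]
    exact hω α a ha
  · intro u hu
    rw [hDfin.mem_toFinset] at hu
    obtain ⟨A, hA⟩ := hsec u hu
    obtain ⟨π, hπ⟩ := exists_perm_split _ A hA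
    have hsingle : ∀ i, wtLex W φ {(i, false)} = wtLex W φ {(i, true)} := fun i =>
      (isWeight_wtLex (W := W) φ).single (i, true)
    have hsplit : ∀ i, ∃ a, a ∈ A i ∧ linv a ∉ A i ∧
        wtLex W φ {a} = wtLex W φ {(π i, true)} := by
      intro i
      by_cases h : (π i, true) ∈ A i
      · exact ⟨(π i, true), h, fun h' => hπ i (iff_of_true h h'), rfl⟩
      · refine ⟨(π i, false), ?_, h, hsingle _⟩
        by_contra h'
        exact hπ i (iff_of_false h h')
    by_cases hred : ∃ i, wtLex W φ (A i) < wtLex W φ {(π i, true)}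
    · obtain ⟨i, hi⟩ := hred
      obtain ⟨a, h1, h2, h3⟩ := hsplit i
      exact Or.inl ⟨A i, ⟨i, hA i⟩, a, h1, h2, h3 ▸ hi⟩
    · right
      have hred : ∀ i, wtLex W φ {(π i, true)} ≤ wtLex W φ (A i) :=
        fun i => not_lt.1 fun h => hred ⟨i, h⟩
      have hsum : ∑ i, wtLex W φ {(π i, true)} = ∑ i, wtLex W φ {(i, true)} :=
        Equiv.sum_comp π fun i => wtLex W φ {(i, true)}
      have heq : ∑ i, wtLex W φ {(π i, true)} = ∑ i, wtLex W φ (A i) := by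
        refine le_antisymm (Finset.sum_le_sum fun i _ => hred i) ?_
        rw [hsum, ← hv, ← normLex_eq_sum hA]
        exact hle u hu
      rw [Finset.sum_eq_sum_iff_of_le fun i _ => hred i] at heq
      rintro β ⟨i, hβ⟩ γ
      obtain ⟨a, h1, h2, h3⟩ := hsplit i
      exact (hA i).nestF_trans hβ (nestF_of_wtLex_eq hW h1 h2
        ((heq i (Finset.mem_univ i)).symm.trans h3.symm) γ)

end DescendingLinks

/-! ### Connectivity of the graph of outer automorphisms -/

section Connectivity

open Filter
open scoped Pointwise

variable {ι : Type*} [DecidableEq ι]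

/-- The translates of `U` that cross `V`. -/
def crossings (U V : Set (FreeGroup ι)) : Set (FreeGroup ι) := {g | ¬ Nested (g • U) V}

lemma IsSector.ncard_crossings {U : Set (FreeGroup ι)} {α : Finset (ι × Bool)}
    (h : IsSector U α) (V : Set (FreeGroup ι)) :
    (crossings U V).ncard = (crossings (sec α) V).ncard := by
  obtain ⟨k, hk⟩ : ∃ k, ∀ g : FreeGroup ι,
      Nested (g • U) V ↔ Nested ((g * k) • sec α) V := by
    obtain ⟨k, h | h⟩ := h
    · refine ⟨k, fun g => ?_⟩
      rw [mul_smul]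
      exact nested_congr (almostEq_smul h g) (EventuallyEq.refl _ _)
    · refine ⟨k, fun g => ?_⟩
      rw [mul_smul, ← nested_compl_left, ← Set.smul_set_compl]
      exact nested_congr (almostEq_smul h g) (EventuallyEq.refl _ _)
  rw [← preimage_mul_right_ncard (crossings (sec α) V) k]
  congr 1
  ext g
  exact not_congr (hk g)

lemma AlmInv.exists_nested_pre [Fintype ι] {V : Set (FreeGroup ι)} (hV : AlmInv V) :
    ∃ R, ∀ h : FreeGroup ι, R < h.norm → Nested (pre h) V := by
  obtain ⟨R, hR⟩ := hV.exists_bound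
  refine ⟨R, fun h hh => ?_⟩
  rcases hR h hh with h1 | h1
  · exact Or.inl (Eventually.of_forall h1)
  · exact Or.inr (Or.inr (Or.inl (Eventually.of_forall h1)))

lemma crossings_finite [Fintype ι] (a : ι × Bool) {V : Set (FreeGroup ι)} (hV : AlmInv V) :
    (crossings (sec {a}) V).Finite := by
  obtain ⟨R, hR⟩ := hV.exists_nested_pre
  refine (finite_norm_le (ι := ι) R).subset fun g hg => ?_
  by_contra hlt
  replace hlt : R < g.norm := not_le.1 hlt
  apply hg
  by_cases hl : lst g = some (linv a)
  · obtain ⟨k, hk, -, hk'⟩ := exists_of_lst hl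
    have h1 : g • sec {a} = (pre g)ᶜ := by
      have h2 := ltr_smul_sec (linv a)
      rw [linv_linv] at h2
      rw [hk, mul_smul, h2, Set.smul_set_compl, smul_sec_singleton hk']
    rw [h1]
    exact (hR g hlt).compl_left
  · rw [smul_sec_singleton hl]
    refine hR _ (hlt.trans ?_)
    rw [norm_eq_length, norm_eq_length, norm_mul_ltr hl]
    simp

lemma smul_sec_singleton_of_lst {h : FreeGroup ι} {c : ι × Bool} (hl : lst h = some c) :
    (h⁻¹ • pre h : Set (FreeGroup ι)) = (sec {linv c})ᶜ := by
  obtain ⟨k, hk, -, hk'⟩ := exists_of_lst hl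
  have h2 := ltr_smul_sec (linv c)
  rw [linv_linv] at h2
  rw [← h2, ltr_linv, inv_smul_eq_iff]
  conv_lhs => rw [hk]
  rw [← smul_sec_singleton hk', hk, mul_smul, smul_inv_smul]

variable [Fintype ι]

/-- A set crossing the sector of `a` but no other sector agrees with a sector outside it. -/
lemma exists_sec_almostEq_sdiff {V : Set (FreeGroup ι)} {a : ι × Bool}
    (hc : ¬ Nested V (sec {a})) (hn : ∀ b, b ≠ a → Nested V (sec {b})) :
    ∃ (α : Finset (ι × Bool)) (V' : Set (FreeGroup ι)), (V' = V ∨ V' = Vᶜ) ∧ a ∉ α ∧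
      linv a ∈ α ∧ sec α =ᶠ[cofinite] (V' ∩ (sec {a})ᶜ : Set (FreeGroup ι)) := by
  classical
  -- the sectors other than that of `a` lie on one side
  have hside : ∀ U : Set (FreeGroup ι), ¬ Nested U (sec {a}) → ∀ b, b ≠ a → Nested U (sec {b}) →
      (∀ᶠ x in cofinite, x ∈ sec {b} → x ∈ U) ∨ ∀ᶠ x in cofinite, x ∈ sec {b} → x ∉ U := by
    intro U hU b hb h
    have hdisj : ∀ x, x ∈ sec {b} → x ∉ sec {a} := by
      intro x h1 h2
      rw [mem_sec_singleton] at h1 h2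
      rw [h1, Option.some_inj] at h2
      exact hb h2
    rcases h with h | h | h | h
    · exact absurd (Or.inr (Or.inr (Or.inl (h.mono fun x hx hxU => hdisj x (hx hxU))))) hU
    · exact Or.inl h
    · exact Or.inr (h.mono fun x hx hb hU => hx hU hb)
    · refine absurd (Or.inr (Or.inl (h.mono fun x hx hxa => ?_))) hU
      by_contra hxU
      exact hdisj x (hx hxU) hxa
  obtain ⟨V', hV', hc', hn', hla⟩ : ∃ V' : Set (FreeGroup ι), (V' = V ∨ V' = Vᶜ) ∧
      ¬ Nested V' (sec {a}) ∧ (∀ b, b ≠ a → Nested V' (sec {b})) ∧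
      ∀ᶠ x in cofinite, x ∈ sec {linv a} → x ∈ V' := by
    rcases hside V hc (linv a) (linv_ne a) (hn _ (linv_ne a)) with h | h
    · exact ⟨V, Or.inl rfl, hc, hn, h⟩
    · exact ⟨Vᶜ, Or.inr rfl, fun h' => hc (nested_compl_left.1 h'),
        fun b hb => (hn b hb).compl_left, h⟩
  set α : Finset (ι × Bool) :=
    Finset.univ.filter fun b => b ≠ a ∧ ∀ᶠ x in cofinite, x ∈ sec {b} → x ∈ V' with hα
  have memα : ∀ b, b ∈ α ↔ b ≠ a ∧ ∀ᶠ x in cofinite, x ∈ sec {b} → x ∈ V' := by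
    intro b
    simp [hα]
  refine ⟨α, V', hV', fun h => ((memα a).1 h).1 rfl, (memα _).2 ⟨linv_ne a, hla⟩, ?_⟩
  have hall : ∀ᶠ x : FreeGroup ι in cofinite, ∀ b, b ≠ a → x ∈ sec {b} → (x ∈ V' ↔ b ∈ α) := by
    rw [eventually_all]
    intro b
    by_cases hb : b = a
    · exact Eventually.of_forall fun x h => absurd hb h
    by_cases hbα : b ∈ α
    · exact ((memα b).1 hbα).2.mono fun x hx _ hxb => iff_of_true (hx hxb) hbα
    · rcases hside V' hc' b hb (hn' b hb) with h | h
      · exact absurd ((memα b).2 ⟨hb, h⟩) hbα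
      · exact h.mono fun x hx _ hxb => iff_of_false (hx hxb) hbα
  have h1 : ∀ᶠ x : FreeGroup ι in cofinite, x ≠ 1 :=
    (Set.finite_singleton (1 : FreeGroup ι)).compl_mem_cofinite
  filter_upwards [hall, h1] with x hx hx1
  obtain ⟨b, hb⟩ := Option.ne_none_iff_exists'.1 (mt hd_eq_none.1 hx1)
  apply propext
  change x ∈ sec α ↔ x ∈ V' ∧ x ∉ sec {a}
  rw [mem_sec_iff hb, mem_sec_iff hb, Finset.mem_singleton]
  by_cases hba : b = a
  · rw [hba]
    have : a ∉ α := fun h => ((memα a).1 h).1 rfl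
    tauto
  · rw [hx b hba (mem_sec_singleton.2 hb)]
    tauto

/-- The crossing number of `ψ` with the standard cuts. -/
noncomputable def crossingNumber (ψ : MulAut (FreeGroup ι)) : ℕ :=
  ∑ j, ∑ i, (crossings (gsec i) (ψ '' gsec j)).ncard

lemma crossingNumber_inv_mul (χ ψ : MulAut (FreeGroup ι)) :
    crossingNumber (χ⁻¹ * ψ) = ∑ j, ∑ i, (crossings (χ '' gsec i) (ψ '' gsec j)).ncard := by
  refine Finset.sum_congr rfl fun j _ => Finset.sum_congr rfl fun i _ => ?_
  have h : crossings (χ '' gsec i) (ψ '' gsec j) =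
      χ '' crossings (gsec i) ((χ⁻¹ * ψ : MulAut (FreeGroup ι)) '' gsec j) := by
    ext g
    obtain ⟨g, rfl⟩ := χ.surjective g
    rw [χ.injective.mem_set_image]
    refine not_congr ?_
    have : ψ '' gsec j = χ '' ((χ⁻¹ * ψ : MulAut (FreeGroup ι)) '' gsec j) := by
      rw [← mulAut_mul_image, mul_inv_cancel_left]
    rw [this, ← mulAut_image_smul]
    exact nested_image_iff χ.toEquiv
  rw [h, Set.ncard_image_of_injective _ χ.injective]

lemma isSector_gsec_fst (a : ι × Bool) : IsSector (gsec a.1) {a} := by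
  obtain ⟨k, e⟩ := a
  cases e
  · refine ⟨ltr (k, true), Or.inr ?_⟩
    have h := ltr_smul_sec (k, true)
    rw [show linv (k, true) = (k, false) from rfl] at h
    rw [h]
    exact EventuallyEq.refl _ _
  · exact isSector_gsec k

lemma exists_smaller_crossingNumber {ψ : MulAut (FreeGroup ι)} (hψ : ¬ Compat 1 ψ) :
    ∃ χ, Compat 1 χ ∧ crossingNumber (χ⁻¹ * ψ) < crossingNumber ψ := by
  have hai : ∀ j, AlmInv (ψ '' gsec j) := fun j => (almInv_sec _).image ψ
  set S : Set (ι × FreeGroup ι) := {p | p.2 ≠ 1 ∧ ¬ Nested (ψ '' gsec p.1) (pre p.2)} with hS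
  have hSne : S.Nonempty := by
    by_contra hSe
    apply hψ
    refine compat_one_of_sectors fun i => AlmInv.isSector (hai i) ?_ ?_ fun k hk => ?_
    · exact (sec_singleton_infinite _).image ψ.injective.injOn
    · rw [← Set.image_compl_eq ψ.bijective]
      exact (gsec_compl_infinite i).image ψ.injective.injOn
    · by_contra h
      exact hSe ⟨(i, k), hk, h⟩
  have hSfin : S.Finite := by
    choose R hR using fun j => (hai j).exists_nested_pre
    refine ((Set.finite_univ (α := ι)).prod (finite_norm_le (ι := ι) (∑ j, R j))).subset
      fun p hp => ⟨Set.mem_univ _, ?_⟩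
    by_contra hlt
    replace hlt : ∑ j, R j < p.2.norm := not_le.1 hlt
    refine hp.2 (hR p.1 p.2 (lt_of_le_of_lt ?_ hlt)).symm
    exact Finset.single_le_sum (fun _ _ => Nat.zero_le _) (Finset.mem_univ _)
  obtain ⟨⟨j₀, h⟩, ⟨hh1, hcr⟩, hmax⟩ :=
    Set.exists_max_image S (fun p => p.2.norm) hSfin hSne
  dsimp only at hh1 hcr hmax
  obtain ⟨c, hc⟩ := Option.ne_none_iff_exists'.1 (mt lst_eq_none.1 hh1)
  set V : Set (FreeGroup ι) := h⁻¹ • (ψ '' gsec j₀ : Set (FreeGroup ι)) with hV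
  have hVa : ¬ Nested V (sec {linv c}) := by
    intro hn
    apply hcr
    rw [← nested_smul_iff h⁻¹, smul_sec_singleton_of_lst hc]
    exact nested_compl_right.2 hn
  have hVb : ∀ b, b ≠ linv c → Nested V (sec {b}) := by
    intro b hb
    by_contra hn
    have hl : lst h ≠ some (linv b) := by
      rw [hc]
      intro h'
      rw [Option.some_inj] at h'
      exact hb (by rw [h', linv_linv])
    have hlen : (h * ltr b).norm = h.norm + 1 := by
      rw [norm_eq_length, norm_eq_length, norm_mul_ltr hl]
      simp
    have := hmax (j₀, h * ltr b) ⟨fun h0 => ?_, fun hn' => hn ?_⟩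
    · dsimp only at this
      omega
    · rw [show h * ltr b = 1 from h0] at hlen
      simp at hlen
    · dsimp only at hn'
      rw [← smul_sec_singleton hl, ← nested_smul_iff h⁻¹, inv_smul_smul] at hn'
      exact hn'
  set a := linv c with ha
  obtain ⟨α, V', hV', haα, hlaα, hαV⟩ := exists_sec_almostEq_sdiff hVa hVb
  have hV'n : ∀ B, Nested B V → Nested B V' := by
    intro B hB
    rcases hV' with rfl | rfl
    · exact hB
    · exact nested_compl_right.2 hB
  have hV'c : ¬ Nested V' (sec {a})ᶜ := by
    rw [nested_compl_right]
    rcases hV' with rfl | rfl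
    · exact hVa
    · rwa [nested_compl_left]
  have hsub : ∀ j (g : FreeGroup ι), Nested (g • sec {a}) (ψ '' gsec j) →
      Nested (g • sec α) (ψ '' gsec j) := by
    intro j g hg
    rw [nested_smul_left_iff] at hg ⊢
    have h1 : Nested (g⁻¹ • (ψ '' gsec j : Set (FreeGroup ι))) V := by
      rw [nested_smul_left_iff, inv_inv, hV, ← mul_smul]
      exact compat_self ψ j j₀ _
    have h2 := Nested.inter_of_cross (hV'n _ h1) (nested_compl_right.2 hg.symm) hV'c
    exact ((nested_congr (EventuallyEq.refl _ _) hαV).2 h2).symm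
  have hsplit : ¬((a.1, true) ∈ α ↔ (a.1, false) ∈ α) := by
    revert haα hlaα
    obtain ⟨k, e⟩ := a
    cases e
    · intro h1 h2
      exact fun h3 => h1 (h3.1 h2)
    · intro h1 h2
      exact fun h3 => h1 (h3.2 h2)
  obtain ⟨χ, hχk, hχ⟩ := exists_mulAut_image hsplit
  refine ⟨χ, compat_one_of_sectors fun i => ?_, ?_⟩
  · by_cases hi : i = a.1
    · exact ⟨α, hi ▸ hχk⟩
    · exact ⟨_, hχ i hi⟩
  have hle : ∀ j, crossings (sec α) (ψ '' gsec j) ⊆ crossings (sec {a}) (ψ '' gsec j) :=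
    fun j g hg hn => hg (hsub j g hn)
  have hfin : ∀ j, (crossings (sec {a}) (ψ '' gsec j)).Finite := fun j =>
    crossings_finite a (hai j)
  have hterm : ∀ j i, (crossings (χ '' gsec i) (ψ '' gsec j)).ncard ≤
      (crossings (gsec i) (ψ '' gsec j)).ncard := by
    intro j i
    by_cases hi : i = a.1
    · rw [hi, hχk.ncard_crossings, (isSector_gsec_fst a).ncard_crossings]
      exact Set.ncard_le_ncard (hle j) (hfin j)
    · rw [(hχ i hi).ncard_crossings]
  rw [crossingNumber_inv_mul]
  refine Finset.sum_lt_sum (fun j _ => Finset.sum_le_sum fun i _ => hterm j i)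
    ⟨j₀, Finset.mem_univ _, Finset.sum_lt_sum (fun i _ => hterm j₀ i) ⟨a.1, Finset.mem_univ _, ?_⟩⟩
  rw [hχk.ncard_crossings, (isSector_gsec_fst a).ncard_crossings]
  refine Set.ncard_lt_ncard ⟨hle j₀, fun hss => ?_⟩ (hfin j₀)
  have h1 : h ∈ crossings (sec {a}) (ψ '' gsec j₀) := by
    intro hn
    rw [nested_smul_left_iff] at hn
    exact hVa hn.symm
  apply hss h1
  rw [nested_smul_left_iff]
  refine (nested_congr hαV (EventuallyEq.refl _ _)).2 ?_
  change Nested (V' ∩ (sec {a})ᶜ) V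
  rcases hV' with h' | h' <;> rw [h']
  · exact Or.inl (Eventually.of_forall fun x hx => hx.1)
  · exact Or.inr (Or.inr (Or.inl (Eventually.of_forall fun x hx => hx.1)))

lemma reachable_one (ψ : MulAut (FreeGroup ι)) :
    (outGraph ι).Reachable 1 (ψ : OuterAutomorphismGroup (FreeGroup ι)) := by
  induction hn : crossingNumber ψ using Nat.strong_induction_on generalizing ψ with
  | _ n ih =>
  have hone : ∀ χ : MulAut (FreeGroup ι), Compat 1 χ →
      (outGraph ι).Reachable 1 (χ : OuterAutomorphismGroup (FreeGroup ι)) := by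
    intro χ hχ
    by_cases h : (1 : OuterAutomorphismGroup (FreeGroup ι)) = χ
    · rw [← h]
    · exact SimpleGraph.Adj.reachable (outGraph_adj.2 ⟨h, hχ⟩)
  by_cases hc : Compat 1 ψ
  · exact hone ψ hc
  obtain ⟨χ, hχ, hlt⟩ := exists_smaller_crossingNumber hc
  have h1 := ih _ (hn ▸ hlt) _ rfl
  let f : outGraph ι →g outGraph ι :=
    ⟨fun x => (χ : OuterAutomorphismGroup (FreeGroup ι)) * x, fun h =>
      (outGraph_adj_mul _ _ _).2 h⟩
  have h2 := h1.map f
  refine (hone χ hχ).trans ?_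
  have h3 : f 1 = (χ : OuterAutomorphismGroup (FreeGroup ι)) := mul_one _
  have h4 : f ((χ⁻¹ * ψ : MulAut (FreeGroup ι)) : OuterAutomorphismGroup (FreeGroup ι)) = ψ := by
    change (χ : OuterAutomorphismGroup (FreeGroup ι)) * _ = _
    rw [← QuotientGroup.mk_mul, mul_inv_cancel_left]
  rwa [h3, h4] at h2

end Connectivity

/-! ### A bound for the rank of abelian subgroups -/

section RankBound

variable {V : Type*} [DecidableEq V] {G : SimpleGraph V}

lemma exists_bd_eq_of_reachable {u v : V} (h : G.Reachable u v) :
    ∃ b ∈ chainsOn (CliqueCard G 2), bd b = Finsupp.single {u} 1 - Finsupp.single {v} 1 := by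
  obtain ⟨p⟩ := h
  induction p with
  | nil => exact ⟨0, Submodule.zero_mem _, by simp⟩
  | @cons u v w huv p ih =>
    obtain ⟨b, hb, hbd⟩ := ih
    refine ⟨Finsupp.single {u, v} 1 + b,
      Submodule.add_mem _ (single_mem_chainsOn ⟨?_, Finset.card_pair huv.ne⟩) hb, ?_⟩
    · intro x hx y hy hxy
      simp only [Finset.coe_insert, Finset.coe_singleton, Set.mem_insert_iff,
        Set.mem_singleton_iff] at hx hy
      rcases hx with rfl | rfl <;> rcases hy with rfl | rfl
      · exact absurd rfl hxy
      · exact huv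
      · exact huv.symm
      · exact absurd rfl hxy
    · have h1 : ({u, v} : Finset V).erase u = {v} := by
        ext x; have := huv.ne; simp; grind
      have h2 : ({u, v} : Finset V).erase v = {u} := by
        ext x; have := huv.ne; simp; grind
      rw [map_add, hbd, bd_single, Finset.sum_pair huv.ne, h1, h2, chain_sub_eq_add,
        chain_sub_eq_add]
      have h3 := chain_add_self (Finsupp.single ({v} : Finset V) (1 : ZMod 2))
      calc _ = (Finsupp.single {v} 1 + Finsupp.single {v} 1 : Chain V)
            + (Finsupp.single {u} 1 + Finsupp.single {w} 1) := by abel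
        _ = _ := by rw [h3, zero_add]

variable {ι : Type*} [DecidableEq ι] [Fintype ι]

lemma outGraph_reachable (x y : OuterAutomorphismGroup (FreeGroup ι)) :
    (outGraph ι).Reachable x y := by
  have h1 := reachable_one (Quotient.out (x⁻¹ * y))
  rw [mk_out] at h1
  let f : outGraph ι →g outGraph ι :=
    ⟨fun z => x * z, fun h => (outGraph_adj_mul _ _ _).2 h⟩
  have h2 := h1.map f
  have h3 : f 1 = x := mul_one _
  have h4 : f (x⁻¹ * y) = y := mul_inv_cancel_left _ _
  rwa [h3, h4] at h2

/-- The rank of torsion-free abelian subgroups of the outer automorphism group is bounded. -/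
theorem exists_rank_bound (ι : Type*) [DecidableEq ι] [Fintype ι] :
    ∃ d : ℕ, ∀ A : Subgroup (OuterAutomorphismGroup (FreeGroup ι)),
      (∀ x ∈ A, ∀ y ∈ A, x * y = y * x) →
      (∀ g ∈ A, ∀ k : ℕ, 0 < k → g ^ k = 1 → g = 1) →
      ∀ t : ℕ → OuterAutomorphismGroup (FreeGroup ι), (∀ j, t j ∈ A) → ∀ m : ℕ,
      (∀ j < m, ∀ k : ℕ, 0 < k → t j ^ k ∉ Subgroup.closure (t '' Set.Iio j)) → m ≤ d := by
  classical
  obtain ⟨d, hd⟩ := exists_clique_bound (ι := ι)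
  refine ⟨d, fun A hcomm htf t htA m ht => ?_⟩
  let _ : CommGroup A := { (inferInstance : Group A) with
    mul_comm := fun x y => Subtype.ext (hcomm x x.2 y y.2) }
  obtain ⟨W, hW1, hW2, hW⟩ := exists_words ι
  obtain ⟨r, hr, hr'⟩ := exists_rank (normLex W) fun v => finite_normLex_le hW1 hW2 v
  obtain ⟨s, hs⟩ := exists_clique_of_independent (Γ := A)
    (V := OuterAutomorphismGroup (FreeGroup ι)) (G := outGraph ι)
    (fun g u v => outGraph_adj_mul _ _ _)
    (fun g k hk h => Subtype.ext (htf g g.2 k hk (by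
      have := congrArg (Subtype.val) h
      exact this)))
    (fun g v h => Subtype.ext (mul_eq_right.1 h))
    (fun u v => exists_bd_eq_of_reachable (outGraph_reachable u v))
    (fun k hk c hc hbd => exists_bd_eq_of_descending r hr
      (fun v => acyclic_descending_link hW1 hW2 hW hr' v) hk hc hbd)
    (fun j => ⟨t j, htA j⟩) m (fun j hj k hk hmem => ht j hj k hk (by
      have h1 : A.subtype ((⟨t j, htA j⟩ : A) ^ k) ∈
          (Subgroup.closure ((fun j => (⟨t j, htA j⟩ : A)) '' Set.Iio j)).map A.subtype :=
        Subgroup.mem_map_of_mem _ hmem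
      rw [MonoidHom.map_closure, Set.image_image] at h1
      exact h1))
  have := hd s hs.1
  have := hs.2
  omega

end RankBound

/-! ### Polynomial functions on groups -/

section PolynomialFunctions

variable {G : Type*} [Group G]

/-- The difference operator in the direction `h`. -/
def fdiff (h : G) : (G → ℤ) →ₗ[ℤ] (G → ℤ) where
  toFun f g := f (g * h) - f g
  map_add' f f' := by ext g; simp; ring
  map_smul' c f := by ext g; simp; ring

lemma fdiff_apply (h : G) (f : G → ℤ) (g : G) : fdiff h f g = f (g * h) - f g := rfl

/-- The functions of degree less than `k` on a group. -/
def polyFun (G : Type*) [Group G] : ℕ → Submodule ℤ (G → ℤ)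
  | 0 => ⊥
  | k + 1 => ⨅ h : G, (polyFun G k).comap (fdiff h)

lemma mem_polyFun_zero {f : G → ℤ} : f ∈ polyFun G 0 ↔ f = 0 := Iff.rfl

lemma mem_polyFun_succ {k : ℕ} {f : G → ℤ} :
    f ∈ polyFun G (k + 1) ↔ ∀ h, fdiff h f ∈ polyFun G k := by
  simp [polyFun, Submodule.mem_iInf]

lemma polyFun_le_succ (k : ℕ) : polyFun G k ≤ polyFun G (k + 1) := by
  induction k with
  | zero => exact bot_le
  | succ k ih =>
    intro f hf
    rw [mem_polyFun_succ] at hf ⊢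
    exact fun h => ih (hf h)

lemma polyFun_mono : Monotone (polyFun G) := monotone_nat_of_le_succ polyFun_le_succ

lemma comp_mem_polyFun (φ : G →* G) {k : ℕ} {f : G → ℤ} (hf : f ∈ polyFun G k) :
    f ∘ φ ∈ polyFun G k := by
  induction k generalizing f with
  | zero =>
    rw [mem_polyFun_zero] at hf ⊢
    subst hf
    rfl
  | succ k ih =>
    rw [mem_polyFun_succ] at hf ⊢
    intro h
    have : fdiff h (f ∘ φ) = fdiff (φ h) f ∘ φ := by
      ext g
      simp [fdiff_apply]
    rw [this]
    exact ih (hf _)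

lemma translate_mem_polyFun (h : G) {k : ℕ} {f : G → ℤ} (hf : f ∈ polyFun G k) :
    (fun g => f (g * h)) ∈ polyFun G k := by
  have h1 : fdiff h f ∈ polyFun G k := by
    cases k with
    | zero =>
      rw [mem_polyFun_zero] at hf ⊢
      rw [hf, map_zero]
    | succ k => exact polyFun_le_succ k (mem_polyFun_succ.1 hf h)
  have : (fun g => f (g * h)) = fdiff h f + f := by
    ext g
    simp [fdiff_apply]
  rw [this]
  exact Submodule.add_mem _ h1 hf

lemma fdiff_mul (h h' : G) (f : G → ℤ) :
    fdiff (h * h') f = fdiff h (fdiff h' f) + fdiff h' f + fdiff h f := by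
  ext g
  simp [fdiff_apply, mul_assoc]

lemma fdiff_mem_polyFun_of_commutator {k : ℕ} {f : G → ℤ} (hf : f ∈ polyFun G (k + 2)) {c : G}
    (hc : c ∈ commutator G) : fdiff c f ∈ polyFun G k := by
  have hf2 : ∀ h h', fdiff h (fdiff h' f) ∈ polyFun G k := fun h h' =>
    mem_polyFun_succ.1 (mem_polyFun_succ.1 hf h') h
  let M := (G → ℤ) ⧸ polyFun G k
  let θ : G →* Multiplicative M :=
    { toFun := fun h => Multiplicative.ofAdd (Submodule.Quotient.mk (fdiff h f))
      map_one' := by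
        have : fdiff (1 : G) f = 0 := by
          ext g
          simp [fdiff_apply]
        rw [this]
        rfl
      map_mul' := fun h h' => by
        rw [← ofAdd_add, ← Submodule.Quotient.mk_add, fdiff_mul]
        congr 1
        rw [Submodule.Quotient.eq]
        have := hf2 h h'
        convert this using 1
        abel }
  have h1 : c ∈ θ.ker := Abelianization.commutator_subset_ker θ hc
  have h2 : (Submodule.Quotient.mk (fdiff c f) : M) = 0 := h1
  exact (Submodule.Quotient.mk_eq_zero _).1 h2

/-- Endomorphisms acting trivially on the abelianization act unipotently on polynomial
functions. -/
lemma comp_sub_mem_polyFun (φ : G →* G) (hφ : ∀ g, g⁻¹ * φ g ∈ commutator G) {k : ℕ} {f : G → ℤ}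
    (hf : f ∈ polyFun G (k + 1)) : f ∘ φ - f ∈ polyFun G k := by
  induction k generalizing f with
  | zero =>
    rw [mem_polyFun_zero]
    ext g
    have h := mem_polyFun_zero.1 (mem_polyFun_succ.1 hf (g⁻¹ * φ g))
    have h1 := congrFun h g
    simpa [fdiff_apply] using h1
  | succ k ih =>
    rw [mem_polyFun_succ]
    intro h
    have h1 : fdiff h (f ∘ φ - f) = (fdiff (φ h) f ∘ φ - fdiff (φ h) f) +
        fun g => fdiff (h⁻¹ * φ h) f (g * h) := by
      ext g
      simp [fdiff_apply, mul_assoc]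
      ring
    rw [h1]
    exact Submodule.add_mem _ (ih (mem_polyFun_succ.1 hf _))
      (translate_mem_polyFun h (fdiff_mem_polyFun_of_commutator hf (hφ h)))

lemma coe_hom_mem_polyFun (σ : G →* Multiplicative ℤ) :
    (fun g => Multiplicative.toAdd (σ g)) ∈ polyFun G 2 := by
  rw [mem_polyFun_succ]
  intro h
  rw [mem_polyFun_succ]
  intro h'
  rw [mem_polyFun_zero]
  ext g
  simp [fdiff_apply]

variable {ι : Type*}

lemma eq_const_of_fdiff_of {f : FreeGroup ι → ℤ} (hf : ∀ i, fdiff (FreeGroup.of i) f = 0)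
    (w : FreeGroup ι) : f w = f 1 := by
  have key : ∀ w g : FreeGroup ι, f (g * w) = f g := by
    intro w
    induction w using FreeGroup.induction_on with
    | C1 => intro g; rw [mul_one]
    | of i =>
      intro g
      have := congrFun (hf i) g
      rw [fdiff_apply] at this
      simpa [sub_eq_zero] using this
    | inv_of i ih =>
      intro g
      have := ih (g * (FreeGroup.of i)⁻¹)
      rw [inv_mul_cancel_right] at this
      exact this.symm
    | mul x y hx hy =>
      intro g
      rw [← mul_assoc, hy, hx]
  simpa using key w 1

instance instFinitePolyFun [Finite ι] (k : ℕ) : Module.Finite ℤ (polyFun (FreeGroup ι) k) := by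
  induction k with
  | zero => exact inferInstanceAs (Module.Finite ℤ (⊥ : Submodule ℤ (FreeGroup ι → ℤ)))
  | succ k ih =>
    let T : polyFun (FreeGroup ι) (k + 1) →ₗ[ℤ] (ι → polyFun (FreeGroup ι) k) × ℤ :=
      LinearMap.prod
        (LinearMap.pi fun i => LinearMap.codRestrict _
          ((fdiff (FreeGroup.of i)).comp (Submodule.subtype _))
          fun f => mem_polyFun_succ.1 f.2 _)
        ((LinearMap.proj (1 : FreeGroup ι)).comp (Submodule.subtype _))
    have hT : Function.Injective T := by
      rw [← LinearMap.ker_eq_bot, LinearMap.ker_eq_bot']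
      intro f hf
      have h1 : ∀ i, fdiff (FreeGroup.of i) f.1 = 0 := fun i =>
        congrArg Subtype.val (congrFun (congrArg Prod.fst hf) i)
      have h2 : f.1 1 = 0 := congrArg Prod.snd hf
      ext w
      exact (eq_const_of_fdiff_of h1 w).trans h2
    have := isNoetherian_of_injective T hT
    infer_instance

/-- The class functions of degree less than `k`. -/
def classFun (G : Type*) [Group G] (k : ℕ) : Submodule ℤ (G → ℤ) where
  carrier := {f | f ∈ polyFun G k ∧ ∀ p g, f (p * g * p⁻¹) = f g}
  add_mem' := fun ha hb => ⟨Submodule.add_mem _ ha.1 hb.1, fun p g => by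
    rw [Pi.add_apply, Pi.add_apply, ha.2, hb.2]⟩
  zero_mem' := ⟨Submodule.zero_mem _, fun _ _ => rfl⟩
  smul_mem' := fun c f hf => ⟨Submodule.smul_mem _ c hf.1, fun p g => by
    rw [Pi.smul_apply, Pi.smul_apply, hf.2]⟩

instance instFiniteClassFun [Finite ι] (k : ℕ) :
    Module.Finite ℤ (classFun (FreeGroup ι) k) := by
  have := isNoetherian_of_injective
    (Submodule.inclusion (fun f hf => hf.1 : classFun (FreeGroup ι) k ≤ polyFun (FreeGroup ι) k))
    (Submodule.inclusion_injective _)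
  infer_instance

lemma comp_mem_classFun (φ : MulAut G) {k : ℕ} {f : G → ℤ} (hf : f ∈ classFun G k) :
    f ∘ φ ∈ classFun G k :=
  ⟨comp_mem_polyFun φ.toMonoidHom hf.1, fun p g => by
    simp only [Function.comp_apply, map_mul, map_inv]
    exact hf.2 _ _⟩

/-- The action of automorphisms on class functions. -/
def autClassFun (G : Type*) [Group G] (k : ℕ) : MulAut G →* Module.End ℤ (classFun G k) where
  toFun φ :=
    { toFun := fun f => ⟨f.1 ∘ (φ⁻¹ : MulAut G), comp_mem_classFun _ f.2⟩
      map_add' := fun _ _ => rfl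
      map_smul' := fun _ _ => rfl }
  map_one' := rfl
  map_mul' := fun φ ψ => by
    ext f g
    simp [MulAut.mul_apply]

/-- The action of outer automorphisms on class functions of degree less than `k`. -/
def outClassFun (G : Type*) [Group G] (k : ℕ) :
    OuterAutomorphismGroup G →* Module.End ℤ (classFun G k) :=
  QuotientGroup.lift _ (autClassFun G k) (by
    rintro _ ⟨p, rfl⟩
    rw [MonoidHom.mem_ker]
    ext f g
    change f.1 ((MulAut.conj p)⁻¹ g) = f.1 g
    rw [← map_inv, MulAut.conj_apply]
    exact f.2.2 _ _)

lemma outClassFun_mk_apply (φ : MulAut G) (k : ℕ) (f : classFun G k) (g : G) :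
    (outClassFun G k (φ : OuterAutomorphismGroup G) f).1 g = f.1 ((φ⁻¹ : MulAut G) g) := rfl

end PolynomialFunctions

/-! ### Coefficients of unipotent representations -/

section Coefficients

open Polynomial

variable {G A : Type*} [Group G] [Ring A]

lemma coeff_mem_polyFun (ρ : G →* A[X]) (hρ : ∀ g, (ρ g).coeff 0 = 1) (k : ℕ) (l : A →+ ℤ) :
    (fun g => l ((ρ g).coeff k)) ∈ polyFun G (k + 1) := by
  induction k using Nat.strong_induction_on generalizing l with
  | _ k ih =>
  rw [mem_polyFun_succ]
  intro h
  have h1 : fdiff h (fun g => l ((ρ g).coeff k)) = ∑ i ∈ Finset.range k,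
      fun g => (l.comp (AddMonoidHom.mulRight ((ρ h).coeff (k - i)))) ((ρ g).coeff i) := by
    ext g
    rw [fdiff_apply, map_mul, coeff_mul, Finset.Nat.sum_antidiagonal_eq_sum_range_succ_mk,
      Finset.sum_range_succ, Nat.sub_self, hρ, mul_one, map_add, add_sub_cancel_right, map_sum,
      Finset.sum_apply]
    rfl
  rw [h1]
  refine Submodule.sum_mem _ fun i hi => ?_
  rw [Finset.mem_range] at hi
  exact polyFun_mono hi (ih i hi _)

lemma apply_coeff_mul_comm {l : A →+ ℤ} (hl : ∀ a b, l (a * b) = l (b * a)) (p q : A[X]) (k : ℕ) :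
    l ((p * q).coeff k) = l ((q * p).coeff k) := by
  rw [coeff_mul, coeff_mul, map_sum, map_sum, ← Finset.Nat.sum_antidiagonal_swap]
  exact Finset.sum_congr rfl fun _ _ => hl _ _

lemma coeff_mem_classFun (ρ : G →* A[X]) (hρ : ∀ g, (ρ g).coeff 0 = 1) {l : A →+ ℤ}
    (hl : ∀ a b, l (a * b) = l (b * a)) (k : ℕ) :
    (fun g => l ((ρ g).coeff k)) ∈ classFun G (k + 1) := by
  refine ⟨coeff_mem_polyFun ρ hρ k l, fun p g => ?_⟩
  dsimp only
  rw [map_mul, apply_coeff_mul_comm hl, ← map_mul, ← mul_assoc, inv_mul_cancel, one_mul]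

/-- The unit `1 + N X` attached to a square-zero element. -/
noncomputable def sqZeroUnit (N : A) (hN : N * N = 0) : (A[X])ˣ where
  val := 1 + C N * X
  inv := 1 - C N * X
  val_inv := by
    have : (C N * X : A[X]) * (C N * X) = 0 := by
      rw [mul_assoc, ← mul_assoc X, X_mul_C, mul_assoc, ← mul_assoc (C N), ← C_mul, hN]
      simp
    rw [mul_sub, add_mul, add_mul, this]
    simp
  inv_val := by
    have : (C N * X : A[X]) * (C N * X) = 0 := by
      rw [mul_assoc, ← mul_assoc X, X_mul_C, mul_assoc, ← mul_assoc (C N), ← C_mul, hN]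
      simp
    rw [mul_add, sub_mul, sub_mul, this]
    simp

lemma coe_sqZeroUnit_zpow (N : A) (hN : N * N = 0) (e : ℤ) :
    ((sqZeroUnit N hN ^ e : (A[X])ˣ) : A[X]) = 1 + C (e • N) * X := by
  have hX : (C N * X : A[X]) * (C N * X) = 0 := by
    rw [mul_assoc, ← mul_assoc X, X_mul_C, mul_assoc, ← mul_assoc (C N), ← C_mul, hN]
    simp
  have hC : ∀ e : ℤ, (C (e • N) * X : A[X]) = e • (C N * X) := fun e => by
    rw [map_zsmul, smul_mul_assoc]
  induction e using Int.induction_on with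
  | zero => simp
  | succ n ih =>
    rw [zpow_add_one, Units.val_mul, ih, hC, hC]
    change (1 + (n : ℤ) • (C N * X)) * (1 + C N * X) = _
    rw [mul_add, add_mul, add_mul, smul_mul_assoc, smul_mul_assoc, hX, smul_zero, add_smul]
    simp only [one_mul, mul_one, one_smul, add_zero]
    abel
  | pred n ih =>
    rw [zpow_sub_one, Units.val_mul, ih, hC, hC]
    change (1 + (-(n : ℤ)) • (C N * X)) * (1 - C N * X) = _
    rw [mul_sub, add_mul, add_mul, smul_mul_assoc, smul_mul_assoc, hX, smul_zero, sub_smul]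
    simp only [one_mul, mul_one, one_smul, add_zero]
    abel

end Coefficients

section Syllables

open Polynomial

variable {ι : Type*}

/-- The element of the free group with the given list of syllables. -/
def sylProd (L : List (ι × ℤ)) : FreeGroup ι := (L.map fun p => FreeGroup.of p.1 ^ p.2).prod

lemma sylProd_nil : sylProd ([] : List (ι × ℤ)) = 1 := rfl

lemma sylProd_cons (p : ι × ℤ) (L : List (ι × ℤ)) :
    sylProd (p :: L) = FreeGroup.of p.1 ^ p.2 * sylProd L := by
  simp [sylProd]

lemma sylProd_append (L L' : List (ι × ℤ)) : sylProd (L ++ L') = sylProd L * sylProd L' := by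
  simp [sylProd]

lemma exists_sylProd (w : FreeGroup ι) : ∃ L, sylProd L = w := by
  induction w using FreeGroup.induction_on with
  | C1 => exact ⟨[], rfl⟩
  | of i => exact ⟨[(i, 1)], by simp [sylProd]⟩
  | inv_of i _ => exact ⟨[(i, -1)], by simp [sylProd]⟩
  | mul x y hx hy =>
    obtain ⟨L, rfl⟩ := hx
    obtain ⟨L', rfl⟩ := hy
    exact ⟨L ++ L', sylProd_append L L'⟩

lemma isConj_sylProd_rotate (L : List (ι × ℤ)) {n : ℕ} (hn : n ≤ L.length) :
    IsConj (sylProd L) (sylProd (L.rotate n)) := by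
  rw [List.rotate_eq_drop_append_take hn, sylProd_append]
  conv_lhs => rw [← List.take_append_drop n L, sylProd_append]
  rw [isConj_iff]
  exact ⟨(sylProd (L.take n))⁻¹, by group⟩

/-- Every conjugacy class contains a cyclically reduced product of syllables. -/
lemma exists_reduced_sylProd (w : FreeGroup ι) : ∃ L : List (ι × ℤ), IsConj w (sylProd L) ∧
    (∀ p ∈ L, p.2 ≠ 0) ∧ (2 ≤ L.length → ∀ (j : ℕ) (hj : j < L.length),
      L[j].1 ≠ (L[(j + 1) % L.length]'(Nat.mod_lt _ (by omega))).1) := by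
  classical
  have hex : ∃ n, ∃ L : List (ι × ℤ), IsConj w (sylProd L) ∧ L.length = n := by
    obtain ⟨L, hL⟩ := exists_sylProd w
    exact ⟨_, L, hL ▸ IsConj.refl _, rfl⟩
  obtain ⟨L, hL, hn⟩ := Nat.find_spec hex
  have hmin : ∀ L', IsConj w (sylProd L') → L.length ≤ L'.length := fun L' h => by
    rw [hn]
    exact Nat.find_min' hex ⟨L', h, rfl⟩
  refine ⟨L, hL, fun p hp h0 => ?_, fun h2 j hj heq => ?_⟩
  · obtain ⟨l1, l2, rfl⟩ := List.append_of_mem hp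
    have := hmin (l1 ++ l2) (by
      rwa [sylProd_append, sylProd_cons, h0, zpow_zero, one_mul, ← sylProd_append] at hL)
    simp at this
  · have hrot := hL.trans (isConj_sylProd_rotate L hj.le)
    have hlen := List.length_rotate L j
    rcases hR : L.rotate j with _ | ⟨p, _ | ⟨q, l⟩⟩
    · rw [hR] at hlen
      simp at hlen
      omega
    · rw [hR] at hlen
      simp at hlen
      omega
    · have h0 : (L.rotate j)[0]'(by omega) = L[j] := by
        rw [List.getElem_rotate]
        simp [Nat.mod_eq_of_lt hj]
      have h1 : (L.rotate j)[1]'(by omega) = L[(j + 1) % L.length]'(Nat.mod_lt _ (by omega)) := by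
        rw [List.getElem_rotate]
        congr 2
        omega
      rw [← h0, ← h1] at heq
      simp only [hR, List.getElem_cons_zero, List.getElem_cons_succ] at heq
      rw [hR] at hrot hlen
      have := hmin ((p.1, p.2 + q.2) :: l) (by
        rw [sylProd_cons, sylProd_cons, ← heq, ← mul_assoc, ← zpow_add] at hrot
        rwa [sylProd_cons])
      simp at this hlen
      omega

/-- Two elements with the same values of all polynomial class functions. -/
def PolyEq (y w : FreeGroup ι) : Prop :=
  ∀ k, ∀ f ∈ classFun (FreeGroup ι) k, f y = f w

lemma PolyEq.conj {y y' w : FreeGroup ι} (h : PolyEq y w) (hc : IsConj y y') : PolyEq y' w := by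
  intro k f hf
  obtain ⟨p, rfl⟩ := isConj_iff.1 hc
  rw [hf.2]
  exact h k f hf

variable [DecidableEq ι]

/-- The matrix moving one step along a cyclic word at the occurrences of `a`. -/
def stepMatrix (s : ℕ) [NeZero s] (i : ℕ → ι) (a : ι) : Matrix (Fin s) (Fin s) ℤ :=
  Matrix.of fun p q => if q = p + 1 ∧ i p.val = a then 1 else 0

lemma stepMatrix_sq {s : ℕ} [NeZero s] {i : ℕ → ι} (h : ∀ p : Fin s, i p.val ≠ i (p + 1).val)
    (a : ι) : stepMatrix s i a * stepMatrix s i a = 0 := by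
  ext p q
  rw [Matrix.mul_apply, Matrix.zero_apply]
  refine Finset.sum_eq_zero fun r _ => ?_
  simp only [stepMatrix, Matrix.of_apply]
  split_ifs with h1 h2
  · exfalso
    rw [h1.1] at h2
    exact h p (h1.2.trans h2.2.symm)
  all_goals simp

lemma stepMatrix_prod_nonneg {s : ℕ} [NeZero s] (i : ℕ → ι) (l : List ι) (p q : Fin s) :
    0 ≤ (l.map (stepMatrix s i)).prod p q := by
  induction l generalizing p with
  | nil =>
    rw [List.map_nil, List.prod_nil, Matrix.one_apply]
    split_ifs <;> simp
  | cons a l ih =>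
    rw [List.map_cons, List.prod_cons, Matrix.mul_apply]
    refine Finset.sum_nonneg fun r _ => mul_nonneg ?_ (ih r)
    simp only [stepMatrix, Matrix.of_apply]
    split_ifs <;> simp

lemma stepMatrix_prod_row {s : ℕ} [NeZero s] (i : ℕ → ι) {m : ℕ} (hm : m ≤ s) (q : Fin s) :
    ((List.range m).map fun j => stepMatrix s i (i j)).prod 0 q =
      if q = Fin.ofNat s m then 1 else 0 := by
  induction m generalizing q with
  | zero =>
    rw [List.range_zero, List.map_nil, List.prod_nil, Matrix.one_apply]
    simp [eq_comm]
  | succ m ih =>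
    rw [List.range_succ, List.map_append, List.prod_append, Matrix.mul_apply]
    have h1 : ∀ r, ((List.range m).map fun j => stepMatrix s i (i j)).prod 0 r =
        if r = Fin.ofNat s m then 1 else 0 := fun r => ih (by omega) r
    simp only [h1, ite_mul, one_mul, zero_mul, Finset.sum_ite_eq', Finset.mem_univ, if_true]
    have h2 : (Fin.ofNat s m).val = m := Nat.mod_eq_of_lt hm
    have h3 : Fin.ofNat s m + 1 = Fin.ofNat s (m + 1) := by
      apply Fin.ext
      simp [Fin.val_add, Fin.ofNat]
    simp only [List.map_cons, List.map_nil, List.prod_singleton, stepMatrix, Matrix.of_apply, h2,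
      h3, and_true]

lemma stepMatrix_trace_pos {s : ℕ} [NeZero s] (i : ℕ → ι) :
    0 < ((List.range s).map fun j => stepMatrix s i (i j)).prod.trace := by
  have h0 : ∀ p, 0 ≤ ((List.range s).map fun j => stepMatrix s i (i j)).prod p p := by
    intro p
    have := stepMatrix_prod_nonneg i ((List.range s).map i) p p
    rwa [List.map_map] at this
  have h1 := stepMatrix_prod_row i (le_refl s) 0
  rw [if_pos (by apply Fin.ext; simp [Fin.ofNat])] at h1
  have h2 := Finset.single_le_sum (f := fun p =>
    ((List.range s).map fun j => stepMatrix s i (i j)).prod p p) (fun p _ => h0 p)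
    (Finset.mem_univ (0 : Fin s))
  rw [h1] at h2
  exact lt_of_lt_of_le one_pos h2

end Syllables

section SyllableBound

open Polynomial

variable {ι : Type*} [DecidableEq ι]

lemma natDegree_one_add_C_mul_X_le {A : Type*} [Ring A] (a : A) :
    (1 + C a * X : A[X]).natDegree ≤ 1 := by
  compute_degree

/-- The representation attached to square-zero elements. -/
noncomputable def sqZeroRep {A : Type*} [Ring A] (N : ι → A) (hN : ∀ a, N a * N a = 0) :
    FreeGroup ι →* A[X] :=
  (Units.coeHom _).comp (FreeGroup.lift fun a => sqZeroUnit (N a) (hN a))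

lemma sqZeroRep_sylProd {A : Type*} [Ring A] (N : ι → A) (hN : ∀ a, N a * N a = 0)
    (L : List (ι × ℤ)) : sqZeroRep N hN (sylProd L) =
      (L.map fun p => (1 + C (p.2 • N p.1) * X : A[X])).prod := by
  induction L with
  | nil => simp [sylProd_nil]
  | cons p L ih =>
    rw [sylProd_cons, map_mul, ih, List.map_cons, List.prod_cons, ← coe_sqZeroUnit_zpow _ (hN p.1)]
    congr 1
    simp [sqZeroRep]

lemma sqZeroRep_coeff_zero {A : Type*} [Ring A] (N : ι → A) (hN : ∀ a, N a * N a = 0)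
    (w : FreeGroup ι) : (sqZeroRep N hN w).coeff 0 = 1 := by
  obtain ⟨L, rfl⟩ := exists_sylProd w
  rw [sqZeroRep_sylProd, ← constantCoeff_apply, map_list_prod, List.map_map]
  apply List.prod_eq_one
  intro x hx
  obtain ⟨p, -, rfl⟩ := List.mem_map.1 hx
  simp

lemma sqZeroRep_coeff_length {A : Type*} [Ring A] (N : ι → A) (hN : ∀ a, N a * N a = 0)
    (L : List (ι × ℤ)) : (sqZeroRep N hN (sylProd L)).coeff L.length =
      (L.map Prod.snd).prod • ((L.map Prod.fst).map N).prod := by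
  have h := coeff_list_prod_of_natDegree_le
    (L.map fun p => (1 + C (p.2 • N p.1) * X : A[X])) 1 (by
      intro x hx
      obtain ⟨p, -, rfl⟩ := List.mem_map.1 hx
      exact natDegree_one_add_C_mul_X_le _)
  rw [List.length_map, mul_one, List.map_map] at h
  rw [sqZeroRep_sylProd, h]
  clear h
  induction L with
  | nil => simp
  | cons p L ih =>
    have hc : (1 + C (p.2 • N p.1) * X : A[X]).coeff 1 = p.2 • N p.1 := by
      simp [coeff_one]
    simp only [List.map_cons, List.prod_cons, ih, Function.comp_apply]
    rw [hc, mul_smul, smul_mul_assoc, mul_smul_comm]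

lemma sqZeroRep_coeff_of_lt {A : Type*} [Ring A] (N : ι → A) (hN : ∀ a, N a * N a = 0)
    {L : List (ι × ℤ)} {k : ℕ} (hk : L.length < k) : (sqZeroRep N hN (sylProd L)).coeff k = 0 := by
  rw [sqZeroRep_sylProd]
  apply coeff_eq_zero_of_natDegree_lt
  refine lt_of_le_of_lt ?_ hk
  refine (natDegree_list_prod_le _).trans ?_
  rw [List.map_map]
  refine (List.sum_le_card_nsmul _ 1 ?_).trans (by simp)
  intro x hx
  obtain ⟨p, -, rfl⟩ := List.mem_map.1 hx
  exact natDegree_one_add_C_mul_X_le _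

lemma PolyEq.length_le {L L' : List (ι × ℤ)} (h : PolyEq (sylProd L) (sylProd L'))
    (h0 : ∀ p ∈ L, p.2 ≠ 0) (h2 : 2 ≤ L.length)
    (hred : ∀ (j : ℕ) (hj : j < L.length),
      L[j].1 ≠ (L[(j + 1) % L.length]'(Nat.mod_lt _ (by omega))).1) :
    L.length ≤ L'.length := by
  by_contra hlt
  push Not at hlt
  set s := L.length with hs
  have : NeZero s := ⟨by omega⟩
  set i : ℕ → ι := fun j => (L.getD j (L[0]'(by omega))).1 with hi
  have hij : ∀ j (hj : j < L.length), i j = L[j].1 := by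
    intro j hj
    simp only [hi]
    rw [List.getD_eq_getElem _ _ hj]
  have hN : ∀ a, stepMatrix s i a * stepMatrix s i a = 0 := stepMatrix_sq fun p => by
    have hp : (p + 1).val = (p.val + 1) % s := by
      rw [Fin.val_add, show (1 : Fin s).val = 1 % s from rfl, Nat.add_mod_mod]
    rw [hp, hij _ p.2, hij _ (Nat.mod_lt _ (by omega))]
    exact hred _ p.2
  have hmem := coeff_mem_classFun (sqZeroRep (stepMatrix s i) hN) (sqZeroRep_coeff_zero _ hN)
    (l := Matrix.traceAddMonoidHom (Fin s) ℤ) (fun a b => Matrix.trace_mul_comm a b) s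
  have heq := h _ _ hmem
  have hcoeff : (sqZeroRep (stepMatrix s i) hN (sylProd L)).coeff s = _ :=
    sqZeroRep_coeff_length _ hN L
  rw [sqZeroRep_coeff_of_lt _ _ hlt, hcoeff, map_zero] at heq
  have hmap : L.map Prod.fst = (List.range s).map i := by
    apply List.ext_getElem
    · simp [hs]
    · intro j hj1 hj2
      simp only [List.getElem_map, List.getElem_range]
      exact (hij j (by simpa using hj1)).symm
  rw [hmap, List.map_map, Matrix.traceAddMonoidHom_apply, Matrix.trace_smul, smul_eq_mul,
    mul_eq_zero] at heq
  rcases heq with heq | heq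
  · rw [List.prod_eq_zero_iff] at heq
    obtain ⟨p, hp, hp0⟩ := List.mem_map.1 heq
    exact h0 p hp hp0
  · exact (stepMatrix_trace_pos i).ne' heq

end SyllableBound

section Faithful

variable {ι : Type*} [DecidableEq ι]

/-- The exponent sum of a generator. -/
def expSum (a : ι) : FreeGroup ι →* Multiplicative ℤ :=
  FreeGroup.lift fun b => Multiplicative.ofAdd (if b = a then 1 else 0)

lemma expSum_mem_classFun (a : ι) :
    (fun w => Multiplicative.toAdd (expSum a w)) ∈ classFun (FreeGroup ι) 2 :=
  ⟨coe_hom_mem_polyFun _, fun p g => by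
    simp only [map_mul, map_inv, toAdd_mul, toAdd_inv]
    ring⟩

lemma expSum_sylProd (a : ι) (L : List (ι × ℤ)) : Multiplicative.toAdd (expSum a (sylProd L)) =
    (L.map fun p => if p.1 = a then p.2 else 0).sum := by
  induction L with
  | nil => simp [sylProd_nil]
  | cons p L ih =>
    rw [sylProd_cons, map_mul, toAdd_mul, ih, List.map_cons, List.sum_cons, map_zpow, toAdd_zpow]
    simp [expSum]

lemma expSum_sylProd_map (a : ι) (M : List ι) :
    Multiplicative.toAdd (expSum a (sylProd (M.map fun i => (i, (1 : ℤ))))) = M.count a := by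
  induction M with
  | nil => simp [sylProd_nil]
  | cons p M ih =>
    rw [List.map_cons, sylProd_cons, map_mul, toAdd_mul, ih, List.count_cons]
    by_cases h : p = a <;> simp [expSum, h, add_comm]

lemma norm_of_pow_le (a : ι) (n : ℕ) : (FreeGroup.of a ^ n).norm ≤ n := by
  induction n with
  | zero => simp
  | succ n ih =>
    rw [pow_succ]
    refine (FreeGroup.norm_mul_le _ _).trans ?_
    rw [FreeGroup.norm_of]
    omega

lemma count_add_count_le {a b : ι} (hab : a ≠ b) (M : List ι) :
    M.count a + M.count b ≤ M.length := by
  induction M with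
  | nil => simp
  | cons c M ih =>
    rw [List.count_cons, List.count_cons, List.length_cons]
    by_cases h : c = a
    · have : c ≠ b := fun h' => hab (h ▸ h')
      simp [h, hab]
      omega
    · by_cases h' : c = b <;> simp [h, h'] <;> grind

variable [Fintype ι]

lemma cyclen_isConj {y z : FreeGroup ι} (h : IsConj y z) : cyclen y = cyclen z := by
  obtain ⟨p, rfl⟩ := isConj_iff.1 h
  have := cyclen_conj p⁻¹ y
  rw [inv_inv] at this
  exact this.symm

lemma PolyEq.cyclen_le {y : FreeGroup ι} {M : List ι} (hM : M.length ≤ 2)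
    (h : PolyEq y (sylProd (M.map fun i => (i, (1 : ℤ))))) : cyclen y ≤ M.length := by
  obtain ⟨L, hL, h0, hred⟩ := exists_reduced_sylProd y
  replace h := h.conj hL
  rw [cyclen_isConj hL]
  refine (cyclen_le_norm _).trans ?_
  have hexp : ∀ a, Multiplicative.toAdd (expSum a (sylProd L)) = M.count a := fun a => by
    rw [← expSum_sylProd_map]
    exact h 2 _ (expSum_mem_classFun a)
  have hlen : 2 ≤ L.length → L.length ≤ M.length := fun h2 => by
    have := h.length_le h0 h2 (hred h2)
    rwa [List.length_map] at this
  rcases L with _ | ⟨p, _ | ⟨q, _ | ⟨r, L⟩⟩⟩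
  · simp [sylProd_nil]
  · have h1 := hexp p.1
    rw [expSum_sylProd] at h1
    simp only [List.map_cons, List.map_nil, List.sum_cons, List.sum_nil, if_true, add_zero] at h1
    rw [sylProd_cons, sylProd_nil, mul_one, h1, zpow_natCast]
    exact (norm_of_pow_le _ _).trans List.count_le_length
  · have hne := hred (by simp) 0 (by simp)
    simp only [List.length_cons, List.length_nil, zero_add, Nat.reduceAdd, Nat.reduceMod,
      List.getElem_cons_zero, List.getElem_cons_succ] at hne
    have h1 := hexp p.1
    have h2 := hexp q.1
    rw [expSum_sylProd] at h1 h2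
    simp only [List.map_cons, List.map_nil, List.sum_cons, List.sum_nil, if_true, add_zero,
      if_neg hne, if_neg hne.symm, zero_add] at h1 h2
    rw [sylProd_cons, sylProd_cons, sylProd_nil, mul_one, h1, h2, zpow_natCast, zpow_natCast]
    refine (FreeGroup.norm_mul_le _ _).trans ?_
    exact (add_le_add (norm_of_pow_le _ _) (norm_of_pow_le _ _)).trans (count_add_count_le hne _)
  · have := hlen (by simp)
    simp at this
    omega

lemma eq_of_norm_le_one {w : FreeGroup ι} {i : ι} (hw : w.norm ≤ 1)
    (he : Multiplicative.toAdd (expSum i w) = 1) : w = FreeGroup.of i := by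
  rw [norm_eq_length] at hw
  rcases hl : w.toWord with _ | ⟨⟨a, e⟩, _ | ⟨q, l⟩⟩
  · rw [FreeGroup.toWord_eq_nil_iff] at hl
    rw [hl] at he
    simp at he
  · have hw' : w = FreeGroup.mk [(a, e)] := by rw [← hl, FreeGroup.mk_toWord]
    rw [hw'] at he ⊢
    cases e
    · simp [expSum] at he
      split_ifs at he
      simp at he
    · simp [expSum] at he
      rw [he]
      rfl
  · rw [hl] at hw
    simp at hw

/-- An automorphism preserving all polynomial class functions is inner. -/
theorem mk_eq_one_of_polyEq {φ : MulAut (FreeGroup ι)} (h : ∀ w, PolyEq (φ w) w) :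
    (φ : OuterAutomorphismGroup (FreeGroup ι)) = 1 := by
  obtain ⟨p, hp⟩ := exists_minimal_conj fun i => φ (FreeGroup.of i)
  set t : ι → FreeGroup ι := fun i => p⁻¹ * φ (FreeGroup.of i) * p with ht
  have hconj : ∀ x, IsConj (φ x) (p⁻¹ * φ x * p) := fun x => isConj_iff.2 ⟨p⁻¹, by simp⟩
  have ht1 : ∀ i, PolyEq (t i) (FreeGroup.of i) := fun i => (h _).conj (hconj _)
  have ht2 : ∀ i j, PolyEq (t i * t j) (FreeGroup.of i * FreeGroup.of j) := fun i j => by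
    have : t i * t j = p⁻¹ * φ (FreeGroup.of i * FreeGroup.of j) * p := by
      simp only [ht, map_mul]
      group
    rw [this]
    exact (h _).conj (hconj _)
  have hnorm : ∀ i, (t i).norm ≤ 1 := by
    intro i
    rcases norm_le_cyclen_of_minimal (t := t) hp i with h1 | ⟨j, hj, h1⟩
    · refine h1.trans (PolyEq.cyclen_le (M := [i]) (by simp) ?_)
      simpa [sylProd] using ht1 i
    · have h2 : cyclen (t i * t j) ≤ 2 := PolyEq.cyclen_le (M := [i, j]) (by simp) (by
        simpa [sylProd] using ht2 i j)
      have h3 : (t j).norm ≠ 0 := fun h0 => hj (FreeGroup.norm_eq_zero.1 h0)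
      omega
  have hti : ∀ i, t i = FreeGroup.of i := fun i => by
    refine eq_of_norm_le_one (hnorm i) ?_
    rw [ht1 i 2 _ (expSum_mem_classFun i)]
    simp [expSum]
  have hφ : φ = MulAut.conj p := by
    have : φ.toMonoidHom = (MulAut.conj p).toMonoidHom := by
      ext i
      have := hti i
      simp only [ht] at this
      change φ (FreeGroup.of i) = MulAut.conj p (FreeGroup.of i)
      rw [MulAut.conj_apply]
      calc φ (FreeGroup.of i) = p * (p⁻¹ * φ (FreeGroup.of i) * p) * p⁻¹ := by group
        _ = _ := by rw [this]
    exact MulEquiv.toMonoidHom_injective this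
  rw [QuotientGroup.eq_one_iff]
  exact ⟨p, hφ.symm⟩

end Faithful

/-! ### The filtration of the outer automorphism group -/

section Filtration

variable {ι : Type*} [DecidableEq ι] [Fintype ι]

lemma mem_commutator_of_expSum {w : FreeGroup ι} (h : ∀ a, expSum a w = 1) :
    w ∈ commutator (FreeGroup ι) := by
  let θ : FreeGroup ι →* Abelianization (FreeGroup ι) :=
    ∏ a, (zpowersHom _ (Abelianization.of (FreeGroup.of a))).comp (expSum a)
  have h1 : (Abelianization.of : FreeGroup ι →* _) = θ := by
    ext i
    simp only [θ, MonoidHom.finsetProd_apply, MonoidHom.comp_apply]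
    rw [Finset.prod_eq_single i]
    · simp [expSum]
    · intro b _ hb
      simp [expSum, hb.symm]
    · simp
  rw [← Abelianization.ker_of, MonoidHom.mem_ker, h1]
  simp only [θ, MonoidHom.finsetProd_apply, MonoidHom.comp_apply, h, map_one,
    Finset.prod_const_one]

lemma apply_eq_of_outClassFun {φ : MulAut (FreeGroup ι)} {k : ℕ}
    (h : outClassFun (FreeGroup ι) k (φ : OuterAutomorphismGroup (FreeGroup ι)) = 1)
    {f : FreeGroup ι → ℤ} (hf : f ∈ classFun (FreeGroup ι) k) (g : FreeGroup ι) :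
    f ((φ⁻¹ : MulAut (FreeGroup ι)) g) = f g := by
  have h1 := outClassFun_mk_apply φ k ⟨f, hf⟩ g
  rw [h] at h1
  exact h1.symm

lemma outClassFun_eq_one_of_le {x : OuterAutomorphismGroup (FreeGroup ι)} {k l : ℕ} (hkl : k ≤ l)
    (h : outClassFun (FreeGroup ι) l x = 1) :
    outClassFun (FreeGroup ι) k x = 1 := by
  obtain ⟨φ, rfl⟩ := QuotientGroup.mk_surjective x
  ext f g
  exact apply_eq_of_outClassFun h ⟨polyFun_mono hkl f.2.1, f.2.2⟩ g

lemma outClassFun_sub_mem {x : OuterAutomorphismGroup (FreeGroup ι)}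
    (h : outClassFun (FreeGroup ι) 2 x = 1) {k : ℕ}
    (f : classFun (FreeGroup ι) (k + 1)) :
    (outClassFun (FreeGroup ι) (k + 1) x f).1 - f.1 ∈ classFun (FreeGroup ι) k := by
  obtain ⟨φ, rfl⟩ := QuotientGroup.mk_surjective x
  refine ⟨comp_sub_mem_polyFun (φ⁻¹ : MulAut (FreeGroup ι)).toMonoidHom (fun g => ?_) f.2.1,
    (Submodule.sub_mem (classFun _ (k + 1)) (Subtype.property _) f.2).2⟩
  refine mem_commutator_of_expSum fun a => ?_
  rw [map_mul, map_inv, inv_mul_eq_one]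
  exact (apply_eq_of_outClassFun h (expSum_mem_classFun a) g).symm

lemma outClassFun_eq_one_of_pow_succ {x : OuterAutomorphismGroup (FreeGroup ι)}
    (h : outClassFun (FreeGroup ι) 2 x = 1) {k q : ℕ} (hq : 0 < q)
    (hk : outClassFun (FreeGroup ι) k x = 1)
    (hx : outClassFun (FreeGroup ι) (k + 1) (x ^ q) = 1) :
    outClassFun (FreeGroup ι) (k + 1) x = 1 := by
  ext1 f
  set u : classFun (FreeGroup ι) (k + 1) := outClassFun (FreeGroup ι) (k + 1) x f - f with hu
  have hTu : outClassFun (FreeGroup ι) (k + 1) x u = u := by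
    have hmem := outClassFun_sub_mem h f
    obtain ⟨φ, rfl⟩ := QuotientGroup.mk_surjective x
    ext g
    exact apply_eq_of_outClassFun hk hmem g
  have hpow : ∀ n : ℕ, (outClassFun (FreeGroup ι) (k + 1) x ^ n) f = f + n • u := by
    intro n
    induction n with
    | zero => simp
    | succ n ih =>
      rw [pow_succ', Module.End.mul_apply, ih, map_add, map_nsmul, hTu, succ_nsmul, hu]
      abel
  have h1 := hpow q
  rw [← map_pow, hx, Module.End.one_apply, left_eq_add, smul_eq_zero] at h1
  rcases h1 with h1 | h1
  · omega
  · rw [Module.End.one_apply]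
    exact sub_eq_zero.1 h1

lemma outClassFun_eq_one_of_pow {x : OuterAutomorphismGroup (FreeGroup ι)}
    (h : outClassFun (FreeGroup ι) 2 x = 1) {k q : ℕ} (hq : 0 < q)
    (hx : outClassFun (FreeGroup ι) k (x ^ q) = 1) : outClassFun (FreeGroup ι) k x = 1 := by
  induction k with
  | zero => exact outClassFun_eq_one_of_le (by omega) h
  | succ k ih =>
    exact outClassFun_eq_one_of_pow_succ h hq
      (ih (outClassFun_eq_one_of_le (Nat.le_succ k) hx)) hx

lemma eq_one_of_outClassFun {x : OuterAutomorphismGroup (FreeGroup ι)}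
    (h : ∀ k, outClassFun (FreeGroup ι) k x = 1) : x = 1 := by
  obtain ⟨φ, rfl⟩ := QuotientGroup.mk_surjective x
  have h1 : ((φ⁻¹ : MulAut (FreeGroup ι)) : OuterAutomorphismGroup (FreeGroup ι)) = 1 :=
    mk_eq_one_of_polyEq fun w k f hf => apply_eq_of_outClassFun (h k) hf w
  rw [QuotientGroup.mk_inv, inv_eq_one] at h1
  exact h1

lemma eq_one_of_pow_eq_one {x : OuterAutomorphismGroup (FreeGroup ι)}
    (h : outClassFun (FreeGroup ι) 2 x = 1) {q : ℕ} (hq : 0 < q) (hx : x ^ q = 1) :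
    x = 1 :=
  eq_one_of_outClassFun fun k => outClassFun_eq_one_of_pow h hq (by rw [hx, map_one])

/-- Abelian subgroups act faithfully on some space of class functions. -/
theorem exists_faithful (A : Subgroup (OuterAutomorphismGroup (FreeGroup ι)))
    (hA : ∀ x ∈ A, ∀ y ∈ A, x * y = y * x) :
    ∃ k, ∀ x ∈ A, outClassFun (FreeGroup ι) k x = 1 → x = 1 := by
  by_contra hcon
  push Not at hcon
  have hstep : ∀ k, ∃ x ∈ A, outClassFun (FreeGroup ι) k x = 1 ∧
      ∃ l, k < l ∧ outClassFun (FreeGroup ι) l x ≠ 1 := by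
    intro k
    obtain ⟨x, hxA, hx, hx1⟩ := hcon k
    obtain ⟨l, hl⟩ := not_forall.1 (mt eq_one_of_outClassFun hx1)
    refine ⟨x, hxA, hx, l, ?_, hl⟩
    by_contra hle
    exact hl (outClassFun_eq_one_of_le (not_lt.1 hle) hx)
  choose y hyA hy next hnext hyn using hstep
  let κ : ℕ → ℕ := fun n => Nat.rec 2 (fun _ k => next k) n
  have hκ : ∀ n, κ (n + 1) = next (κ n) := fun _ => rfl
  have hκm : StrictMono κ := strictMono_nat_of_lt_succ fun n => hnext _
  have hκ2 : ∀ n, 2 ≤ κ n := fun n => hκm.monotone (Nat.zero_le n)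
  have hT : ∀ n, outClassFun (FreeGroup ι) 2 (y (κ n)) = 1 := fun n =>
    outClassFun_eq_one_of_le (hκ2 n) (hy _)
  obtain ⟨d, hd⟩ := exists_rank_bound ι
  have := hd (A ⊓ (outClassFun (FreeGroup ι) 2).ker)
    (fun a ha b hb => hA a ha.1 b hb.1)
    (fun g hg k hk h => eq_one_of_pow_eq_one hg.2 hk h)
    (fun j => y (κ (d - j))) (fun j => ⟨hyA _, hT _⟩) (d + 1) (by
      intro j hj k hk hmem
      have hle : Subgroup.closure ((fun j => y (κ (d - j))) '' Set.Iio j) ≤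
          (outClassFun (FreeGroup ι) (κ (d - j + 1))).ker := by
        rw [Subgroup.closure_le]
        rintro _ ⟨i, hi, rfl⟩
        have hi' : i < j := hi
        exact outClassFun_eq_one_of_le (hκm.monotone (show d - j + 1 ≤ d - i by omega))
          (hy (κ (d - i)))
      have h1 := outClassFun_eq_one_of_pow (hT (d - j)) hk (hle hmem)
      exact hyn (κ (d - j)) h1)
  omega

end Filtration

/-! ### Torsion subgroups -/

section Minkowski

variable {R : Type*} [Ring R]

lemma exists_pow_eq_one_add_smul {c : ℤ} {B : R} (n : ℕ) :
    ∃ E : R, (1 + c • B) ^ n = 1 + c • E := by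
  induction n with
  | zero => exact ⟨0, by simp⟩
  | succ n ih =>
    obtain ⟨E, hE⟩ := ih
    refine ⟨E + B + E * (c • B), ?_⟩
    rw [pow_succ, hE]
    simp only [add_mul, mul_add, one_mul, mul_one, smul_add, smul_mul_assoc]
    abel

lemma exists_geom_sum_eq {c : ℤ} {B : R} (n : ℕ) :
    ∃ E : R, ∑ i ∈ Finset.range n, (1 + c • B) ^ i = (n : ℤ) • 1 + c • E := by
  choose E hE using fun i => exists_pow_eq_one_add_smul (c := c) (B := B) i
  refine ⟨∑ i ∈ Finset.range n, E i, ?_⟩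
  rw [Finset.sum_congr rfl fun i _ => hE i, Finset.sum_add_distrib, Finset.smul_sum]
  simp

lemma exists_three_smul_of_prime_pow [IsAddTorsionFree R] {p a : ℕ} (hp : p.Prime) {B : R}
    (h : (1 + (3 ^ (a + 1) : ℤ) • B) ^ p = 1) : ∃ B', B = (3 : ℤ) • B' := by
  have hinj : ∀ {x : R}, (3 ^ (a + 1) : ℤ) • x = 0 → x = 0 := fun {x} hx =>
    (smul_eq_zero.1 hx).resolve_left (by positivity)
  have hg := mul_geom_sum (1 + (3 ^ (a + 1) : ℤ) • B) p
  rw [h, sub_self, add_sub_cancel_left] at hg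
  by_cases h3 : p = 3
  · subst h3
    rw [smul_mul_assoc] at hg
    have h1 := hinj hg
    rw [Finset.sum_range_succ, Finset.sum_range_succ, Finset.sum_range_one, pow_zero, pow_one,
      sq] at h1
    have h2 : (3 : ℤ) • (B + (3 ^ (a + 1) : ℤ) • (B * B) +
        (3 ^ a * 3 ^ (a + 1) : ℤ) • (B * (B * B))) = 0 := by
      rw [← h1]
      simp only [mul_add, add_mul, mul_one, one_mul, smul_mul_assoc, mul_smul_comm, smul_add,
        smul_smul]
      module
    have h4 := (smul_eq_zero.1 h2).resolve_left (by norm_num)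
    refine ⟨-((3 ^ a : ℤ) • (B * B) + (3 ^ a * 3 ^ a : ℤ) • (B * (B * B))), ?_⟩
    rw [← sub_eq_zero, ← h4]
    module
  · obtain ⟨E, hE⟩ := exists_geom_sum_eq (c := (3 ^ (a + 1) : ℤ)) (B := B) p
    rw [hE, smul_mul_assoc] at hg
    have h1 := hinj hg
    rw [mul_add, mul_smul_comm, mul_one, mul_smul_comm] at h1
    have hcop : IsCoprime (p : ℤ) 3 := by
      have : Nat.Coprime p 3 := (Nat.coprime_primes hp Nat.prime_three).2 h3
      exact Nat.isCoprime_iff_coprime.2 this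
    obtain ⟨u, v, huv⟩ := hcop
    refine ⟨v • B - (u * 3 ^ a) • (B * E), ?_⟩
    have h2 : u • ((p : ℤ) • B + (3 ^ (a + 1) : ℤ) • (B * E)) = 0 := by rw [h1, smul_zero]
    calc B = (u * p + v * 3) • B := by rw [huv, one_smul]
      _ = (u * p + v * 3) • B - u • ((p : ℤ) • B + (3 ^ (a + 1) : ℤ) • (B * E)) := by
        rw [h2, sub_zero]
      _ = _ := by module

lemma eq_one_of_prime_pow {n : Type*} [Fintype n] [DecidableEq n] {p : ℕ} (hp : p.Prime)
    {B : Matrix n n ℤ} (h : (1 + (3 : ℤ) • B) ^ p = 1) : B = 0 := by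
  have : IsAddTorsionFree (Matrix n n ℤ) := inferInstanceAs (IsAddTorsionFree (n → n → ℤ))
  have key : ∀ a : ℕ, ∃ B' : Matrix n n ℤ, B = (3 ^ a : ℤ) • B' := by
    intro a
    induction a with
    | zero => exact ⟨B, by simp⟩
    | succ a ih =>
      obtain ⟨B', rfl⟩ := ih
      rw [smul_smul, ← pow_succ'] at h
      obtain ⟨B'', rfl⟩ := exists_three_smul_of_prime_pow hp h
      exact ⟨B'', by rw [smul_smul, pow_succ]⟩
  ext i j
  rw [Matrix.zero_apply]
  obtain ⟨B', hB'⟩ := key (B i j).natAbs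
  have hdvd : (3 ^ (B i j).natAbs : ℤ) ∣ B i j := ⟨B' i j, by
    conv_lhs => rw [hB']
    rfl⟩
  refine Int.eq_zero_of_abs_lt_dvd hdvd ?_
  rw [Int.abs_eq_natAbs]
  exact_mod_cast Nat.lt_pow_self (by norm_num)

/-- Minkowski's lemma: an integral matrix of finite order congruent to one modulo three is
trivial. -/
lemma eq_one_of_pow_eq_one_of_mod_three {n : Type*} [Fintype n] [DecidableEq n]
    {q : ℕ} (hq : 0 < q) {g : Matrix n n ℤ} (hg : g ^ q = 1)
    (h : ∃ B : Matrix n n ℤ, g = 1 + (3 : ℤ) • B) : g = 1 := by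
  induction q using induction_on_primes generalizing g with
  | zero => omega
  | one => simpa using hg
  | prime_mul p q hp ih =>
    obtain ⟨B, rfl⟩ := h
    have hq' : 0 < q := Nat.pos_of_mul_pos_left hq
    rw [pow_mul] at hg
    obtain ⟨E, hE⟩ := exists_pow_eq_one_add_smul (c := 3) (B := B) p
    have h1 := ih hq' hg ⟨E, hE⟩
    rw [eq_one_of_prime_pow hp h1, smul_zero, add_zero]

lemma exists_eq_one_add_three_smul {n : Type*} [Fintype n] [DecidableEq n] {g : Matrix n n ℤ}
    (h : g.map (Int.castRingHom (ZMod 3)) = 1) : ∃ B : Matrix n n ℤ, g = 1 + (3 : ℤ) • B := by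
  have h1 : ∀ i j, (3 : ℤ) ∣ (g - 1) i j := by
    intro i j
    have h2 := congrFun (congrFun h i) j
    refine (ZMod.intCast_zmod_eq_zero_iff_dvd ((g - 1) i j) 3).1 ?_
    rw [Matrix.sub_apply, Int.cast_sub]
    rw [Matrix.map_apply] at h2
    change ((g i j : ℤ) : ZMod 3) = _ at h2
    rw [h2, Matrix.one_apply, Matrix.one_apply]
    split_ifs <;> simp
  choose B hB using h1
  refine ⟨Matrix.of B, ?_⟩
  ext i j
  have := hB i j
  rw [Matrix.sub_apply] at this
  simp only [Matrix.add_apply, Matrix.smul_apply, Matrix.of_apply, smul_eq_mul]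
  linarith

variable {ι : Type*} [DecidableEq ι] [Fintype ι]

/-- Torsion subgroups of the outer automorphism group are finite. -/
theorem finite_of_torsion (T : Subgroup (OuterAutomorphismGroup (FreeGroup ι)))
    (hT : ∀ x ∈ T, IsOfFinOrder x) : (T : Set (OuterAutomorphismGroup (FreeGroup ι))).Finite := by
  have : Module.Free ℤ (classFun (FreeGroup ι) 2) := Module.free_of_finite_type_torsion_free'
  let b := Module.Free.chooseBasis ℤ (classFun (FreeGroup ι) 2)
  let θ₀ : OuterAutomorphismGroup (FreeGroup ι) →* Matrix _ _ ℤ :=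
    (LinearMap.toMatrixAlgEquiv b).toMulEquiv.toMonoidHom.comp (outClassFun (FreeGroup ι) 2)
  let θ : OuterAutomorphismGroup (FreeGroup ι) →* Matrix _ _ (ZMod 3) :=
    (Int.castRingHom (ZMod 3)).mapMatrix.toMonoidHom.comp θ₀
  have hker : ∀ x ∈ T, θ x = 1 → x = 1 := by
    intro x hx h
    obtain ⟨q, hq, hxq⟩ := (isOfFinOrder_iff_pow_eq_one).1 (hT x hx)
    have h1 : θ₀ x = 1 := eq_one_of_pow_eq_one_of_mod_three hq
      (by rw [← map_pow, hxq, map_one]) (exists_eq_one_add_three_smul h)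
    have h2 : outClassFun (FreeGroup ι) 2 x = 1 := by
      apply (LinearMap.toMatrixAlgEquiv b).injective
      rw [map_one]
      exact h1
    exact eq_one_of_pow_eq_one h2 hq hxq
  refine Set.Finite.of_finite_image (f := θ) (Set.toFinite _) ?_
  intro x hx y hy hxy
  have h1 : θ (x⁻¹ * y) = 1 := by
    rw [map_mul, ← hxy, ← map_mul, inv_mul_cancel, map_one]
  exact inv_mul_eq_one.1 (hker _ (T.mul_mem (T.inv_mem hx) hy) h1)

end Minkowski

/-! ### Units of rings that are finite over the integers -/

section Units

open scoped nonZeroDivisors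

lemma isNoetherian_additive_of_injective {G H : Type*} [CommGroup G] [CommGroup H]
    [IsNoetherian ℤ (Additive H)] (f : G →* H) (hf : Function.Injective f) :
    IsNoetherian ℤ (Additive G) :=
  isNoetherian_of_injective f.toAdditive.toIntLinearMap hf

lemma isNoetherian_additive_of_ker {G H : Type*} [CommGroup G] [CommGroup H]
    [IsNoetherian ℤ (Additive H)] (f : G →* H) (h : IsNoetherian ℤ (Additive f.ker)) :
    IsNoetherian ℤ (Additive G) := by
  refine isNoetherian_of_range_eq_ker f.ker.subtype.toAdditive.toIntLinearMap
    f.toAdditive.toIntLinearMap ?_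
  ext x
  constructor
  · rintro ⟨y, rfl⟩
    exact y.toMul.2
  · intro hx
    exact ⟨Additive.ofMul ⟨x.toMul, hx⟩, rfl⟩

/-- Units lift finite generation along ring homomorphisms with square-zero kernel. -/
lemma isNoetherian_units_of_ker_sq {R S : Type*} [CommRing R] [CommRing S] [Module.Finite ℤ R]
    [IsNoetherian ℤ (Additive Sˣ)] (f : R →+* S) (h : ∀ x y, f x = 0 → f y = 0 → x * y = 0) :
    IsNoetherian ℤ (Additive Rˣ) := by
  refine isNoetherian_additive_of_ker (Units.map f.toMonoidHom) ?_
  have hk : ∀ u : (Units.map f.toMonoidHom).ker, f ((u : Rˣ) - 1) = 0 := by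
    intro u
    have h1 := congrArg Units.val u.2
    change f (u : Rˣ) = 1 at h1
    rw [map_sub, h1, map_one, sub_self]
  let g : Additive (Units.map f.toMonoidHom).ker →+ R :=
    { toFun := fun u => ((u.toMul : Rˣ) : R) - 1
      map_zero' := sub_self 1
      map_add' := by
        intro u v
        have h1 := h _ _ (hk u.toMul) (hk v.toMul)
        rw [toMul_add, Subgroup.coe_mul, Units.val_mul]
        linear_combination h1 }
  refine isNoetherian_of_injective g.toIntLinearMap ?_
  intro u v huv
  have h1 : ((u.toMul : Rˣ) : R) - 1 = ((v.toMul : Rˣ) : R) - 1 := huv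
  exact Additive.toMul.injective (Subtype.ext (Units.ext (sub_left_injective h1)))

lemma isNoetherian_units_of_isDomain {R : Type*} [CommRing R] [IsDomain R] [Module.Finite ℤ R] :
    IsNoetherian ℤ (Additive Rˣ) := by
  by_cases h : CharZero R
  · let K := FractionRing R
    let : Algebra ℤ K := Ring.toIntAlgebra K
    have : NumberField K := { to_finiteDimensional := Module.Finite.of_isLocalization ℤ R ℤ⁰ }
    have hxint : ∀ x : R, IsIntegral ℤ (algebraMap R K x) := fun x =>
      (Algebra.IsIntegral.isIntegral x).map (algebraMap R K).toIntAlgHom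
    let f : R →+* NumberField.RingOfIntegers K :=
      (algebraMap R K).codRestrict (integralClosure ℤ K) hxint
    have hf : Function.Injective f := fun x y hxy =>
      IsFractionRing.injective R K (congrArg Subtype.val hxy)
    exact isNoetherian_additive_of_injective (Units.map f.toMonoidHom)
      (Units.map_injective hf)
  · have hn : ∃ n : ℕ, n ≠ 0 ∧ (n : R) = 0 := by
      by_contra! hn
      exact h (charZero_of_inj_zero fun n h0 => by_contra fun h1 => hn n h1 h0)
    obtain ⟨n, hn, hn0⟩ := hn
    have : Finite R := by
      refine Module.finite_of_fg_torsion R fun {x} => ?_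
      refine ⟨⟨(n : ℤ), mem_nonZeroDivisors_of_ne_zero (by exact_mod_cast hn)⟩, ?_⟩
      change (n : ℤ) • x = 0
      rw [zsmul_eq_mul, Int.cast_natCast, hn0, zero_mul]
    have : Finite (Additive Rˣ) := inferInstanceAs (Finite Rˣ)
    infer_instance

lemma isNoetherian_units_quotient_mul {R : Type*} [CommRing R] [Module.Finite ℤ R] (I J : Ideal R)
    [IsNoetherian ℤ (Additive (R ⧸ I)ˣ)] [IsNoetherian ℤ (Additive (R ⧸ J)ˣ)] :
    IsNoetherian ℤ (Additive (R ⧸ I * J)ˣ) := by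
  have : IsNoetherian ℤ (Additive ((R ⧸ I) × (R ⧸ J))ˣ) := by
    let e := (AddEquiv.prodAdditive (R ⧸ I)ˣ (R ⧸ J)ˣ).symm.trans
      (MulEquiv.toAdditive MulEquiv.prodUnits.symm)
    exact isNoetherian_of_injective e.symm.toAddMonoidHom.toIntLinearMap e.symm.injective
  refine isNoetherian_units_of_ker_sq
    ((Ideal.Quotient.factor Ideal.mul_le_left).prod (Ideal.Quotient.factor Ideal.mul_le_right) :
      R ⧸ I * J →+* (R ⧸ I) × (R ⧸ J)) ?_
  intro x y hx hy
  obtain ⟨x, rfl⟩ := Ideal.Quotient.mk_surjective x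
  obtain ⟨y, rfl⟩ := Ideal.Quotient.mk_surjective y
  have hx' := congrArg Prod.fst hx
  have hy' := congrArg Prod.snd hy
  rw [← map_mul, Ideal.Quotient.eq_zero_iff_mem]
  exact Ideal.mul_mem_mul (Ideal.Quotient.eq_zero_iff_mem.1 hx')
    (Ideal.Quotient.eq_zero_iff_mem.1 hy')

/-- The unit group of a commutative ring that is finitely generated as an abelian group is
finitely generated. -/
theorem isNoetherian_units {R : Type*} [CommRing R] [Module.Finite ℤ R] :
    IsNoetherian ℤ (Additive Rˣ) := by
  have : IsNoetherianRing R := isNoetherian_of_tower ℤ inferInstance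
  obtain ⟨Z, hZ⟩ := PrimeSpectrum.exists_primeSpectrum_prod_le R (⊥ : Ideal R)
  have key : ∀ Z : Multiset (PrimeSpectrum R),
      IsNoetherian ℤ (Additive (R ⧸ (Z.map PrimeSpectrum.asIdeal).prod)ˣ) := by
    intro Z
    induction Z using Multiset.induction_on with
    | empty =>
      rw [Multiset.map_zero, Multiset.prod_zero, Ideal.one_eq_top]
      have : Subsingleton (R ⧸ (⊤ : Ideal R)) := Ideal.Quotient.subsingleton_iff.2 rfl
      have : Finite (Additive (R ⧸ (⊤ : Ideal R))ˣ) :=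
        inferInstanceAs (Finite (R ⧸ (⊤ : Ideal R))ˣ)
      infer_instance
    | cons p Z ih =>
      rw [Multiset.map_cons, Multiset.prod_cons]
      have : IsNoetherian ℤ (Additive (R ⧸ p.asIdeal)ˣ) := isNoetherian_units_of_isDomain
      exact isNoetherian_units_quotient_mul _ _
  have := key Z
  have hinj : Function.Injective (Ideal.Quotient.mk (Z.map PrimeSpectrum.asIdeal).prod) :=
    (RingHom.injective_iff_ker_eq_bot _).2 (by rw [Ideal.mk_ker]; exact le_bot_iff.1 hZ)
  exact isNoetherian_additive_of_injective (Units.map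
    (Ideal.Quotient.mk (Z.map PrimeSpectrum.asIdeal).prod).toMonoidHom) (Units.map_injective hinj)

end Units

/-! ### Abelian subgroups -/

/-- A finitely generated abelian group is a direct sum of cyclic groups. -/
lemma IsDirectSumOfCyclic.of_fg {A : Type} [CommGroup A] (h : AddGroup.FG (Additive A)) :
    IsDirectSumOfCyclic A := by
  classical
  obtain ⟨m, κ, _, p, -, e, ⟨f⟩⟩ := AddCommGroup.equiv_free_prod_directSum_zmod (Additive A)
  let n : Fin m ⊕ κ → ℕ := Sum.elim (fun _ => 0) fun i => p i ^ e i
  let g₁ : (Fin m →₀ ℤ) ≃+ ∀ i : Fin m, ZMod (n (Sum.inl i)) := Finsupp.addEquivFunOnFinite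
  let g₂ : (DirectSum κ fun i => ZMod (p i ^ e i)) ≃+ ∀ i : κ, ZMod (n (Sum.inr i)) :=
    DirectSum.addEquivProd _
  let g₃ : ((∀ i : Fin m, ZMod (n (Sum.inl i))) × ∀ i : κ, ZMod (n (Sum.inr i))) ≃+
      ∀ i, ZMod (n i) :=
    { (Equiv.sumPiEquivProdPi fun i => ZMod (n i)).symm with
      map_add' := fun x y => by ext (i | i) <;> rfl }
  let g := (f.trans (g₁.prodCongr g₂)).trans (g₃.trans (DirectSum.addEquivProd _).symm)
  exact ⟨Fin m ⊕ κ, n, ⟨AddEquiv.toMultiplicativeRight g⟩⟩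

/-- A commutative group embedding multiplicatively into a ring that is a noetherian abelian group
is finitely generated. -/
lemma isNoetherian_of_injective_ring {A R : Type*} [CommGroup A] [Ring R] [IsNoetherian ℤ R]
    (f : A →* R) (hf : Function.Injective f) : IsNoetherian ℤ (Additive A) := by
  let S := Algebra.adjoin ℤ (Set.range f)
  have : IsMulCommutative S := Algebra.isMulCommutative_adjoin ℤ (by
    rintro _ ⟨a, rfl⟩ _ ⟨b, rfl⟩
    rw [← map_mul, mul_comm, map_mul])
  let : CommRing S :=
    { (inferInstance : Ring S) with mul_comm := this.is_comm.comm }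
  have : Module.Finite ℤ S := by
    have : IsNoetherian ℤ S := isNoetherian_submodule' (Subalgebra.toSubmodule S)
    infer_instance
  have := isNoetherian_units (R := S)
  let f' : A →* S := f.codRestrict S fun a => Algebra.subset_adjoin ⟨a, rfl⟩
  refine isNoetherian_additive_of_injective (f'.toHomUnits) fun a b hab => hf ?_
  exact congrArg (fun u : Sˣ => ((u : S) : R)) hab

/-- Abelian subgroups of the outer automorphism group are finitely generated. -/
theorem fg_of_comm {ι : Type*} [DecidableEq ι] [Fintype ι]
    (A : Subgroup (OuterAutomorphismGroup (FreeGroup ι))) (hA : ∀ x ∈ A, ∀ y ∈ A, x * y = y * x) :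
    AddGroup.FG (Additive A) := by
  let : CommGroup A :=
    { (inferInstance : Group A) with mul_comm := fun x y => Subtype.ext (hA x x.2 y y.2) }
  obtain ⟨k, hk⟩ := exists_faithful A hA
  have : Module.Free ℤ (classFun (FreeGroup ι) k) := Module.free_of_finite_type_torsion_free'
  have : IsNoetherian ℤ (Additive A) :=
    isNoetherian_of_injective_ring ((outClassFun (FreeGroup ι) k).comp A.subtype)
      ((injective_iff_map_eq_one _).2 fun x hx => Subtype.ext (hk x x.2 hx))
  exact Module.Finite.iff_addGroup_fg.1 inferInstance

/-- `Out(F_n)` belongs to the class `𝒢`: every torsion subgroup is finite and every abelian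
subgroup is finitely generated (hence a direct sum of cyclic groups). -/
theorem Out_free_in_classG (n : ℕ) (hn : 1 ≤ n) :
    InClassG (OuterAutomorphismGroup (FreeGroup (Fin n))) ∧
      ∀ A : Subgroup (OuterAutomorphismGroup (FreeGroup (Fin n))),
        (∀ x ∈ A, ∀ y ∈ A, x * y = y * x) → A.FG := by
  have key : ∀ A : Subgroup (OuterAutomorphismGroup (FreeGroup (Fin n))),
      (∀ x ∈ A, ∀ y ∈ A, x * y = y * x) → IsDirectSumOfCyclic A ∧ A.FG := by
    intro A hA
    have hfg := fg_of_comm A hA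
    let : CommGroup A :=
      { (inferInstance : Group A) with mul_comm := fun x y => Subtype.ext (hA x x.2 y y.2) }
    exact ⟨.of_fg hfg, (Group.fg_iff_subgroup_fg A).1 (GroupFG.iff_add_fg.2 hfg)⟩
  exact ⟨⟨finite_of_torsion, fun A hA => (key A hA).1⟩, fun A hA => (key A hA).2⟩
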